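/- Every smooth ternary quartic f ∈ ℝ[x,y,z] has exactly 36 inequivalent linear symmetric determinantal representations: the set of equivalence classes of triples (A,B,C) of complex symmetric 4×4 matrices with det(xA + yB + zC) = f (as polynomials in ℂ[x,y,z]) has exactly 36 elements, where (A,B,C) and (A′,B′,C′) are equivalent if there exists T ∈ GL₄(ℂ) with A′ = T·A·Tᵀ, B′ = T·B·Tᵀ and C′ = T·C·Tᵀ. -/

import Mathlib

open MvPolynomial Matrix

/-- `f` is smooth: no nonzero complex point at which all partial derivatives of the
complexification of `f` vanish. -/
def IsSmooth (f : MvPolynomial (Fin 3) ℝ) : Prop :=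
  ∀ a : Fin 3 → ℂ,
    (∀ i, eval a (pderiv i (map (algebraMap ℝ ℂ) f)) = 0) → a = 0

/-- The matrix pencil `xA + yB + zC` with entries in `ℂ[x,y,z]`. -/
noncomputable def pencil (A B C : Matrix (Fin 4) (Fin 4) ℂ) :
    Matrix (Fin 4) (Fin 4) (MvPolynomial (Fin 3) ℂ) :=
  Matrix.of fun i j =>
    MvPolynomial.C (A i j) * X 0 + MvPolynomial.C (B i j) * X 1 +
      MvPolynomial.C (C i j) * X 2

/-- `(A,B,C)` is a linear symmetric determinantal representation of `f`:
`A,B,C` are symmetric complex `4×4` matrices and `det(xA+yB+zC) = f` in `ℂ[x,y,z]`. -/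
def IsLSDR (f : MvPolynomial (Fin 3) ℝ)
    (t : Matrix (Fin 4) (Fin 4) ℂ × Matrix (Fin 4) (Fin 4) ℂ ×
      Matrix (Fin 4) (Fin 4) ℂ) : Prop :=
  t.1.IsSymm ∧ t.2.1.IsSymm ∧ t.2.2.IsSymm ∧
    (pencil t.1 t.2.1 t.2.2).det = map (algebraMap ℝ ℂ) f

/-- Equivalence of determinantal representations: conjugation by `T ∈ GL₄(ℂ)`,
`(A,B,C) ↦ (TATᵀ, TBTᵀ, TCTᵀ)`. -/
def LSDREquiv
    (t t' : Matrix (Fin 4) (Fin 4) ℂ × Matrix (Fin 4) (Fin 4) ℂ ×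
      Matrix (Fin 4) (Fin 4) ℂ) : Prop :=
  ∃ T : Matrix (Fin 4) (Fin 4) ℂ, IsUnit T.det ∧
    t'.1 = T * t.1 * Tᵀ ∧ t'.2.1 = T * t.2.1 * Tᵀ ∧ t'.2.2 = T * t.2.2 * Tᵀ

/-- `F` is a polynomial function. -/
def IsPolyF (F : (Fin 3 → ℂ) → ℂ) : Prop := ∃ P : MvPolynomial (Fin 3) ℂ, ∀ X, F X = eval X P

/-- `F` is given by a homogeneous polynomial of degree `n`. -/
def IsForm (n : ℕ) (F : (Fin 3 → ℂ) → ℂ) : Prop :=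
  ∃ P : MvPolynomial (Fin 3) ℂ, P.IsHomogeneous n ∧ ∀ X, F X = eval X P

/-- No nonzero singular point. -/
def SmoothF (F : (Fin 3 → ℂ) → ℂ) : Prop :=
  ∀ P : MvPolynomial (Fin 3) ℂ, (∀ X, F X = eval X P) → ∀ a : Fin 3 → ℂ,
    (∀ i, eval a (pderiv i P) = 0) → a = 0

theorem IsForm.isPoly {n F} (h : IsForm n F) : IsPolyF F := let ⟨P, _, h⟩ := h; ⟨P, h⟩

theorem IsForm.congr {n F G} (h : IsForm n F) (e : ∀ X, G X = F X) : IsForm n G := by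
  obtain ⟨P, hP, h⟩ := h
  exact ⟨P, hP, fun X => (e X).trans (h X)⟩

theorem IsPolyF.congr {F G} (h : IsPolyF F) (e : ∀ X, G X = F X) : IsPolyF G := by
  obtain ⟨P, h⟩ := h
  exact ⟨P, fun X => (e X).trans (h X)⟩

theorem IsForm.add {n F G} (h : IsForm n F) (h' : IsForm n G) : IsForm n (fun X => F X + G X) := by
  obtain ⟨P, hP, h⟩ := h
  obtain ⟨Q, hQ, h'⟩ := h'
  exact ⟨P + Q, hP.add hQ, fun X => by simp [h, h']⟩

theorem IsForm.sub {n F G} (h : IsForm n F) (h' : IsForm n G) : IsForm n (fun X => F X - G X) := by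
  obtain ⟨P, hP, h⟩ := h
  obtain ⟨Q, hQ, h'⟩ := h'
  exact ⟨P - Q, hP.sub hQ, fun X => by simp [h, h']⟩

theorem IsForm.neg {n F} (h : IsForm n F) : IsForm n (fun X => - F X) := by
  obtain ⟨P, hP, h⟩ := h
  exact ⟨-P, hP.neg, fun X => by simp [h]⟩

theorem IsForm.mul {m n F G} (h : IsForm m F) (h' : IsForm n G) :
    IsForm (m + n) (fun X => F X * G X) := by
  obtain ⟨P, hP, h⟩ := h
  obtain ⟨Q, hQ, h'⟩ := h'
  exact ⟨P * Q, hP.mul hQ, fun X => by simp [h, h']⟩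

theorem IsForm.pow {m F} (h : IsForm m F) (n : ℕ) :
    IsForm (m * n) (fun X => F X ^ n) := by
  obtain ⟨P, hP, h⟩ := h
  exact ⟨P ^ n, hP.pow n, fun X => by simp [h]⟩

theorem IsForm.smul {n F} (h : IsForm n F) (c : ℂ) : IsForm n (fun X => c * F X) := by
  obtain ⟨P, hP, h⟩ := h
  exact ⟨MvPolynomial.C c * P, hP.C_mul c, fun X => by simp [h]⟩

theorem isForm_zero (n) : IsForm n (fun _ => 0) := ⟨0, isHomogeneous_zero _ _ _, by simp⟩

theorem isForm_const (c : ℂ) : IsForm 0 (fun _ => c) :=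
  ⟨MvPolynomial.C c, isHomogeneous_C _ _, by simp⟩

theorem isForm_X (i : Fin 3) : IsForm 1 (fun X => X i) :=
  ⟨MvPolynomial.X i, isHomogeneous_X _ _, by simp⟩

theorem isForm_dot (l : Fin 3 → ℂ) : IsForm 1 (fun X => l ⬝ᵥ X) := by
  refine (((isForm_X 0).smul (l 0)).add (((isForm_X 1).smul (l 1)).add
    ((isForm_X 2).smul (l 2)))).congr fun X => ?_
  simp [dotProduct, Fin.sum_univ_three, add_assoc]

theorem IsForm.comp {m n F} (h : IsForm m F) (G : (Fin 3 → ℂ) → Fin 3 → ℂ)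
    (hG : ∀ i, IsForm n (fun X => G X i)) : IsForm (n * m) (fun X => F (G X)) := by
  obtain ⟨P, hP, h⟩ := h
  choose Q hQ h' using hG
  refine ⟨aeval Q P, ?_, fun X => ?_⟩
  · exact hP.aeval Q hQ
  · show F (G X) = _
    rw [h]
    have : eval X (aeval Q P) = eval (fun i => eval X (Q i)) P := by
      rw [← MvPolynomial.coe_aeval_eq_eval, ← MvPolynomial.coe_aeval_eq_eval]
      simp only [RingHom.coe_coe]
      rw [← AlgHom.comp_apply, comp_aeval]
    rw [this]
    congr 2
    funext i
    exact h' i X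

theorem IsForm.comp1 {m F} (h : IsForm m F) (G : (Fin 3 → ℂ) → Fin 3 → ℂ)
    (hG : ∀ i, IsForm 1 (fun X => G X i)) : IsForm m (fun X => F (G X)) := by
  have := h.comp G hG
  rwa [one_mul] at this

theorem IsForm.homog {n F} (h : IsForm n F) (c : ℂ) (X) : F (c • X) = c ^ n * F X := by
  obtain ⟨P, hP, h⟩ := h
  rw [h, h]
  have : ∀ d ∈ P.support, (∏ i, (c • X) i ^ d i) = c ^ n * ∏ i, X i ^ d i := by
    intro d hd
    have := hP.degree_eq_sum_deg_support hd
    simp only [Pi.smul_apply, smul_eq_mul, mul_pow, Finset.prod_mul_distrib]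
    rw [Finset.prod_pow_eq_pow_sum]
    congr 2
    rw [this]
    exact (Finset.sum_subset (Finset.subset_univ _) fun i _ hi => by simpa using hi).symm
  rw [eval_eq', eval_eq', Finset.mul_sum]
  refine Finset.sum_congr rfl fun d hd => ?_
  rw [this d hd]; ring

theorem IsForm.zero_of_pos {n F} (h : IsForm n F) (hn : 0 < n) : F 0 = 0 := by
  have := h.homog 0 0
  rw [zero_smul, zero_pow hn.ne', zero_mul] at this
  exact this

theorem isForm0_const {F} (h : IsForm 0 F) : ∃ c, ∀ X, F X = c :=
  ⟨F 0, fun X => by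
    have := h.homog 0 X
    rw [zero_smul, pow_zero, one_mul] at this
    exact this.symm⟩

theorem IsForm.euler {n F} (h : IsForm (n + 1) F) : ∃ A B D, IsForm n A ∧ IsForm n B ∧ IsForm n D ∧
    ∀ X, F X = X 0 * A X + X 1 * B X + X 2 * D X := by
  obtain ⟨P, hP, h⟩ := h
  have hp : ∀ i, (pderiv i P).IsHomogeneous n := fun i => hP.pderiv
  have e := hP.sum_X_mul_pderiv
  refine ⟨_, _, _, (IsForm.smul ⟨_, hp 0, fun X => rfl⟩ ((n + 1 : ℂ)⁻¹)),
    (IsForm.smul ⟨_, hp 1, fun X => rfl⟩ ((n + 1 : ℂ)⁻¹)),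
    (IsForm.smul ⟨_, hp 2, fun X => rfl⟩ ((n + 1 : ℂ)⁻¹)), fun X => ?_⟩
  have e' := congrArg (eval X) e
  simp [Fin.sum_univ_three] at e'
  have : (n + 1 : ℂ) ≠ 0 := by exact_mod_cast n.succ_ne_zero
  rw [h]
  field_simp
  rw [e', mul_comm]

theorem IsForm.lin {F} (h : IsForm 1 F) : ∃ l : Fin 3 → ℂ, ∀ X, F X = l ⬝ᵥ X := by
  obtain ⟨A, B, D, hA, hB, hD, h⟩ := h.euler
  obtain ⟨a, hA⟩ := isForm0_const hA
  obtain ⟨b, hB⟩ := isForm0_const hB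
  obtain ⟨d, hD⟩ := isForm0_const hD
  refine ⟨![a, b, d], fun X => ?_⟩
  rw [h, hA, hB, hD]; simp [dotProduct, Fin.sum_univ_three]; ring

theorem IsForm.quad {F} (h : IsForm 2 F) : ∃ S : Matrix (Fin 3) (Fin 3) ℂ, S.IsSymm ∧
    ∀ X, F X = X ⬝ᵥ (S *ᵥ X) := by
  obtain ⟨A, B, D, hA, hB, hD, h⟩ := h.euler
  obtain ⟨a, hA⟩ := hA.lin
  obtain ⟨b, hB⟩ := hB.lin
  obtain ⟨d, hD⟩ := hD.lin
  refine ⟨!![a 0, (a 1 + b 0)/2, (a 2 + d 0)/2; (a 1 + b 0)/2, b 1, (b 2 + d 1)/2;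
    (a 2 + d 0)/2, (b 2 + d 1)/2, d 2], ?_, fun X => ?_⟩
  · ext i j; fin_cases i <;> fin_cases j <;> rfl
  · rw [h, hA, hB, hD]; simp [dotProduct, mulVec, Fin.sum_univ_three]; ring

theorem isForm_quad (S : Matrix (Fin 3) (Fin 3) ℂ) : IsForm 2 (fun X => X ⬝ᵥ (S *ᵥ X)) := by
  refine (((isForm_X 0).mul (isForm_dot (S 0))).add (((isForm_X 1).mul (isForm_dot (S 1))).add
    ((isForm_X 2).mul (isForm_dot (S 2))))).congr fun X => ?_
  simp [dotProduct, mulVec, Fin.sum_univ_three]; ring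

theorem poly_domain {F G} (hF : IsPolyF F) (hG : IsPolyF G) (h : ∀ X, F X * G X = 0) :
    (∀ X, F X = 0) ∨ (∀ X, G X = 0) := by
  obtain ⟨P, hP⟩ := hF
  obtain ⟨Q, hQ⟩ := hG
  have : P * Q = 0 := by
    apply MvPolynomial.funext
    intro X
    simp [← hP, ← hQ, h]
  rcases mul_eq_zero.1 this with h | h
  · left; intro X; simp [hP, h]
  · right; intro X; simp [hQ, h]

theorem exists_dot_one {l : Fin 3 → ℂ} (hl : l ≠ 0) : ∃ v : Fin 3 → ℂ, l ⬝ᵥ v = 1 := by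
  obtain ⟨i, hi⟩ := Function.ne_iff.1 hl
  refine ⟨Pi.single i (l i)⁻¹, ?_⟩
  rw [dotProduct_single]
  exact mul_inv_cancel₀ hi

theorem isForm_proj (l v : Fin 3 → ℂ) (i) : IsForm 1 (fun X => (X - (l ⬝ᵥ X) • v) i) := by
  refine ((isForm_X i).sub ((isForm_dot l).smul (v i))).congr fun X => ?_
  simp [mul_comm]

theorem proj_mem {l v : Fin 3 → ℂ} (hv : l ⬝ᵥ v = 1) (X) : l ⬝ᵥ (X - (l ⬝ᵥ X) • v) = 0 := by
  rw [dotProduct_sub, dotProduct_smul, hv]; simp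

theorem plane_domain {l : Fin 3 → ℂ} (hl : l ≠ 0) {m n F G} (hF : IsForm m F) (hG : IsForm n G)
    (h : ∀ X, l ⬝ᵥ X = 0 → F X * G X = 0) :
    (∀ X, l ⬝ᵥ X = 0 → F X = 0) ∨ (∀ X, l ⬝ᵥ X = 0 → G X = 0) := by
  obtain ⟨v, hv⟩ := exists_dot_one hl
  have := poly_domain (hF.comp1 _ (isForm_proj l v)).isPoly (hG.comp1 _ (isForm_proj l v)).isPoly
    (fun X => h _ (proj_mem hv X))
  refine this.imp (fun h X hX => ?_) (fun h X hX => ?_) <;>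
  · have := h X
    rw [hX] at this
    simpa using this

theorem homogeneousComponent_mul_left {a n : ℕ} {P R : MvPolynomial (Fin 3) ℂ}
    (hP : P.IsHomogeneous a) :
    homogeneousComponent (a + n) (P * R) = P * homogeneousComponent n R := by
  let _ : GradedRing (homogeneousSubmodule (Fin 3) ℂ) := MvPolynomial.gradedAlgebra
  have hh := DirectSum.coe_decompose_mul_add_of_left_mem (homogeneousSubmodule (Fin 3) ℂ)
    (a := P) (b := R) (i := a) (j := n) hP
  have e : ∀ (Q : MvPolynomial (Fin 3) ℂ) m,
    ((DirectSum.decompose (homogeneousSubmodule (Fin 3) ℂ)) Q m : MvPolynomial (Fin 3) ℂ) =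
      homogeneousComponent m Q := fun Q m => decomposition.decompose'_apply Q m
  rw [e, e] at hh
  exact hh

theorem IsForm.div {l : Fin 3 → ℂ} (hl : l ≠ 0) {n F} (hF : IsForm (n + 1) F)
    (h : ∀ X, l ⬝ᵥ X = 0 → F X = 0) : ∃ G, IsForm n G ∧ ∀ X, F X = (l ⬝ᵥ X) * G X := by
  obtain ⟨v, hv⟩ := exists_dot_one hl
  obtain ⟨P, hP, hF⟩ := hF
  let L : MvPolynomial (Fin 3) ℂ := ∑ i, MvPolynomial.C (l i) * MvPolynomial.X i
  have hL : L.IsHomogeneous 1 := IsHomogeneous.sum _ _ _ fun i _ => isHomogeneous_C_mul_X _ _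
  have hLe : ∀ X, eval X L = l ⬝ᵥ X := fun X => by simp [L, dotProduct]
  let Q : MvPolynomial (Fin 3) ℂ := aeval (fun i => MvPolynomial.X i - L * MvPolynomial.C (v i)) P
  have hQ0 : Q = 0 := by
    apply MvPolynomial.funext
    intro X
    have : eval X Q = eval (X - (l ⬝ᵥ X) • v) P := by
      simp only [Q]
      rw [← MvPolynomial.coe_aeval_eq_eval, ← MvPolynomial.coe_aeval_eq_eval]
      simp only [RingHom.coe_coe]
      rw [← AlgHom.comp_apply, comp_aeval]
      congr 2
      funext i
      simp [hLe, MvPolynomial.aeval_def]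
    rw [this, ← hF, h _ (proj_mem hv X), map_zero]
  have hmem : P - Q ∈ Ideal.span {L} := by
    rw [← Ideal.Quotient.eq]
    have : ((Ideal.Quotient.mkₐ ℂ (Ideal.span {L})).comp
        (aeval (fun i => MvPolynomial.X i - L * MvPolynomial.C (v i)))) =
        (Ideal.Quotient.mkₐ ℂ (Ideal.span {L})) := by
      ext i
      simp only [AlgHom.comp_apply, aeval_X, Ideal.Quotient.mkₐ_eq_mk]
      rw [Ideal.Quotient.eq]
      simp only [sub_sub_cancel_left]
      exact neg_mem (Ideal.mul_mem_right _ _ (Ideal.subset_span rfl))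
    exact (DFunLike.congr_fun this P).symm
  rw [hQ0, sub_zero, Ideal.mem_span_singleton] at hmem
  obtain ⟨R, hR⟩ := hmem
  refine ⟨fun X => eval X (homogeneousComponent n R), ⟨_, homogeneousComponent_isHomogeneous _ _,
    fun X => rfl⟩, fun X => ?_⟩
  have hh := homogeneousComponent_mul_left (n := n) (R := R) hL
  rw [← hR, homogeneousComponent_eq_self (by rw [add_comm]; exact hP)] at hh
  rw [hF, hh, map_mul, hLe]

/-- A sum of products of functions vanishing at `a` is singular at `a`. -/
theorem SmoothF.sing {F} (hS : SmoothF F) {g₁ h₁ g₂ h₂ g₃ h₃ : (Fin 3 → ℂ) → ℂ}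
    (k : ℂ) (hk : k ≠ 0)
    (G1 : IsPolyF g₁) (H1 : IsPolyF h₁) (G2 : IsPolyF g₂) (H2 : IsPolyF h₂) (G3 : IsPolyF g₃)
    (H3 : IsPolyF h₃) (hF : ∀ X, k * F X = g₁ X * h₁ X + g₂ X * h₂ X + g₃ X * h₃ X)
    {a : Fin 3 → ℂ} (e1 : g₁ a = 0) (e2 : h₁ a = 0) (e3 : g₂ a = 0) (e4 : h₂ a = 0)
    (e5 : g₃ a = 0) (e6 : h₃ a = 0) : a = 0 := by
  obtain ⟨p1, G1⟩ := G1
  obtain ⟨p2, H1⟩ := H1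
  obtain ⟨p3, G2⟩ := G2
  obtain ⟨p4, H2⟩ := H2
  obtain ⟨p5, G3⟩ := G3
  obtain ⟨p6, H3⟩ := H3
  apply hS (MvPolynomial.C k⁻¹ * (p1 * p2 + p3 * p4 + p5 * p6))
  · intro X
    simp [← G1, ← H1, ← G2, ← H2, ← G3, ← H3, ← hF, hk]
  · intro i
    simp [Derivation.leibniz, ← G1, ← H1, ← G2, ← H2, ← G3, ← H3, e1, e2, e3, e4, e5, e6]

theorem isPoly_zero : IsPolyF (fun _ => 0) := ⟨0, by simp⟩

theorem SmoothF.sing2 {F} (hS : SmoothF F) {g₁ h₁ g₂ h₂ : (Fin 3 → ℂ) → ℂ}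
    (k : ℂ) (hk : k ≠ 0)
    (G1 : IsPolyF g₁) (H1 : IsPolyF h₁) (G2 : IsPolyF g₂) (H2 : IsPolyF h₂)
    (hF : ∀ X, k * F X = g₁ X * h₁ X + g₂ X * h₂ X)
    {a : Fin 3 → ℂ} (e1 : g₁ a = 0) (e2 : h₁ a = 0) (e3 : g₂ a = 0) (e4 : h₂ a = 0) : a = 0 :=
  hS.sing k hk G1 H1 G2 H2 isPoly_zero isPoly_zero (fun X => by rw [hF]; ring) e1 e2 e3 e4 rfl rfl

/-- A form of positive degree has a zero on every line. -/
theorem IsForm.line_zero {n F} (hF : IsForm n F) (hn : 0 < n) (Y Z : Fin 3 → ℂ) :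
    ∃ s t : ℂ, (s ≠ 0 ∨ t ≠ 0) ∧ F (s • Y + t • Z) = 0 := by
  obtain ⟨P, hP, h⟩ := id hF
  let p : Polynomial ℂ := aeval (fun i => Polynomial.C (Y i) + Polynomial.X * Polynomial.C (Z i)) P
  have hp : ∀ s, p.eval s = F (Y + s • Z) := by
    intro s
    rw [h]
    simp only [p]
    rw [← Polynomial.coe_aeval_eq_eval, ← MvPolynomial.coe_aeval_eq_eval]
    simp only [RingHom.coe_coe]
    rw [← AlgHom.comp_apply, comp_aeval]
    congr 2
    funext i
    simp only [map_add, map_mul, Polynomial.aeval_C, Polynomial.aeval_X, Pi.add_apply, Pi.smul_apply,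
      smul_eq_mul, Algebra.algebraMap_self_apply]
  by_cases hd : p.degree = 0
  · obtain ⟨c, hc⟩ : ∃ c, p = Polynomial.C c := ⟨_, Polynomial.eq_C_of_degree_eq_zero hd⟩
    let q : Polynomial ℂ := aeval (fun i => Polynomial.C (Z i) + Polynomial.X * Polynomial.C (Y i)) P
    have hq : ∀ s, q.eval s = F (Z + s • Y) := by
      intro s
      rw [h]
      simp only [q]
      rw [← Polynomial.coe_aeval_eq_eval, ← MvPolynomial.coe_aeval_eq_eval]
      simp only [RingHom.coe_coe]
      rw [← AlgHom.comp_apply, comp_aeval]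
      congr 2
      funext i
      simp only [map_add, map_mul, Polynomial.aeval_C, Polynomial.aeval_X, Pi.add_apply, Pi.smul_apply,
      smul_eq_mul, Algebra.algebraMap_self_apply]
    have : q * Polynomial.X = Polynomial.C c * Polynomial.X ^ n * Polynomial.X := by
      apply Polynomial.funext
      intro s
      rcases eq_or_ne s 0 with rfl | hs
      · simp
      simp only [Polynomial.eval_mul, hq, Polynomial.eval_X, Polynomial.eval_C, Polynomial.eval_pow]
      have e : Z + s • Y = s • (Y + s⁻¹ • Z) := by
        rw [smul_add, smul_smul, mul_inv_cancel₀ hs, one_smul, add_comm]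
      rw [e, hF.homog, ← hp, hc, Polynomial.eval_C]
      ring
    have := mul_right_cancel₀ Polynomial.X_ne_zero this
    refine ⟨0, 1, Or.inr one_ne_zero, ?_⟩
    have := congrArg (Polynomial.eval 0) this
    rw [hq] at this
    simpa [hn.ne'] using this
  · obtain ⟨s, hs⟩ := IsAlgClosed.exists_root p hd
    refine ⟨1, s, Or.inl one_ne_zero, ?_⟩
    rw [one_smul, ← hp]
    exact hs

theorem eval_translate (a X : Fin 3 → ℂ) (P : MvPolynomial (Fin 3) ℂ) :
    aeval X (aeval (fun i => MvPolynomial.X i - MvPolynomial.C (a i)) P :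
      MvPolynomial (Fin 3) ℂ) = eval (X - a) P := by
  rw [← MvPolynomial.coe_aeval_eq_eval]
  simp only [RingHom.coe_coe]
  rw [← AlgHom.comp_apply, comp_aeval]
  congr 2
  funext i
  simp [MvPolynomial.aeval_def]

/-- Two ternary forms of positive degree have a common nontrivial zero. -/
theorem common_zero {m n : ℕ} {F G} (hF : IsForm m F) (hG : IsForm n G) (hm : 0 < m) (hn : 0 < n) :
    ∃ X : Fin 3 → ℂ, X ≠ 0 ∧ F X = 0 ∧ G X = 0 := by
  by_contra! hno
  have hF0 := hF.zero_of_pos hm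
  have hG0 := hG.zero_of_pos hn
  obtain ⟨P, hP, hFP⟩ := hF
  obtain ⟨Q, hQ, hGQ⟩ := hG
  have hdim : ringKrullDim (MvPolynomial (Fin 3) ℂ) ≤ 2 := by
    rw [ringKrullDim_le_iff_isMaximal_height_le]
    intro M hM
    obtain ⟨a, rfl⟩ := isMaximal_iff_eq_vanishingIdeal_singleton.1 hM
    let P' : MvPolynomial (Fin 3) ℂ := aeval (fun i => MvPolynomial.X i - MvPolynomial.C (a i)) P
    let Q' : MvPolynomial (Fin 3) ℂ := aeval (fun i => MvPolynomial.X i - MvPolynomial.C (a i)) Q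
    have hz : zeroLocus ℂ (Ideal.span {P', Q'}) = {a} := by
      rw [zeroLocus_span]
      ext X
      simp only [Set.mem_insert_iff, Set.mem_singleton_iff, forall_eq_or_imp, forall_eq,
        Set.mem_ofPred_eq, P', Q', eval_translate]
      rw [← hFP, ← hGQ]
      constructor
      · rintro ⟨h1, h2⟩
        by_contra hne
        exact hno (X - a) (sub_ne_zero.2 hne) h1 h2
      · rintro rfl
        simp [hF0, hG0]
    have hr := vanishingIdeal_zeroLocus_eq_radical (k := ℂ) (K := ℂ) (Ideal.span {P', Q'})
    rw [hz] at hr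
    have hmin : vanishingIdeal ℂ {a} ∈ (Ideal.span {P', Q'}).minimalPrimes := by
      refine ⟨⟨hM.isPrime, ?_⟩, ?_⟩
      · rw [hr]; exact Ideal.le_radical
      · rintro J ⟨hJ, hle⟩ -
        rw [hr]
        exact hJ.radical_le_iff.2 hle
    have h1 := Ideal.height_le_card_of_mem_minimalPrimes_span (Set.toFinite _) hmin
    have h2 : ({P', Q'} : Set (MvPolynomial (Fin 3) ℂ)).ncard ≤ 2 := Set.ncard_insert_le _ _ |>.trans (by simp)
    have h3 := h1.trans (Nat.cast_le.2 h2)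
    exact (WithBot.coe_le_coe.2 h3 :)
  rw [MvPolynomial.ringKrullDim_of_isNoetherianRing, ringKrullDim_eq_zero_of_field, zero_add] at hdim
  simp only [Nat.card_eq_fintype_card, Fintype.card_fin] at hdim
  exact absurd hdim (by decide)

section Quartic
variable {R : Type*} [CommRing R]

/-- The general ternary quartic. -/
def q4 (c : Fin 15 → R) (x y z : R) : R :=
    c 0 * x ^ 4 + c 1 * x ^ 3 * y + c 2 * x ^ 3 * z + c 3 * x ^ 2 * y ^ 2 + c 4 * x ^ 2 * y * z +
      c 5 * x ^ 2 * z ^ 2 + c 6 * x * y ^ 3 + c 7 * x * y ^ 2 * z + c 8 * x * y * z ^ 2 +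
      c 9 * x * z ^ 3 + c 10 * y ^ 4 + c 11 * y ^ 3 * z + c 12 * y ^ 2 * z ^ 2 +
      c 13 * y * z ^ 3 + c 14 * z ^ 4

/-- Partial derivatives of the general quartic. -/
def q4x (c : Fin 15 → R) (x y z : R) : R :=
    c 0 * (4 * x ^ 3) + c 1 * (3 * x ^ 2 * y) + c 2 * (3 * x ^ 2 * z) + c 3 * (2 * x * y ^ 2) + c 4 * (2 * x * y * z) + c 5 * (2 * x * z ^ 2) + c 6 * (y ^ 3) + c 7 * (y ^ 2 * z) + c 8 * (y * z ^ 2) + c 9 * (z ^ 3)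

/-- Partial derivatives of the general quartic. -/
def q4y (c : Fin 15 → R) (x y z : R) : R :=
    c 1 * (x ^ 3) + c 3 * (2 * x ^ 2 * y) + c 4 * (x ^ 2 * z) + c 6 * (3 * x * y ^ 2) + c 7 * (2 * x * y * z) + c 8 * (x * z ^ 2) + c 10 * (4 * y ^ 3) + c 11 * (3 * y ^ 2 * z) + c 12 * (2 * y * z ^ 2) + c 13 * (z ^ 3)

/-- Partial derivatives of the general quartic. -/
def q4z (c : Fin 15 → R) (x y z : R) : R :=
    c 2 * (x ^ 3) + c 4 * (x ^ 2 * y) + c 5 * (2 * x ^ 2 * z) + c 7 * (x * y ^ 2) + c 8 * (2 * x * y * z) + c 9 * (3 * x * z ^ 2) + c 11 * (y ^ 3) + c 12 * (2 * y ^ 2 * z) + c 13 * (3 * y * z ^ 2) + c 14 * (4 * z ^ 3)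

/-- Second polar. -/
def q4A (c : Fin 15 → R) (x y z u v w : R) : R :=
    c 0 * 6 * x ^ 2 * u ^ 2 + c 1 * (3 * x ^ 2 * u * v + 3 * x * y * u ^ 2) +
      c 2 * (3 * x ^ 2 * u * w + 3 * x * z * u ^ 2) +
      c 3 * (x ^ 2 * v ^ 2 + 4 * x * y * u * v + y ^ 2 * u ^ 2) +
      c 4 * (x ^ 2 * v * w + 2 * x * y * u * w + 2 * x * z * u * v + y * z * u ^ 2) +
      c 5 * (x ^ 2 * w ^ 2 + 4 * x * z * u * w + z ^ 2 * u ^ 2) +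
      c 6 * (3 * x * y * v ^ 2 + 3 * y ^ 2 * u * v) +
      c 7 * (2 * x * y * v * w + x * z * v ^ 2 + y ^ 2 * u * w + 2 * y * z * u * v) +
      c 8 * (x * y * w ^ 2 + 2 * x * z * v * w + 2 * y * z * u * w + z ^ 2 * u * v) +
      c 9 * (3 * x * z * w ^ 2 + 3 * z ^ 2 * u * w) + c 10 * 6 * y ^ 2 * v ^ 2 +
      c 11 * (3 * y ^ 2 * v * w + 3 * y * z * v ^ 2) +
      c 12 * (y ^ 2 * w ^ 2 + 4 * y * z * v * w + z ^ 2 * v ^ 2) +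
      c 13 * (3 * y * z * w ^ 2 + 3 * z ^ 2 * v * w) + c 14 * 6 * z ^ 2 * w ^ 2

/-- Third polar. -/
def q4B (c : Fin 15 → R) (x y z u v w : R) : R :=
  q4x c u v w * x + q4y c u v w * y + q4z c u v w * z

/-- First polar. -/
def q4L (c : Fin 15 → R) (x y z u v w : R) : R :=
  q4x c x y z * u + q4y c x y z * v + q4z c x y z * w

/-- Discriminant of the residual pair. -/
def q4disc (c : Fin 15 → R) (x y z u v w : R) : R :=
  q4B c x y z u v w ^ 2 - 4 * q4A c x y z u v w * q4 c u v w

/-- Discriminant in the direction of the tangent, first chart. -/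
def q4dx (c : Fin 15 → R) (x y z : R) : R :=
  q4disc c x y z 0 (q4z c x y z) (-q4y c x y z)

/-- Discriminant in the direction of the tangent, second chart. -/
def q4dy (c : Fin 15 → R) (x y z : R) : R :=
  q4disc c x y z (-q4z c x y z) 0 (q4x c x y z)

theorem q4_euler (c : Fin 15 → R) (x y z : R) :
    q4x c x y z * x + q4y c x y z * y + q4z c x y z * z = 4 * q4 c x y z := by
  simp only [q4, q4x, q4y, q4z]; ring

theorem q4_line (c : Fin 15 → R) (x y z u v w a s : R) :
    q4 c (a * x + s * u) (a * y + s * v) (a * z + s * w) =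
      a ^ 4 * q4 c x y z + a ^ 3 * s * q4L c x y z u v w + a ^ 2 * s ^ 2 * q4A c x y z u v w +
        a * s ^ 3 * q4B c x y z u v w + s ^ 4 * q4 c u v w := by
  simp only [q4, q4x, q4y, q4z, q4A, q4B, q4L]; ring

theorem q4A_sub (c : Fin 15 → R) (x y z u v w a k : R) :
    q4A c x y z (a * u + k * x) (a * v + k * y) (a * w + k * z) =
      a ^ 2 * q4A c x y z u v w + 3 * k * a * q4L c x y z u v w + 6 * k ^ 2 * q4 c x y z := by
  simp only [q4, q4x, q4y, q4z, q4A, q4L]; ring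

theorem q4B_sub (c : Fin 15 → R) (x y z u v w a k : R) :
    q4B c x y z (a * u + k * x) (a * v + k * y) (a * w + k * z) =
      a ^ 3 * q4B c x y z u v w + 2 * k * a ^ 2 * q4A c x y z u v w
        + 3 * k ^ 2 * a * q4L c x y z u v w + 4 * k ^ 3 * q4 c x y z := by
  simp only [q4, q4x, q4y, q4z, q4A, q4B, q4L]; ring

theorem q4_sub (c : Fin 15 → R) (x y z u v w a k : R) :
    q4 c (a * u + k * x) (a * v + k * y) (a * w + k * z) =
      a ^ 4 * q4 c u v w + k * a ^ 3 * q4B c x y z u v w + k ^ 2 * a ^ 2 * q4A c x y z u v w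
        + k ^ 3 * a * q4L c x y z u v w + k ^ 4 * q4 c x y z := by
  have := q4_line c x y z u v w k a
  rw [show a * u + k * x = k * x + a * u by ring, show a * v + k * y = k * y + a * v by ring,
    show a * w + k * z = k * z + a * w by ring, this]; ring

theorem q4disc_sub (c : Fin 15 → R) (x y z u v w a k : R) (hf : q4 c x y z = 0)
    (hL : q4L c x y z u v w = 0) :
    q4disc c x y z (a * u + k * x) (a * v + k * y) (a * w + k * z) =
      a ^ 6 * q4disc c x y z u v w := by
  simp only [q4disc]
  rw [q4A_sub, q4B_sub, q4_sub, hf, hL]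
  ring

theorem q4dx_dy (c : Fin 15 → R) (x y z : R) (hf : q4 c x y z = 0) :
    x ^ 6 * q4dy c x y z = y ^ 6 * q4dx c x y z := by
  have e := q4_euler c x y z
  rw [hf, mul_zero] at e
  have h1 := q4disc_sub c x y z (-q4z c x y z) 0 (q4x c x y z) x 0 hf
    (by simp only [q4L]; ring)
  have h2 := q4disc_sub c x y z 0 (q4z c x y z) (-q4y c x y z) y (-q4z c x y z) hf
    (by simp only [q4L]; ring)
  simp only [q4dx, q4dy]
  rw [← h1, ← h2]
  congr 1
  · ring
  · ring
  · linear_combination e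

theorem map_q4 {S : Type*} [CommRing S] (φ : R →+* S) (c : Fin 15 → R) (x y z : R) :
    φ (q4 c x y z) = q4 (fun i => φ (c i)) (φ x) (φ y) (φ z) := by simp [q4]

theorem map_q4x {S : Type*} [CommRing S] (φ : R →+* S) (c : Fin 15 → R) (x y z : R) :
    φ (q4x c x y z) = q4x (fun i => φ (c i)) (φ x) (φ y) (φ z) := by simp [q4x, map_ofNat]

theorem map_q4y {S : Type*} [CommRing S] (φ : R →+* S) (c : Fin 15 → R) (x y z : R) :
    φ (q4y c x y z) = q4y (fun i => φ (c i)) (φ x) (φ y) (φ z) := by simp [q4y, map_ofNat]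

theorem map_q4z {S : Type*} [CommRing S] (φ : R →+* S) (c : Fin 15 → R) (x y z : R) :
    φ (q4z c x y z) = q4z (fun i => φ (c i)) (φ x) (φ y) (φ z) := by simp [q4z, map_ofNat]

theorem map_q4A {S : Type*} [CommRing S] (φ : R →+* S) (c : Fin 15 → R) (x y z u v w : R) :
    φ (q4A c x y z u v w) = q4A (fun i => φ (c i)) (φ x) (φ y) (φ z) (φ u) (φ v) (φ w) := by
  simp [q4A, map_ofNat]

theorem map_q4disc {S : Type*} [CommRing S] (φ : R →+* S) (c : Fin 15 → R) (x y z u v w : R) :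
    φ (q4disc c x y z u v w) = q4disc (fun i => φ (c i)) (φ x) (φ y) (φ z) (φ u) (φ v) (φ w) := by
  simp [q4disc, map_ofNat, q4B, map_q4, map_q4A, map_q4x, map_q4y, map_q4z]

theorem map_q4dx {S : Type*} [CommRing S] (φ : R →+* S) (c : Fin 15 → R) (x y z : R) :
    φ (q4dx c x y z) = q4dx (fun i => φ (c i)) (φ x) (φ y) (φ z) := by
  simp [q4dx, map_q4disc, map_q4x, map_q4y, map_q4z]

theorem map_q4dy {S : Type*} [CommRing S] (φ : R →+* S) (c : Fin 15 → R) (x y z : R) :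
    φ (q4dy c x y z) = q4dy (fun i => φ (c i)) (φ x) (φ y) (φ z) := by
  simp [q4dy, map_q4disc, map_q4x, map_q4y, map_q4z]

end Quartic

theorem mem_span_of_mul_pow (g : MvPolynomial (Fin 3) ℂ) (N : ℕ)
    (h : (MvPolynomial.X 2) ^ N * g ∈ Ideal.span
      {(MvPolynomial.X 0 ^ 6 : MvPolynomial (Fin 3) ℂ), MvPolynomial.X 1 ^ 6}) :
    g ∈ Ideal.span {(MvPolynomial.X 0 ^ 6 : MvPolynomial (Fin 3) ℂ), MvPolynomial.X 1 ^ 6} := by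
  have e : ({(MvPolynomial.X 0 ^ 6 : MvPolynomial (Fin 3) ℂ), MvPolynomial.X 1 ^ 6} : Set _) =
      Set.image (fun s => monomial s (1 : ℂ)) {Finsupp.single 0 6, Finsupp.single 1 6} := by
    simp [Set.image_pair, X_pow_eq_monomial]
  rw [e, mem_ideal_span_monomial_image] at h ⊢
  intro d hd
  obtain ⟨s, hs, hle⟩ := h (Finsupp.single 2 N + d) (by
    rw [X_pow_eq_monomial, mem_support_iff, coeff_monomial_mul]
    simpa using hd)
  refine ⟨s, hs, ?_⟩
  rcases hs with rfl | rfl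
  · intro i
    fin_cases i
    · simpa using hle 0
    · simp
    · simp
  · intro i
    fin_cases i
    · simp
    · simpa using hle 1
    · simp

theorem regular_mod (f g α β : MvPolynomial (Fin 3) ℂ) (k : ℂ) (hk : k ≠ 0)
    (hf : f = MvPolynomial.C k * MvPolynomial.X 2 ^ 4 + (MvPolynomial.X 0 * α + MvPolynomial.X 1 * β))
    (h : f * g ∈ Ideal.span
      {(MvPolynomial.X 0 ^ 6 : MvPolynomial (Fin 3) ℂ), MvPolynomial.X 1 ^ 6}) :
    g ∈ Ideal.span {(MvPolynomial.X 0 ^ 6 : MvPolynomial (Fin 3) ℂ), MvPolynomial.X 1 ^ 6} := by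
  set I := Ideal.span {(MvPolynomial.X 0 ^ 6 : MvPolynomial (Fin 3) ℂ), MvPolynomial.X 1 ^ 6}
  set u : MvPolynomial (Fin 3) ℂ := MvPolynomial.X 0 * α + MvPolynomial.X 1 * β
  set z : MvPolynomial (Fin 3) ℂ := MvPolynomial.C k * MvPolynomial.X 2 ^ 4
  have hz : ∀ n, z ^ n * g - (-u) ^ n * g ∈ I := by
    intro n
    obtain ⟨w, hw⟩ := sub_dvd_pow_sub_pow z (-u) n
    rw [← sub_mul, hw, show (z - -u) * w * g = w * (f * g) by rw [hf]; ring]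
    exact I.mul_mem_left _ h
  have hu : (-u) ^ 11 ∈ I := by
    rw [neg_pow]
    apply I.mul_mem_left
    apply Ideal.add_pow_mem_of_pow_mem_of_le (m := 6) (n := 6)
    · rw [mul_pow]; exact I.mul_mem_right _ (Ideal.subset_span (by simp))
    · rw [mul_pow]; exact I.mul_mem_right _ (Ideal.subset_span (by simp))
    · norm_num
  have := I.add_mem (hz 11) (I.mul_mem_right g hu)
  rw [sub_add_cancel] at this
  apply mem_span_of_mul_pow g 44
  have h2 := I.mul_mem_left (MvPolynomial.C (k⁻¹ ^ 11)) this
  convert h2 using 1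
  simp only [z]
  have : (MvPolynomial.C k⁻¹ * MvPolynomial.C k : MvPolynomial (Fin 3) ℂ) = 1 := by
    rw [← map_mul, inv_mul_cancel₀ hk, map_one]
  rw [map_pow]
  calc _ = 1 ^ 11 * (MvPolynomial.X 2 ^ 44 * g) := by ring
    _ = _ := by rw [← this]; ring

/-- The quartic as a polynomial. -/
noncomputable def Q4P (c : Fin 15 → ℂ) : MvPolynomial (Fin 3) ℂ :=
  q4 (fun i => MvPolynomial.C (c i)) (MvPolynomial.X 0) (MvPolynomial.X 1) (MvPolynomial.X 2)

theorem eval_q4P (c : Fin 15 → ℂ) (X : Fin 3 → ℂ) : eval X (Q4P c) = q4 c (X 0) (X 1) (X 2) := by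
  rw [Q4P, map_q4]; simp

theorem isForm_q4 {n} (c : Fin 15 → ℂ) {u v w} (hu : IsForm n u) (hv : IsForm n v)
    (hw : IsForm n w) : IsForm (n * 4) (fun X => q4 c (u X) (v X) (w X)) := by
  have hQ : (Q4P c).IsHomogeneous 4 := by
    have hx := fun i => isHomogeneous_X (R := ℂ) (i : Fin 3)
    have hc := fun i => isHomogeneous_C (Fin 3) (c i)
    have mm : ∀ i j k l : ℕ, j + k + l = 4 → (MvPolynomial.C (c (Fin.ofNat 15 i)) *
        (MvPolynomial.X 0 ^ j * (MvPolynomial.X 1 ^ k * MvPolynomial.X 2 ^ l)) :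
        MvPolynomial (Fin 3) ℂ).IsHomogeneous 4 := by
      intro i j k l h
      have := (hc (Fin.ofNat 15 i)).mul (((hx 0).pow j).mul (((hx 1).pow k).mul ((hx 2).pow l)))
      convert this using 1
      omega
    have := (mm 0 4 0 0 rfl).add <| (mm 1 3 1 0 rfl).add <| (mm 2 3 0 1 rfl).add <|
      (mm 3 2 2 0 rfl).add <| (mm 4 2 1 1 rfl).add <| (mm 5 2 0 2 rfl).add <|
      (mm 6 1 3 0 rfl).add <| (mm 7 1 2 1 rfl).add <| (mm 8 1 1 2 rfl).add <|
      (mm 9 1 0 3 rfl).add <| (mm 10 0 4 0 rfl).add <| (mm 11 0 3 1 rfl).add <|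
      (mm 12 0 2 2 rfl).add <| (mm 13 0 1 3 rfl).add (mm 14 0 0 4 rfl)
    convert this using 1
    simp only [Q4P, q4, Fin.ofNat, Nat.reduceMod]
    ring!
  have h : IsForm 4 (fun X => eval X (Q4P c)) := ⟨_, hQ, fun X => rfl⟩
  refine (h.comp (fun X => ![u X, v X, w X]) (fun i => ?_)).congr fun X => ?_
  · fin_cases i
    · exact hu
    · exact hv
    · exact hw
  · simp [eval_q4P]

theorem isHomogeneous_of_scaling {N : ℕ} {P : MvPolynomial (Fin 3) ℂ}
    (h : ∀ (t : ℂ) (X : Fin 3 → ℂ), eval (t • X) P = t ^ N * eval X P) : P.IsHomogeneous N := by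
  have key : ∀ k, k ≠ N → homogeneousComponent k P = 0 := by
    intro k hk
    by_cases hkd : P.totalDegree < k
    · exact homogeneousComponent_eq_zero _ _ hkd
    apply MvPolynomial.funext
    intro X
    rw [map_zero]
    have e : (∑ j ∈ Finset.range (P.totalDegree + 1),
        Polynomial.C (eval X (homogeneousComponent j P)) * Polynomial.X ^ j : Polynomial ℂ) =
        Polynomial.C (eval X P) * Polynomial.X ^ N := by
      apply Polynomial.funext
      intro t
      have h1 := h t X
      conv_lhs at h1 => rw [← sum_homogeneousComponent P]
      rw [map_sum] at h1
      rw [Polynomial.eval_finset_sum]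
      simp only [Polynomial.eval_mul, Polynomial.eval_C, Polynomial.eval_pow, Polynomial.eval_X]
      rw [mul_comm, ← h1]
      refine Finset.sum_congr rfl fun j _ => ?_
      have : IsForm j (fun X => eval X (homogeneousComponent j P)) :=
        ⟨_, homogeneousComponent_isHomogeneous _ _, fun X => rfl⟩
      rw [mul_comm]
      exact (this.homog t X).symm
    have e2 := congrArg (fun p => Polynomial.coeff p k) e
    simp only [Polynomial.finset_sum_coeff, Polynomial.coeff_C_mul_X_pow, if_neg hk] at e2
    rw [Finset.sum_ite_eq, if_pos (Finset.mem_range.2 (by omega))] at e2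
    exact e2
  rw [← sum_homogeneousComponent P]
  refine IsHomogeneous.sum _ _ _ fun j _ => ?_
  by_cases hj : j = N
  · rw [hj]; exact homogeneousComponent_isHomogeneous _ _
  · rw [key j hj]; exact isHomogeneous_zero _ _ _

section
variable {R : Type*} [CommRing R]

theorem q4x_scale (c : Fin 15 → R) (x y z t : R) :
    q4x c (t * x) (t * y) (t * z) = t ^ 3 * q4x c x y z := by simp only [q4x]; ring

theorem q4y_scale (c : Fin 15 → R) (x y z t : R) :
    q4y c (t * x) (t * y) (t * z) = t ^ 3 * q4y c x y z := by simp only [q4y]; ring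

theorem q4z_scale (c : Fin 15 → R) (x y z t : R) :
    q4z c (t * x) (t * y) (t * z) = t ^ 3 * q4z c x y z := by simp only [q4z]; ring

theorem q4_scale (c : Fin 15 → R) (x y z t : R) :
    q4 c (t * x) (t * y) (t * z) = t ^ 4 * q4 c x y z := by simp only [q4]; ring

theorem q4A_scale (c : Fin 15 → R) (x y z u v w s t : R) :
    q4A c (t * x) (t * y) (t * z) (s * u) (s * v) (s * w) = t ^ 2 * s ^ 2 * q4A c x y z u v w := by
  simp only [q4A]; ring

theorem q4disc_scale (c : Fin 15 → R) (x y z u v w s t : R) :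
    q4disc c (t * x) (t * y) (t * z) (s * u) (s * v) (s * w)
      = t ^ 2 * s ^ 6 * q4disc c x y z u v w := by
  simp only [q4disc, q4A_scale, q4_scale, q4B, q4x_scale, q4y_scale, q4z_scale]; ring

theorem q4dx_scale (c : Fin 15 → R) (x y z t : R) :
    q4dx c (t * x) (t * y) (t * z) = t ^ 20 * q4dx c x y z := by
  have := q4disc_scale c x y z 0 (q4z c x y z) (-q4y c x y z) (t ^ 3) t
  simp only [q4dx, q4y_scale, q4z_scale]
  rw [mul_zero, mul_neg] at this
  rw [this]; ring

theorem q4dy_scale (c : Fin 15 → R) (x y z t : R) :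
    q4dy c (t * x) (t * y) (t * z) = t ^ 20 * q4dy c x y z := by
  have := q4disc_scale c x y z (-q4z c x y z) 0 (q4x c x y z) (t ^ 3) t
  simp only [q4dy, q4x_scale, q4z_scale]
  rw [mul_zero, mul_neg] at this
  rw [this]; ring

end

/-- `q4dx` as a polynomial. -/
noncomputable def DXP (c : Fin 15 → ℂ) : MvPolynomial (Fin 3) ℂ :=
  q4dx (fun i => MvPolynomial.C (c i)) (MvPolynomial.X 0) (MvPolynomial.X 1) (MvPolynomial.X 2)

/-- `q4dy` as a polynomial. -/
noncomputable def DYP (c : Fin 15 → ℂ) : MvPolynomial (Fin 3) ℂ :=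
  q4dy (fun i => MvPolynomial.C (c i)) (MvPolynomial.X 0) (MvPolynomial.X 1) (MvPolynomial.X 2)

theorem eval_DXP (c : Fin 15 → ℂ) (X : Fin 3 → ℂ) : eval X (DXP c) = q4dx c (X 0) (X 1) (X 2) := by
  rw [DXP, map_q4dx]; simp

theorem eval_DYP (c : Fin 15 → ℂ) (X : Fin 3 → ℂ) : eval X (DYP c) = q4dy c (X 0) (X 1) (X 2) := by
  rw [DYP, map_q4dy]; simp

theorem Q4P_homog (c : Fin 15 → ℂ) : (Q4P c).IsHomogeneous 4 :=
  isHomogeneous_of_scaling fun t X => by simp [eval_q4P, q4_scale]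

theorem DXP_homog (c : Fin 15 → ℂ) : (DXP c).IsHomogeneous 20 :=
  isHomogeneous_of_scaling fun t X => by simp [eval_DXP, q4dx_scale]

theorem DYP_homog (c : Fin 15 → ℂ) : (DYP c).IsHomogeneous 20 :=
  isHomogeneous_of_scaling fun t X => by simp [eval_DYP, q4dy_scale]

/-- The bitangential covariant: a form of degree 14 cutting out the contact points. -/
theorem exists_bitangential (c : Fin 15 → ℂ) (hc : c 14 ≠ 0) :
    ∃ Δ G₁ G₂, IsForm 14 Δ ∧ IsForm 16 G₁ ∧ IsForm 16 G₂ ∧ ∀ X : Fin 3 → ℂ,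
      q4dx c (X 0) (X 1) (X 2) = q4 c (X 0) (X 1) (X 2) * G₁ X + X 0 ^ 6 * Δ X ∧
      q4dy c (X 0) (X 1) (X 2) = q4 c (X 0) (X 1) (X 2) * G₂ X + X 1 ^ 6 * Δ X := by
  set x : MvPolynomial (Fin 3) ℂ := MvPolynomial.X 0 with hx
  set y : MvPolynomial (Fin 3) ℂ := MvPolynomial.X 1 with hy
  have h1 : y ^ 6 * DXP c - x ^ 6 * DYP c ∈ Ideal.span {Q4P c} := by
    rw [← Ideal.Quotient.eq, map_mul, map_mul, DXP, DYP, map_q4dx, map_q4dy, map_pow, map_pow]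
    refine (q4dx_dy _ _ _ _ ?_).symm
    rw [← map_q4, Ideal.Quotient.eq_zero_iff_mem]
    exact Ideal.subset_span rfl
  rw [Ideal.mem_span_singleton] at h1
  obtain ⟨g, hg⟩ := h1
  have h2 : g ∈ Ideal.span {x ^ 6, y ^ 6} := by
    set z : MvPolynomial (Fin 3) ℂ := MvPolynomial.X 2 with hz
    have e : Q4P c = C (c 14) * z ^ 4 + (x * (
        C (c 0) * (x ^ 3 * y ^ 0 * z ^ 0) +
        C (c 1) * (x ^ 2 * y ^ 1 * z ^ 0) +
        C (c 2) * (x ^ 2 * y ^ 0 * z ^ 1) +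
        C (c 3) * (x ^ 1 * y ^ 2 * z ^ 0) +
        C (c 4) * (x ^ 1 * y ^ 1 * z ^ 1) +
        C (c 5) * (x ^ 1 * y ^ 0 * z ^ 2) +
        C (c 6) * (x ^ 0 * y ^ 3 * z ^ 0) +
        C (c 7) * (x ^ 0 * y ^ 2 * z ^ 1) +
        C (c 8) * (x ^ 0 * y ^ 1 * z ^ 2) +
        C (c 9) * (x ^ 0 * y ^ 0 * z ^ 3)) +
        y * (C (c 10) * (x ^ 0 * y ^ 3 * z ^ 0) +
        C (c 11) * (x ^ 0 * y ^ 2 * z ^ 1) +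
        C (c 12) * (x ^ 0 * y ^ 1 * z ^ 2) +
        C (c 13) * (x ^ 0 * y ^ 0 * z ^ 3))) := by
      simp only [Q4P, q4, ← hx, ← hy, ← hz]; ring
    refine regular_mod (Q4P c) g _ _ (c 14) hc e ?_
    rw [← hg]
    refine Ideal.sub_mem _ (Ideal.mul_mem_right _ _ (Ideal.subset_span ?_))
      (Ideal.mul_mem_right _ _ (Ideal.subset_span ?_)) <;> simp [hx, hy]
  obtain ⟨g1, g2, hgg⟩ := Ideal.mem_span_pair.1 h2
  have h3 : y ^ 6 * (DXP c - Q4P c * g2) = x ^ 6 * (DYP c + Q4P c * g1) := by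
    rw [← hgg] at hg
    linear_combination hg
  have hpx : Prime x := X_prime
  have hxy : ¬ x ∣ y ^ 6 := by
    intro h
    obtain ⟨w, hw⟩ := hpx.dvd_of_dvd_pow h
    have := congrArg (eval ![0, 1, 0]) hw
    simp [hx, hy] at this
  have h4 : x ^ 6 ∣ DXP c - Q4P c * g2 :=
    hpx.pow_dvd_of_dvd_mul_left 6 hxy ⟨_, h3⟩
  obtain ⟨D, hD⟩ := h4
  have h5 : DYP c + Q4P c * g1 = y ^ 6 * D := by
    rw [hD] at h3
    have : x ^ 6 ≠ 0 := pow_ne_zero _ hpx.ne_zero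
    apply mul_left_cancel₀ this
    rw [← h3]; ring
  have hQ := Q4P_homog c
  have hx6 : (x ^ 6).IsHomogeneous 6 := isHomogeneous_X_pow _ _
  have hy6 : (y ^ 6).IsHomogeneous 6 := isHomogeneous_X_pow _ _
  have k1 := congrArg (homogeneousComponent 20) hD
  have k2 := congrArg (homogeneousComponent 20) h5
  rw [map_sub, homogeneousComponent_eq_self (DXP_homog c),
    homogeneousComponent_mul_left (n := 16) hQ, homogeneousComponent_mul_left (n := 14) hx6] at k1
  rw [map_add, homogeneousComponent_eq_self (DYP_homog c),
    homogeneousComponent_mul_left (n := 16) hQ, homogeneousComponent_mul_left (n := 14) hy6] at k2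
  refine ⟨fun X => eval X (homogeneousComponent 14 D), fun X => eval X (homogeneousComponent 16 g2),
    fun X => - eval X (homogeneousComponent 16 g1),
    ⟨_, homogeneousComponent_isHomogeneous _ _, fun X => rfl⟩,
    ⟨_, homogeneousComponent_isHomogeneous _ _, fun X => rfl⟩,
    IsForm.neg ⟨_, homogeneousComponent_isHomogeneous _ _, fun X => rfl⟩, fun X => ⟨?_, ?_⟩⟩
  · have := congrArg (eval X) k1
    simp only [map_sub, map_mul, map_pow, eval_DXP, eval_q4P, hx, eval_X] at this
    linear_combination this
  · have := congrArg (eval X) k2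
    simp only [map_add, map_mul, map_pow, eval_DYP, eval_q4P, hy, eval_X] at this
    linear_combination this

/-- The general ternary cubic. -/
def c3 (a : Fin 10 → ℂ) (X : Fin 3 → ℂ) : ℂ :=
  a 0 * (X 0 ^ 3 * X 1 ^ 0 * X 2 ^ 0) + a 1 * (X 0 ^ 2 * X 1 ^ 1 * X 2 ^ 0) + a 2 * (X 0 ^ 2 * X 1 ^ 0 * X 2 ^ 1) + a 3 * (X 0 ^ 1 * X 1 ^ 2 * X 2 ^ 0) + a 4 * (X 0 ^ 1 * X 1 ^ 1 * X 2 ^ 1) + a 5 * (X 0 ^ 1 * X 1 ^ 0 * X 2 ^ 2) + a 6 * (X 0 ^ 0 * X 1 ^ 3 * X 2 ^ 0) + a 7 * (X 0 ^ 0 * X 1 ^ 2 * X 2 ^ 1) + a 8 * (X 0 ^ 0 * X 1 ^ 1 * X 2 ^ 2) + a 9 * (X 0 ^ 0 * X 1 ^ 0 * X 2 ^ 3)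

theorem IsForm.cubic {F} (h : IsForm 3 F) : ∃ a, ∀ X, F X = c3 a X := by
  obtain ⟨A, B, D, hA, hB, hD, h⟩ := h.euler
  obtain ⟨S, hS, hA⟩ := hA.quad
  obtain ⟨T, hT, hB⟩ := hB.quad
  obtain ⟨U, hU, hD⟩ := hD.quad
  refine ⟨![S 0 0, 2 * S 0 1 + T 0 0, 2 * S 0 2 + U 0 0, S 1 1 + 2 * T 0 1, 2 * S 1 2 + 2 * T 0 2 + 2 * U 0 1, S 2 2 + 2 * U 0 2, T 1 1, 2 * T 1 2 + U 1 1, T 2 2 + 2 * U 1 2, U 2 2], fun X => ?_⟩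
  have e1 := fun i j => hS.apply i j
  have e2 := fun i j => hT.apply i j
  have e3 := fun i j => hU.apply i j
  rw [h, hA, hB, hD]
  simp only [c3, dotProduct, mulVec, Fin.sum_univ_three]
  rw [e1 0 1, e1 0 2, e1 1 2, e2 0 1, e2 0 2, e2 1 2, e3 0 1, e3 0 2, e3 1 2]
  dsimp
  ring

theorem IsForm.quartic {F} (h : IsForm 4 F) : ∃ c, ∀ X, F X = q4 c (X 0) (X 1) (X 2) := by
  obtain ⟨A, B, D, hA, hB, hD, h⟩ := h.euler
  obtain ⟨a, hA⟩ := hA.cubic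
  obtain ⟨b, hB⟩ := hB.cubic
  obtain ⟨d, hD⟩ := hD.cubic
  refine ⟨![a 0, a 1 + b 0, a 2 + d 0, a 3 + b 1, a 4 + b 2 + d 1, a 5 + d 2, a 6 + b 3, a 7 + b 4 + d 3, a 8 + b 5 + d 4, a 9 + d 5, b 6, b 7 + d 6, b 8 + d 7, b 9 + d 8, d 9], fun X => ?_⟩
  rw [h, hA, hB, hD]
  simp only [c3, q4]
  dsimp
  ring

theorem eval_pderiv_Q4P (c : Fin 15 → ℂ) (X : Fin 3 → ℂ) :
    eval X (pderiv 0 (Q4P c)) = q4x c (X 0) (X 1) (X 2) ∧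
    eval X (pderiv 1 (Q4P c)) = q4y c (X 0) (X 1) (X 2) ∧
    eval X (pderiv 2 (Q4P c)) = q4z c (X 0) (X 1) (X 2) := by
  refine ⟨?_, ?_, ?_⟩ <;>
  · simp [Q4P, q4, q4x, q4y, q4z, Derivation.leibniz, pderiv_X,
      Derivation.leibniz_pow]
    try ring

/-- The gradient of the quartic. -/
def grad4 (c : Fin 15 → ℂ) (X : Fin 3 → ℂ) : Fin 3 → ℂ :=
  ![q4x c (X 0) (X 1) (X 2), q4y c (X 0) (X 1) (X 2), q4z c (X 0) (X 1) (X 2)]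

theorem SmoothF.grad_ne {F} (hS : SmoothF F) {c : Fin 15 → ℂ}
    (hc : ∀ X, F X = q4 c (X 0) (X 1) (X 2)) {p : Fin 3 → ℂ} (hp : p ≠ 0) : grad4 c p ≠ 0 := by
  intro h
  apply hp
  apply hS (Q4P c) (fun X => by rw [hc, eval_q4P])
  obtain ⟨h0, h1, h2⟩ := eval_pderiv_Q4P c p
  have e0 := congrFun h 0
  have e1 := congrFun h 1
  have e2 := congrFun h 2
  simp only [grad4] at e0 e1 e2
  dsimp at e0 e1 e2
  intro i
  fin_cases i
  · exact h0.trans e0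
  · exact h1.trans e1
  · exact h2.trans e2

/-- `l` is a bitangent of `F`. -/
def Bit (F : (Fin 3 → ℂ) → ℂ) (l : Fin 3 → ℂ) : Prop :=
  l ≠ 0 ∧ ∃ q, IsForm 2 q ∧ ∀ X, l ⬝ᵥ X = 0 → F X = q X ^ 2

theorem plane_vanish {l m : Fin 3 → ℂ} (hl : l ≠ 0) (h : ∀ X, l ⬝ᵥ X = 0 → m ⬝ᵥ X = 0) :
    ∃ μ : ℂ, m = μ • l := by
  obtain ⟨G, hG, h⟩ := (isForm_dot m).div (n := 0) hl h
  obtain ⟨μ, hμ⟩ := isForm0_const hG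
  refine ⟨μ, ?_⟩
  funext i
  have := h (Pi.single i 1)
  simp only [dotProduct_single, mul_one, hμ] at this
  rw [this, Pi.smul_apply, smul_eq_mul, mul_comm]

theorem plane_span {l p τ d X : Fin 3 → ℂ} (hl : l ≠ 0) (hp : l ⬝ᵥ p = 0) (hτ : l ⬝ᵥ τ = 0)
    (hd : d ⬝ᵥ (p ⨯₃ τ) = 1) (hX : l ⬝ᵥ X = 0) :
    X = (d ⬝ᵥ (X ⨯₃ τ)) • p + (d ⬝ᵥ (p ⨯₃ X)) • τ := by
  have hz : X ⬝ᵥ (p ⨯₃ τ) = 0 := by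
    obtain ⟨i, hi⟩ := Function.ne_iff.1 hl
    have : (X ⬝ᵥ (p ⨯₃ τ)) * l i = 0 := by
      simp only [dotProduct, Fin.sum_univ_three, cross_apply] at hX hp hτ ⊢
      simp only [Matrix.cons_val]
      fin_cases i
      · simp only [Fin.zero_eta]; linear_combination (p 1 * τ 2 - p 2 * τ 1) * hX + (τ 1 * X 2 - τ 2 * X 1) * hp +
          (X 1 * p 2 - X 2 * p 1) * hτ
      · simp only [Fin.mk_one]; linear_combination (p 2 * τ 0 - p 0 * τ 2) * hX + (τ 2 * X 0 - τ 0 * X 2) * hp +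
          (X 2 * p 0 - X 0 * p 2) * hτ
      · simp only [Fin.reduceFinMk]; linear_combination (p 0 * τ 1 - p 1 * τ 0) * hX + (τ 0 * X 1 - τ 1 * X 0) * hp +
          (X 0 * p 1 - X 1 * p 0) * hτ
    exact (mul_eq_zero.1 this).resolve_right hi
  simp only [dotProduct, Fin.sum_univ_three, cross_apply] at hd hz ⊢
  simp at hd hz ⊢
  funext i
  fin_cases i <;> simp
  · linear_combination d 0 * hz - X 0 * hd
  · linear_combination d 1 * hz - X 1 * hd
  · linear_combination d 2 * hz - X 2 * hd

theorem sq_factor {A B D : ℂ} (h : B ^ 2 = 4 * A * D) :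
    ∃ α γ : ℂ, A = α ^ 2 ∧ B = 2 * α * γ ∧ D = γ ^ 2 := by
  obtain ⟨α, hα⟩ := IsAlgClosed.exists_pow_nat_eq A (n := 2) (by norm_num)
  by_cases h0 : α = 0
  · subst h0
    obtain ⟨γ, hγ⟩ := IsAlgClosed.exists_pow_nat_eq D (n := 2) (by norm_num)
    have hA : A = 0 := by rw [← hα]; ring
    refine ⟨0, γ, hα.symm, ?_, hγ.symm⟩
    rw [hA] at h
    have : B ^ 2 = 0 := by rw [h]; ring
    rw [pow_eq_zero_iff (by norm_num)] at this
    rw [this]; ring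
  · refine ⟨α, B / (2 * α), hα.symm, by field_simp, ?_⟩
    field_simp
    rw [h, ← hα]; ring

theorem exists_dot_one' {v : Fin 3 → ℂ} (hl : v ≠ 0) : ∃ d : Fin 3 → ℂ, d ⬝ᵥ v = 1 := by
  obtain ⟨d, hd⟩ := exists_dot_one hl
  exact ⟨d, by rw [dotProduct_comm, hd]⟩

theorem bit_of_disc {F} {c : Fin 15 → ℂ}
    (hc : ∀ X, F X = q4 c (X 0) (X 1) (X 2)) {p τ : Fin 3 → ℂ} (hF : F p = 0)
    (hl : grad4 c p ≠ 0) (hτ : grad4 c p ⬝ᵥ τ = 0) (hx : p ⨯₃ τ ≠ 0)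
    (hd : q4disc c (p 0) (p 1) (p 2) (τ 0) (τ 1) (τ 2) = 0) : Bit F (grad4 c p) := by
  obtain ⟨d, hd1⟩ := exists_dot_one' hx
  have hp : grad4 c p ⬝ᵥ p = 0 := by
    have := q4_euler c (p 0) (p 1) (p 2)
    rw [← hc, hF, mul_zero] at this
    simpa [grad4, dotProduct, Fin.sum_univ_three] using this
  have hL : q4L c (p 0) (p 1) (p 2) (τ 0) (τ 1) (τ 2) = 0 := by
    simpa [grad4, dotProduct, Fin.sum_univ_three, q4L] using hτ
  obtain ⟨α, γ, hA, hB, hD⟩ := sq_factor (A := q4A c (p 0) (p 1) (p 2) (τ 0) (τ 1) (τ 2))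
    (B := q4B c (p 0) (p 1) (p 2) (τ 0) (τ 1) (τ 2)) (D := q4 c (τ 0) (τ 1) (τ 2))
    (by rw [q4disc] at hd; linear_combination hd)
  have hu : IsForm 1 (fun X => d ⬝ᵥ (X ⨯₃ τ)) := (isForm_dot (τ ⨯₃ d)).congr fun X => by
    rw [dotProduct_comm (τ ⨯₃ d), triple_product_permutation, triple_product_permutation]
  have hs : IsForm 1 (fun X => d ⬝ᵥ (p ⨯₃ X)) := (isForm_dot (d ⨯₃ p)).congr fun X => by
    simp [cross_apply, dotProduct, Fin.sum_univ_three]; ring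
  refine ⟨hl, fun X => (d ⬝ᵥ (p ⨯₃ X)) * (α * (d ⬝ᵥ (X ⨯₃ τ)) + γ * (d ⬝ᵥ (p ⨯₃ X))),
    hs.mul ((hu.smul α).add (hs.smul γ)), fun X hX => ?_⟩
  have e := plane_span hl hp hτ hd1 hX
  beta_reduce
  generalize d ⬝ᵥ (X ⨯₃ τ) = u at e ⊢
  generalize d ⬝ᵥ (p ⨯₃ X) = s at e ⊢
  rw [hc, e]
  simp only [Pi.add_apply, Pi.smul_apply, smul_eq_mul]
  rw [q4_line, ← hc, hF, hL, hA, hB, hD]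
  ring

theorem bit_of_contact {F} (hS : SmoothF F) {c : Fin 15 → ℂ}
    (hc : ∀ X, F X = q4 c (X 0) (X 1) (X 2)) (h14 : c 14 ≠ 0) {p : Fin 3 → ℂ} (hp : p ≠ 0)
    (hF : F p = 0) (hdx : q4dx c (p 0) (p 1) (p 2) = 0) (hdy : q4dy c (p 0) (p 1) (p 2) = 0) :
    Bit F (grad4 c p) := by
  have hg := hS.grad_ne hc hp
  have eu := q4_euler c (p 0) (p 1) (p 2)
  rw [← hc, hF, mul_zero] at eu
  by_cases h0 : p 0 = 0
  · by_cases h1 : p 1 = 0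
    · exfalso
      have := hc p
      rw [hF, h0, h1] at this
      simp [q4, h14] at this
      apply hp
      funext i
      fin_cases i <;> simp [*]
    · refine bit_of_disc hc hF hg (τ := ![-q4z c (p 0) (p 1) (p 2), 0, q4x c (p 0) (p 1) (p 2)])
        ?_ ?_ hdy
      · simp [grad4, dotProduct, Fin.sum_univ_three]; ring
      · intro h
        have e0 := congrFun h 0
        have e2 := congrFun h 2
        simp [cross_apply] at e0 e2
        have f0 := e0.resolve_left h1
        have f2 := e2.resolve_left h1
        rw [f0, f2] at eu
        apply hg
        have f1 : q4y c (p 0) (p 1) (p 2) = 0 := by simpa [h1] using eu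
        funext i
        fin_cases i <;> simp [grad4, f0, f1, f2]
  · refine bit_of_disc hc hF hg (τ := ![0, q4z c (p 0) (p 1) (p 2), -q4y c (p 0) (p 1) (p 2)])
        ?_ ?_ hdx
    · simp [grad4, dotProduct, Fin.sum_univ_three]; ring
    · intro h
      have e1 := congrFun h 1
      have e2 := congrFun h 2
      simp [cross_apply] at e1 e2
      have f1 := e1.resolve_left h0
      have f2 := e2.resolve_left h0
      rw [f1, f2] at eu
      apply hg
      have f0 : q4x c (p 0) (p 1) (p 2) = 0 := by simpa [h0] using eu
      funext i
      fin_cases i <;> simp [grad4, f0, f1, f2]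

theorem IsPolyF.add {F G} (h : IsPolyF F) (h' : IsPolyF G) : IsPolyF (fun X => F X + G X) := by
  obtain ⟨P, hP⟩ := h
  obtain ⟨Q, hQ⟩ := h'
  exact ⟨P + Q, fun X => by simp [hP, hQ]⟩

theorem IsPolyF.sub {F G} (h : IsPolyF F) (h' : IsPolyF G) : IsPolyF (fun X => F X - G X) := by
  obtain ⟨P, hP⟩ := h
  obtain ⟨Q, hQ⟩ := h'
  exact ⟨P - Q, fun X => by simp [hP, hQ]⟩

theorem IsPolyF.mul {F G} (h : IsPolyF F) (h' : IsPolyF G) : IsPolyF (fun X => F X * G X) := by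
  obtain ⟨P, hP⟩ := h
  obtain ⟨Q, hQ⟩ := h'
  exact ⟨P * Q, fun X => by simp [hP, hQ]⟩

theorem IsPolyF.neg {F} (h : IsPolyF F) : IsPolyF (fun X => - F X) := by
  obtain ⟨P, hP⟩ := h
  exact ⟨-P, fun X => by simp [hP]⟩

theorem IsPolyF.pow {F} (h : IsPolyF F) (n : ℕ) : IsPolyF (fun X => F X ^ n) := by
  obtain ⟨P, hP⟩ := h
  exact ⟨P ^ n, fun X => by simp [hP]⟩

theorem isPolyF_const (c : ℂ) : IsPolyF (fun _ => c) := ⟨MvPolynomial.C c, by simp⟩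

theorem isForm_c3 (a : Fin 10 → ℂ) : IsForm 3 (c3 a) := by
  have h : ∀ (t : ℂ) (i j k : ℕ), i + j + k = 3 →
      IsForm 3 (fun X => t * (X 0 ^ i * X 1 ^ j * X 2 ^ k)) := by
    intro t i j k e
    have := ((((isForm_X 0).pow i).mul ((isForm_X 1).pow j)).mul ((isForm_X 2).pow k)).smul t
    rwa [one_mul, one_mul, one_mul, e] at this
  exact (((((((((h _ _ _ _ rfl).add (h _ _ _ _ rfl)).add (h _ _ _ _ rfl)).add (h _ _ _ _ rfl)).add
    (h _ _ _ _ rfl)).add (h _ _ _ _ rfl)).add (h _ _ _ _ rfl)).add (h _ _ _ _ rfl)).add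
    (h _ _ _ _ rfl)).add (h _ _ _ _ rfl)

/-- Coefficients of `Q² + y c`. -/
def cc (k m n : ℂ) (a : Fin 10 → ℂ) : Fin 15 → ℂ :=
  ![n ^ 2, a 0, 2 * m * n, a 1, a 2, m ^ 2 + 2 * k * n, a 3, a 4, a 5, 2 * k * m, a 6, a 7, a 8,
    a 9, k ^ 2]

/-- The remainder term. -/
def RR (k Q Qz c c1 c2 d d1 d2 e e1 e3 a9 : ℂ) : ℂ :=
  let A0 := c ^ 2 * Qz ^ 2
  let A1 := 2 * k * c ^ 2 - 2 * Qz * c * c1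
  let A2 := 4 * Qz ^ 2 * d
  let B0 := -2 * k * c ^ 3 * Qz
  let B1 := Qz * c ^ 2 * c2
  let B2 := - 4 * Qz ^ 2 * c * d1 + 8 * Q * Qz ^ 3 * e
  let C0 := k ^ 2 * c ^ 4
  let C1 := -2 * a9 * Qz * c ^ 3
  let C2 := 2 * Qz ^ 2 * c ^ 2 * d2 - 8 * Q * Qz ^ 3 * c * e1 + 16 * Q ^ 2 * Qz ^ 4 * e3
  B1 ^ 2 + 2 * B0 * B2 + 2 * Q * B1 * B2 + Q ^ 2 * B2 ^ 2
    - 4 * (A0 * C2 + A1 * C1 + A2 * C0 + Q * (A1 * C2 + A2 * C1) + Q ^ 2 * A2 * C2)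

theorem RR_id (k Q Qz c c1 c2 d d1 d2 e e1 e3 a9 u v : ℂ) (hu : u = 2 * Q * Qz) (hv : v = -c) :
    (2 * k * v ^ 3 * Qz + u * v ^ 2 * c2 / 2 + u ^ 2 * v * d1 + u ^ 3 * e) ^ 2 -
      4 * (v ^ 2 * (Qz ^ 2 + 2 * k * Q) + u * v * c1 + u ^ 2 * d) *
        (k ^ 2 * v ^ 4 + u * v ^ 3 * a9 + u ^ 2 * v ^ 2 * d2 / 2 + u ^ 3 * v * e1 + u ^ 4 * e3) =
    Q * (c ^ 5 * (-8 * k ^ 3 * c + 8 * k ^ 2 * Qz * c1 - 4 * k * Qz ^ 2 * c2 + 8 * a9 * Qz ^ 3) +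
      Q * RR k Q Qz c c1 c2 d d1 d2 e e1 e3 a9) := by
  subst hu hv
  simp only [RR]
  ring

theorem q4dx_cc (k m n : ℂ) (a : Fin 10 → ℂ) (x z Q Qz c c1 c2 d d1 d2 e : ℂ)
    (hQ : Q = k * z ^ 2 + m * x * z + n * x ^ 2) (hQz : Qz = 2 * k * z + m * x)
    (hc : c = a 0 * x ^ 3 + a 2 * x ^ 2 * z + a 5 * x * z ^ 2 + a 9 * z ^ 3)
    (hc1 : c1 = a 2 * x ^ 2 + 2 * a 5 * x * z + 3 * a 9 * z ^ 2)
    (hc2 : c2 = 2 * a 5 * x + 6 * a 9 * z)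
    (hd : d = a 1 * x ^ 2 + a 4 * x * z + a 8 * z ^ 2) (hd1 : d1 = a 4 * x + 2 * a 8 * z)
    (hd2 : d2 = 2 * a 8) (he : e = a 3 * x + a 7 * z) :
    q4dx (cc k m n a) x 0 z = Q * (c ^ 5 * (-8 * k ^ 3 * c + 8 * k ^ 2 * Qz * c1
      - 4 * k * Qz ^ 2 * c2 + 8 * a 9 * Qz ^ 3) +
      Q * RR k Q Qz c c1 c2 d d1 d2 e (a 7) (a 6) (a 9)) := by
  have hu : q4z (cc k m n a) x 0 z = 2 * Q * Qz := by
    subst hQ hQz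
    simp only [q4z, cc]; dsimp; ring
  have hv : - q4y (cc k m n a) x 0 z = - c := by
    subst hc
    simp only [q4y, cc]; dsimp; ring
  rw [q4dx, q4disc, ← RR_id k Q Qz c c1 c2 d d1 d2 e (a 7) (a 6) (a 9) _ _ hu hv]
  generalize q4z (cc k m n a) x 0 z = u
  generalize -q4y (cc k m n a) x 0 z = v
  have hA : q4A (cc k m n a) x 0 z 0 u v = v ^ 2 * (Qz ^ 2 + 2 * k * Q) + u * v * c1 + u ^ 2 * d := by
    subst hQ hQz hc1 hd
    simp only [q4A, cc]; dsimp; ring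
  have hB : q4B (cc k m n a) x 0 z 0 u v =
      2 * k * v ^ 3 * Qz + u * v ^ 2 * c2 / 2 + u ^ 2 * v * d1 + u ^ 3 * e := by
    subst hQz hc2 hd1 he
    simp only [q4B, q4x, q4y, q4z, cc]; dsimp; ring
  have hC : q4 (cc k m n a) 0 u v =
      k ^ 2 * v ^ 4 + u * v ^ 3 * a 9 + u ^ 2 * v ^ 2 * d2 / 2 + u ^ 3 * v * a 7 + u ^ 4 * a 6 := by
    subst hd2
    simp only [q4, cc]; dsimp; ring
  rw [hA, hB, hC]

theorem q4_cc (k m n : ℂ) (a : Fin 10 → ℂ) (X : Fin 3 → ℂ) :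
    q4 (cc k m n a) (X 0) (X 1) (X 2) =
      X 1 * c3 a X + (k * X 2 ^ 2 + m * X 0 * X 2 + n * X 0 ^ 2) ^ 2 := by
  simp only [q4, cc, c3]; dsimp; ring

theorem RR_poly {k : ℂ} {Q Qz c c1 c2 d d1 d2 e e1 e3 a9 : (Fin 3 → ℂ) → ℂ} (hQ : IsPolyF Q)
    (hQz : IsPolyF Qz) (hc : IsPolyF c) (hc1 : IsPolyF c1) (hc2 : IsPolyF c2) (hd : IsPolyF d)
    (hd1 : IsPolyF d1) (hd2 : IsPolyF d2) (he : IsPolyF e) (he1 : IsPolyF e1) (he3 : IsPolyF e3)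
    (ha9 : IsPolyF a9) :
    IsPolyF (fun X => RR k (Q X) (Qz X) (c X) (c1 X) (c2 X) (d X) (d1 X) (d2 X) (e X) (e1 X) (e3 X)
      (a9 X)) := by
  obtain ⟨Q, hQ⟩ := hQ
  obtain ⟨Qz, hQz⟩ := hQz
  obtain ⟨c, hc⟩ := hc
  obtain ⟨c1, hc1⟩ := hc1
  obtain ⟨c2, hc2⟩ := hc2
  obtain ⟨d, hd⟩ := hd
  obtain ⟨d1, hd1⟩ := hd1
  obtain ⟨d2, hd2⟩ := hd2
  obtain ⟨e, he⟩ := he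
  obtain ⟨e1, he1⟩ := he1
  obtain ⟨e3, he3⟩ := he3
  obtain ⟨a9, ha9⟩ := ha9
  refine ⟨(Qz * c ^ 2 * c2) ^ 2 +
    2 * (-2 * MvPolynomial.C k * c ^ 3 * Qz) * (- 4 * Qz ^ 2 * c * d1 + 8 * Q * Qz ^ 3 * e) +
    2 * Q * (Qz * c ^ 2 * c2) * (- 4 * Qz ^ 2 * c * d1 + 8 * Q * Qz ^ 3 * e) +
    Q ^ 2 * (- 4 * Qz ^ 2 * c * d1 + 8 * Q * Qz ^ 3 * e) ^ 2
    - 4 * (c ^ 2 * Qz ^ 2 * (2 * Qz ^ 2 * c ^ 2 * d2 - 8 * Q * Qz ^ 3 * c * e1 +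
        16 * Q ^ 2 * Qz ^ 4 * e3) +
      (2 * MvPolynomial.C k * c ^ 2 - 2 * Qz * c * c1) * (-2 * a9 * Qz * c ^ 3) +
      4 * Qz ^ 2 * d * (MvPolynomial.C k ^ 2 * c ^ 4) +
      Q * ((2 * MvPolynomial.C k * c ^ 2 - 2 * Qz * c * c1) * (2 * Qz ^ 2 * c ^ 2 * d2 -
        8 * Q * Qz ^ 3 * c * e1 + 16 * Q ^ 2 * Qz ^ 4 * e3) +
        4 * Qz ^ 2 * d * (-2 * a9 * Qz * c ^ 3)) + Q ^ 2 * (4 * Qz ^ 2 * d) *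
        (2 * Qz ^ 2 * c ^ 2 * d2 - 8 * Q * Qz ^ 3 * c * e1 + 16 * Q ^ 2 * Qz ^ 4 * e3)),
    fun X => ?_⟩
  simp only [hQ, hQz, hc, hc1, hc2, hd, hd1, hd2, he, he1, he3, ha9, RR, map_add, map_sub, map_mul,
    map_neg, map_pow, eval_C, map_ofNat]

theorem poly_xz (i j : ℕ) (t : ℂ) : IsPolyF (fun X => t * X 0 ^ i * X 2 ^ j) :=
  ⟨MvPolynomial.C t * MvPolynomial.X 0 ^ i * MvPolynomial.X 2 ^ j, fun X => by simp⟩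

theorem exists_St (k ζ η : ℂ) (a : Fin 10 → ℂ) (m n : ℂ) (hm : m = - k * (ζ + η))
    (hn : n = k * ζ * η) {G : (Fin 3 → ℂ) → ℂ} (hG : IsPolyF G) :
    ∃ St, IsPolyF St ∧ (∀ X, q4dx (cc k m n a) (X 0) 0 (X 2) =
      (k * (X 2 - ζ * X 0) * (X 2 - η * X 0)) * St X +
        (k * (X 2 - ζ * X 0) * (X 2 - η * X 0)) ^ 2 * G X) ∧
      St ![1, 0, ζ] = c3 a ![1, 0, ζ] ^ 5 * (-8 * k ^ 3 * c3 a ![1, 0, η]) ∧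
      St ![1, 0, η] = c3 a ![1, 0, η] ^ 5 * (-8 * k ^ 3 * c3 a ![1, 0, ζ]) := by
  have pQ : IsPolyF (fun X => k * X 2 ^ 2 + m * X 0 * X 2 + n * X 0 ^ 2) :=
    (((poly_xz 0 2 k).add (poly_xz 1 1 m)).add (poly_xz 2 0 n)).congr fun X => by ring
  have pQz : IsPolyF (fun X => 2 * k * X 2 + m * X 0) :=
    ((poly_xz 0 1 (2 * k)).add (poly_xz 1 0 m)).congr fun X => by ring
  have pc : IsPolyF (fun X => a 0 * X 0 ^ 3 + a 2 * X 0 ^ 2 * X 2 + a 5 * X 0 * X 2 ^ 2 +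
      a 9 * X 2 ^ 3) :=
    ((((poly_xz 3 0 (a 0)).add (poly_xz 2 1 (a 2))).add (poly_xz 1 2 (a 5))).add
      (poly_xz 0 3 (a 9))).congr fun X => by ring
  have pc1 : IsPolyF (fun X => a 2 * X 0 ^ 2 + 2 * a 5 * X 0 * X 2 + 3 * a 9 * X 2 ^ 2) :=
    (((poly_xz 2 0 (a 2)).add (poly_xz 1 1 (2 * a 5))).add (poly_xz 0 2 (3 * a 9))).congr
      fun X => by ring
  have pc2 : IsPolyF (fun X => 2 * a 5 * X 0 + 6 * a 9 * X 2) :=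
    ((poly_xz 1 0 (2 * a 5)).add (poly_xz 0 1 (6 * a 9))).congr fun X => by ring
  have pd : IsPolyF (fun X => a 1 * X 0 ^ 2 + a 4 * X 0 * X 2 + a 8 * X 2 ^ 2) :=
    (((poly_xz 2 0 (a 1)).add (poly_xz 1 1 (a 4))).add (poly_xz 0 2 (a 8))).congr
      fun X => by ring
  have pd1 : IsPolyF (fun X => a 4 * X 0 + 2 * a 8 * X 2) :=
    ((poly_xz 1 0 (a 4)).add (poly_xz 0 1 (2 * a 8))).congr fun X => by ring
  have pe : IsPolyF (fun X => a 3 * X 0 + a 7 * X 2) :=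
    ((poly_xz 1 0 (a 3)).add (poly_xz 0 1 (a 7))).congr fun X => by ring
  have pR := RR_poly (k := k) pQ pQz pc pc1 pc2 pd pd1 (isPolyF_const (2 * a 8)) pe
    (isPolyF_const (a 7)) (isPolyF_const (a 6)) (isPolyF_const (a 9))
  have ph : IsPolyF (fun X => -8 * k ^ 3 * (a 0 * X 0 ^ 3 + a 2 * X 0 ^ 2 * X 2 +
      a 5 * X 0 * X 2 ^ 2 + a 9 * X 2 ^ 3) + 8 * k ^ 2 * (2 * k * X 2 + m * X 0) *
      (a 2 * X 0 ^ 2 + 2 * a 5 * X 0 * X 2 + 3 * a 9 * X 2 ^ 2)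
      - 4 * k * (2 * k * X 2 + m * X 0) ^ 2 * (2 * a 5 * X 0 + 6 * a 9 * X 2) +
      8 * a 9 * (2 * k * X 2 + m * X 0) ^ 3) :=
    ((((isPolyF_const _).mul pc).add (((isPolyF_const _).mul pQz).mul pc1)).sub
      (((isPolyF_const _).mul (pQz.pow 2)).mul pc2)).add ((isPolyF_const _).mul (pQz.pow 3))
  refine ⟨_, (((pc.pow 5).mul ph).add (pQ.mul pR)).sub (pQ.mul hG), fun X => ?_, ?_, ?_⟩
  · rw [q4dx_cc k m n a (X 0) (X 2) _ _ _ _ _ _ _ _ _ rfl rfl rfl rfl rfl rfl rfl rfl rfl]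
    have hQ : k * (X 2 - ζ * X 0) * (X 2 - η * X 0) = k * X 2 ^ 2 + m * X 0 * X 2 + n * X 0 ^ 2 := by
      rw [hm, hn]; ring
    rw [hQ]
    generalize RR _ _ _ _ _ _ _ _ _ _ _ _ _ = R
    generalize k * X 2 ^ 2 + m * X 0 * X 2 + n * X 0 ^ 2 = Q
    generalize 2 * k * X 2 + m * X 0 = Qz
    generalize a 0 * X 0 ^ 3 + a 2 * X 0 ^ 2 * X 2 + a 5 * X 0 * X 2 ^ 2 + a 9 * X 2 ^ 3 = c
    generalize a 2 * X 0 ^ 2 + 2 * a 5 * X 0 * X 2 + 3 * a 9 * X 2 ^ 2 = c1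
    generalize 2 * a 5 * X 0 + 6 * a 9 * X 2 = c2
    ring
  · have hQ0 : k * ζ ^ 2 + m * 1 * ζ + n * 1 ^ 2 = 0 := by rw [hm, hn]; ring
    simp only [Matrix.cons_val]
    rw [hQ0, zero_mul, zero_mul, add_zero, sub_zero]
    congr 1
    · simp [c3]
    · rw [hm]; simp [c3]; ring
  · have hQ0 : k * η ^ 2 + m * 1 * η + n * 1 ^ 2 = 0 := by rw [hm, hn]; ring
    simp only [Matrix.cons_val]
    rw [hQ0, zero_mul, zero_mul, add_zero, sub_zero]
    congr 1
    · simp [c3]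
    · rw [hm]; simp [c3]; ring

theorem poly_l (ζ : ℂ) : IsPolyF (fun X => X 2 - ζ * X 0) :=
  ((isForm_X 2).isPoly).sub ((isForm_X 0).smul ζ).isPoly

set_option maxHeartbeats 2000000 in
theorem second_aux {F} (hS : SmoothF F) (k ζ η : ℂ) (hk : k ≠ 0) {a : Fin 10 → ℂ}
    (hF : ∀ X, F X = X 1 * c3 a X + (k * (X 2 - ζ * X 0) * (X 2 - η * X 0)) ^ 2) :
    ∃ l q, Bit F l ∧ l ⬝ᵥ q = 0 ∧ q 1 ≠ 0 := by
  obtain ⟨m, hm⟩ : ∃ m, m = - k * (ζ + η) := ⟨_, rfl⟩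
  obtain ⟨n, hn⟩ : ∃ n, n = k * ζ * η := ⟨_, rfl⟩
  have hQ : ∀ x z : ℂ, k * (z - ζ * x) * (z - η * x) = k * z ^ 2 + m * x * z + n * x ^ 2 := by
    intro x z; rw [hm, hn]; ring
  have hFc : ∀ X, F X = q4 (cc k m n a) (X 0) (X 1) (X 2) := by
    intro X; rw [hF, q4_cc, hQ]
  have h14 : cc k m n a 14 ≠ 0 := by simp [cc, hk]
  obtain ⟨Δ, G₁, G₂, hΔ, hG1, hG2, hid⟩ := exists_bitangential (cc k m n a) h14
  -- the restriction to the line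
  obtain ⟨π, hπd⟩ : ∃ π : (Fin 3 → ℂ) → Fin 3 → ℂ, ∀ X, π X = ![X 0, 0, X 2] := ⟨_, fun _ => rfl⟩
  have hπ : ∀ i, IsForm 1 (fun X => π X i) := by
    intro i
    simp only [hπd]
    fin_cases i
    · exact isForm_X 0
    · exact isForm_zero 1
    · exact isForm_X 2
  have hΔπ := hΔ.comp1 π hπ
  have hGπ := (hG1.comp1 π hπ).isPoly
  have hcF : IsForm 3 (c3 a) := isForm_c3 a
  have hcne : ∀ ξ, (ξ - ζ) * (ξ - η) = 0 → c3 a ![1, 0, ξ] ≠ 0 := by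
    intro ξ h0 h1
    have := hS.sing2 (a := ![1, 0, ξ]) (g₁ := fun X => X 1) (h₁ := c3 a)
      (g₂ := fun X => (k * (X 2 - ζ * X 0) * (X 2 - η * X 0)))
      (h₂ := fun X => (k * (X 2 - ζ * X 0) * (X 2 - η * X 0))) 1 one_ne_zero (isForm_X 1).isPoly
      hcF.isPoly
      (((isPolyF_const k).mul (poly_l ζ)).mul (poly_l η))
      (((isPolyF_const k).mul (poly_l ζ)).mul (poly_l η))
      (fun X => by rw [hF]; ring) rfl h1 (by simpa [hk] using h0) (by simpa [hk] using h0)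
    simpa using congrFun this 0
  obtain ⟨St, hSt, hk0, hs1, hs2⟩ := exists_St k ζ η a m n hm hn hGπ
  have key : ∀ X, X 0 ^ 6 * Δ (π X) = k * (X 2 - ζ * X 0) * (X 2 - η * X 0) * St X := by
    intro X
    have h1 := (hid (π X)).1
    have e0 : π X 0 = X 0 := by rw [hπd]; rfl
    have e1 : π X 1 = 0 := by rw [hπd]; rfl
    have e2 : π X 2 = X 2 := by rw [hπd]; rfl
    have h2 := q4_cc k m n a (π X)
    rw [e0, e1, e2] at h1 h2
    rw [hk0, h2, ← hQ] at h1
    generalize St X = S at *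
    generalize Δ (π X) = D at *
    generalize G₁ (π X) = G at *
    generalize k * (X 2 - ζ * X 0) * (X 2 - η * X 0) = Q at *
    linear_combination -h1
  have hStz : ∀ ξ, (ξ - ζ) * (ξ - η) = 0 → St ![1, 0, ξ] ≠ 0 := by
    intro ξ h0
    rcases mul_eq_zero.1 h0 with h0 | h0
    · rw [sub_eq_zero.1 h0, hs1]
      exact mul_ne_zero (pow_ne_zero _ (hcne ζ (by simp)))
        (mul_ne_zero (by simp [hk]) (hcne η (by simp)))
    · rw [sub_eq_zero.1 h0, hs2]
      exact mul_ne_zero (pow_ne_zero _ (hcne η (by simp)))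
        (mul_ne_zero (by simp [hk]) (hcne ζ (by simp)))
  have hl : ∀ ξ : ℂ, (![-ξ, 0, 1] : Fin 3 → ℂ) ≠ 0 := fun ξ e => by simpa using congrFun e 2
  have hdot : ∀ (ξ : ℂ) (X : Fin 3 → ℂ), ![-ξ, 0, 1] ⬝ᵥ X = X 2 - ξ * X 0 := fun ξ X => by
    simp [dotProduct, Fin.sum_univ_three]; ring
  have hx6 : ∀ ξ : ℂ, ¬ (∀ X, ![-ξ, 0, 1] ⬝ᵥ X = 0 → X 0 ^ 6 = 0) := fun ξ e => by
    have := e ![1, 0, ξ] (by rw [hdot]; simp)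
    simp at this
  have hX6 : IsForm (1 * 6) (fun X => X 0 ^ 6) := (isForm_X 0).pow 6
  obtain ⟨H1, hH1, e1⟩ := IsForm.div (n := 13) (hl ζ) hΔπ
    ((plane_domain (hl ζ) hX6 hΔπ (fun X hX => by
      rw [hdot] at hX; rw [key, hX]; ring)).resolve_left (hx6 ζ))
  have k1 : ∀ X, X 0 ^ 6 * H1 X = k * (X 2 - η * X 0) * St X := by
    have := (poly_domain (F := fun X => X 2 - ζ * X 0)
      (G := fun X => X 0 ^ 6 * H1 X - k * (X 2 - η * X 0) * St X)
      (poly_l ζ)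
      ((hX6.isPoly.mul hH1.isPoly).sub (((isPolyF_const k).mul (poly_l η)).mul hSt))
      (fun X => by
        have := key X
        rw [e1, hdot] at this
        linear_combination this)).resolve_left (fun e => by simpa using e ![0, 0, 1])
    intro X
    linear_combination this X
  obtain ⟨H, hH, e2⟩ := IsForm.div (n := 12) (hl η) hH1
    ((plane_domain (hl η) hX6 hH1 (fun X hX => by
      rw [hdot] at hX; rw [k1, hX]; ring)).resolve_left (hx6 η))
  have k2 : ∀ X, X 0 ^ 6 * H X = k * St X := by
    have := (poly_domain (F := fun X => X 2 - η * X 0)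
      (G := fun X => X 0 ^ 6 * H X - k * St X)
      (poly_l η)
      ((hX6.isPoly.mul hH.isPoly).sub ((isPolyF_const k).mul hSt))
      (fun X => by
        have := k1 X
        rw [e2, hdot] at this
        linear_combination this)).resolve_left (fun e => by simpa using e ![0, 0, 1])
    intro X
    linear_combination this X
  have hHz : ∀ ξ, (ξ - ζ) * (ξ - η) = 0 → H ![1, 0, ξ] ≠ 0 := by
    intro ξ h0 h1
    have := k2 ![1, 0, ξ]
    rw [h1] at this
    simp [hk, hStz ξ h0] at this
  obtain ⟨Δ1, hΔ1, e3⟩ := IsForm.div (n := 13) (l := ![0, 1, 0]) (fun e => by simpa using congrFun e 1)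
    (hΔ.sub hΔπ) (fun X hX => by
      have h1 : X 1 = 0 := by simpa [dotProduct, Fin.sum_univ_three] using hX
      have : π X = X := by
        funext i
        rw [hπd]; fin_cases i <;> simp [h1]
      simp [this])
  have hl1 := (isForm_dot ![-ζ, 0, 1]).mul (isForm_dot ![-η, 0, 1])
  have hE : IsForm 27 (fun X => ((![-ζ, 0, 1] ⬝ᵥ X) * (![-η, 0, 1] ⬝ᵥ X)) * H X * (2 * Δ1 X) +
      X 1 * Δ1 X ^ 2 - c3 a X * (k⁻¹ ^ 2 * H X ^ 2)) :=
    (((hl1.mul hH).mul (hΔ1.smul 2)).add ((isForm_X 1).mul (hΔ1.pow 2))).sub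
      (hcF.mul ((hH.pow 2).smul (k⁻¹ ^ 2)))
  have hF4 : IsForm 4 F := ((isForm_q4 (cc k m n a) (isForm_X 0) (isForm_X 1) (isForm_X 2))).congr hFc
  obtain ⟨q, hq, hFq, hEq⟩ := common_zero hF4 hE (by norm_num) (by norm_num)
  simp only [hdot] at hEq e1 e2
  have hΔq : Δ q = 0 := by
    have e4 := e3 q
    simp only [e1, e2] at e4
    have e5 : ![0, 1, 0] ⬝ᵥ q = q 1 := by simp [dotProduct, Fin.sum_univ_three]
    rw [e5] at e4
    have e6 := hF q
    rw [hFq] at e6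
    have : Δ q ^ 2 = 0 := by
      have e7 : Δ q = (q 2 - ζ * q 0) * (q 2 - η * q 0) * H q + q 1 * Δ1 q := by
        linear_combination e4
      rw [e7]
      field_simp at hEq
      have : k ^ 2 * (((q 2 - ζ * q 0) * (q 2 - η * q 0) * H q + q 1 * Δ1 q) ^ 2) = 0 := by
        linear_combination q 1 * hEq - H q ^ 2 * e6
      exact (mul_eq_zero.1 this).resolve_left (pow_ne_zero _ hk)
    exact pow_eq_zero_iff (by norm_num) |>.1 this
  have hqF : q4 (cc k m n a) (q 0) (q 1) (q 2) = 0 := by rw [← hFc, hFq]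
  have hB := bit_of_contact hS hFc h14 hq hFq (by rw [(hid q).1, hqF, hΔq]; ring)
    (by rw [(hid q).2, hqF, hΔq]; ring)
  refine ⟨_, q, hB, ?_, ?_⟩
  · have := q4_euler (cc k m n a) (q 0) (q 1) (q 2)
    rw [hqF, mul_zero] at this
    simpa [grad4, dotProduct, Fin.sum_univ_three] using this
  · intro hq1
    have e6 := hF q
    rw [hFq, hq1, zero_mul, zero_add] at e6
    have e7 := (pow_eq_zero_iff (by norm_num)).1 e6.symm
    have e8 : (q 2 - ζ * q 0) * (q 2 - η * q 0) = 0 := by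
      rw [mul_assoc] at e7
      exact (mul_eq_zero.1 e7).resolve_left hk
    have hq0 : q 0 ≠ 0 := by
      intro h0
      rw [h0] at e8
      simp at e8
      apply hq
      funext i
      fin_cases i <;> simp [h0, hq1, e8]
    have eξ : q = q 0 • ![1, 0, q 2 / q 0] := by
      funext i
      fin_cases i <;> simp [hq1] ; field_simp
    have hξ : (q 2 / q 0 - ζ) * (q 2 / q 0 - η) = 0 := by
      field_simp
      linear_combination e8
    have hc0 : c3 a q ≠ 0 := by
      rw [eξ, hcF.homog]
      exact mul_ne_zero (pow_ne_zero _ hq0) (hcne _ hξ)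
    have hH0 : H q ≠ 0 := by
      rw [eξ, hH.homog]
      exact mul_ne_zero (pow_ne_zero _ hq0) (hHz _ hξ)
    rw [e8, hq1] at hEq
    simp [hk, hc0, hH0] at hEq

theorem pderiv_aeval_chain (Q : Fin 3 → MvPolynomial (Fin 3) ℂ) (P : MvPolynomial (Fin 3) ℂ)
    (i : Fin 3) : pderiv i (aeval Q P : MvPolynomial (Fin 3) ℂ) =
      ∑ j, (aeval Q (pderiv j P) : MvPolynomial (Fin 3) ℂ) * pderiv i (Q j) := by
  induction P using MvPolynomial.induction_on with
  | C a => simp [MvPolynomial.algebraMap_eq]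
  | add p q hp hq => simp only [map_add, hp, hq, add_mul, Finset.sum_add_distrib]
  | mul_X p n hp =>
    simp only [map_mul, aeval_X, Derivation.leibniz, hp, map_add, smul_eq_mul, add_mul,
      Finset.sum_add_distrib, Finset.mul_sum, pderiv_X]
    congr 1
    · rw [Finset.sum_eq_single n]
      · simp
      · intro b _ hb
        simp [hb.symm]
      · simp
    · apply Finset.sum_congr rfl
      intros; ring

/-- The matrix with given columns. -/
def colM (t0 t1 t2 : Fin 3 → ℂ) : Matrix (Fin 3) (Fin 3) ℂ := Matrix.of fun i j => ![t0, t1, t2] j i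

theorem colM_mulVec (t0 t1 t2 X : Fin 3 → ℂ) :
    colM t0 t1 t2 *ᵥ X = X 0 • t0 + X 1 • t1 + X 2 • t2 := by
  funext i
  simp [colM, mulVec, dotProduct, Fin.sum_univ_three, mul_comm]

theorem colM_det (t0 t1 t2 : Fin 3 → ℂ) : (colM t0 t1 t2).det = t0 ⬝ᵥ (t1 ⨯₃ t2) := by
  simp [colM, det_fin_three, cross_apply, dotProduct, Fin.sum_univ_three]; ring

theorem isForm_mulVec (T : Matrix (Fin 3) (Fin 3) ℂ) (i) : IsForm 1 (fun X => (T *ᵥ X) i) :=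
  isForm_dot (T i)

theorem SmoothF.comp {F} (hS : SmoothF F) {T : Matrix (Fin 3) (Fin 3) ℂ} (hT : IsUnit T.det) :
    SmoothF (fun X => F (T *ᵥ X)) := by
  intro P hP a ha
  have h0 : T *ᵥ a = 0 := by
    apply hS (aeval (fun j => ∑ i, MvPolynomial.C (T⁻¹ j i) * MvPolynomial.X i) P)
    · intro Y
      have e := hP (T⁻¹ *ᵥ Y)
      simp only [mulVec_mulVec, mul_nonsing_inv _ hT, one_mulVec] at e
      rw [e, ← MvPolynomial.coe_aeval_eq_eval, ← MvPolynomial.coe_aeval_eq_eval]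
      simp only [RingHom.coe_coe]
      rw [← AlgHom.comp_apply, comp_aeval]
      congr 2
      funext j
      simp [mulVec, dotProduct]
    · intro i
      rw [pderiv_aeval_chain, map_sum]
      apply Finset.sum_eq_zero
      intro j _
      rw [map_mul]
      have : eval (T *ᵥ a) (aeval (fun j => ∑ i, MvPolynomial.C (T⁻¹ j i) * MvPolynomial.X i)
          (pderiv j P) : MvPolynomial (Fin 3) ℂ) = eval a (pderiv j P) := by
        rw [← MvPolynomial.coe_aeval_eq_eval, ← MvPolynomial.coe_aeval_eq_eval]
        simp only [RingHom.coe_coe]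
        rw [← AlgHom.comp_apply, comp_aeval]
        congr 2
        have e : a = T⁻¹ *ᵥ (T *ᵥ a) := by
          rw [mulVec_mulVec, nonsing_inv_mul _ hT, one_mulVec]
        conv_rhs => rw [e]
        funext j
        simp [mulVec, dotProduct]
      rw [this, ha, zero_mul]
  have := congrArg (fun v => T⁻¹ *ᵥ v) h0
  simpa [mulVec_mulVec, nonsing_inv_mul _ hT] using this

theorem Bit.comp {F} {T : Matrix (Fin 3) (Fin 3) ℂ} (hT : IsUnit T.det) {l}
    (h : Bit (fun X => F (T *ᵥ X)) l) : Bit F (l ᵥ* T⁻¹) := by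
  obtain ⟨hl, q, hq, h⟩ := h
  refine ⟨fun e => hl ?_, fun X => q (T⁻¹ *ᵥ X), hq.comp1 _ (isForm_mulVec _), fun X hX => ?_⟩
  · have := congrArg (fun v => v ᵥ* T) e
    simpa [vecMul_vecMul, nonsing_inv_mul _ hT] using this
  · rw [← h]; beta_reduce; rw [mulVec_mulVec, mul_nonsing_inv _ hT, one_mulVec]
    rw [dotProduct_mulVec, hX]

theorem parallel_of_cross {a b : Fin 3 → ℂ} (ha : a ≠ 0) (h : a ⨯₃ b = 0) : ∃ μ : ℂ, b = μ • a := by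
  obtain ⟨v, hv⟩ := exists_dot_one ha
  refine ⟨b ⬝ᵥ v, ?_⟩
  have h0 := congrFun h 0
  have h1 := congrFun h 1
  have h2 := congrFun h 2
  simp [cross_apply] at h0 h1 h2
  simp [dotProduct, Fin.sum_univ_three] at hv ⊢
  funext i
  fin_cases i <;> simp
  · linear_combination -b 0 * hv - v 1 * h2 + v 2 * h1
  · linear_combination -b 1 * hv + v 0 * h2 - v 2 * h0
  · linear_combination -b 2 * hv - v 0 * h1 + v 1 * h0

theorem exists_cross_ne {a : Fin 3 → ℂ} (ha : a ≠ 0) : ∃ b, a ⨯₃ b ≠ 0 := by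
  by_contra! h
  apply ha
  have h1 := h ![1, 0, 0]
  have h2 := h ![0, 1, 0]
  have e1 := congrFun h1 1
  have e2 := congrFun h1 2
  have e3 := congrFun h2 2
  simp [cross_apply] at e1 e2 e3
  funext i
  fin_cases i <;> simp [e1, e2, e3]

theorem SmoothF.ne_zero_on {F} (hS : SmoothF F) (hF : IsForm 4 F) {l : Fin 3 → ℂ} (hl : l ≠ 0) :
    ∃ X, l ⬝ᵥ X = 0 ∧ F X ≠ 0 := by
  by_contra! h
  obtain ⟨G, hG, e⟩ := hF.div hl h
  obtain ⟨X, hX, h1, h2⟩ := common_zero (isForm_dot l) hG (by norm_num) (by norm_num)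
  exact hX (hS.sing2 1 one_ne_zero (isForm_dot l).isPoly hG.isPoly isPoly_zero isPoly_zero
    (fun X => by rw [e]; ring) h1 h2 rfl rfl)

theorem first_bitangent {F} (hS : SmoothF F) (hF : IsForm 4 F) : ∃ l, Bit F l := by
  obtain ⟨t2, -, h2⟩ := hS.ne_zero_on hF (l := ![1, 0, 0]) (fun e => by simpa using congrFun e 0)
  have h20 : t2 ≠ 0 := by rintro rfl; exact h2 (hF.zero_of_pos (by norm_num))
  obtain ⟨t1, h1⟩ := exists_cross_ne h20
  have h1' : t1 ⨯₃ t2 ≠ 0 := by rw [← neg_ne_zero, cross_anticomm]; exact h1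
  obtain ⟨t0, h0⟩ := exists_dot_one' h1'
  have hT : IsUnit (colM t0 t1 t2).det := by rw [colM_det, h0]; exact isUnit_one
  have hS' := hS.comp hT
  have hF' := hF.comp1 _ (isForm_mulVec (colM t0 t1 t2))
  obtain ⟨c, hc⟩ := hF'.quartic
  have h14 : c 14 ≠ 0 := by
    have := hc ![0, 0, 1]
    rw [colM_mulVec] at this
    simp [q4] at this
    rwa [← this]
  obtain ⟨Δ, G₁, G₂, hΔ, hG1, hG2, hid⟩ := exists_bitangential c h14
  obtain ⟨q, hq, hFq, hΔq⟩ := common_zero hF' hΔ (by norm_num) (by norm_num)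
  have hqF : q4 c (q 0) (q 1) (q 2) = 0 := by rw [← hc, hFq]
  have hB := bit_of_contact hS' hc h14 hq hFq (by rw [(hid q).1, hqF, hΔq]; ring)
    (by rw [(hid q).2, hqF, hΔq]; ring)
  exact ⟨_, hB.comp hT⟩

theorem second_bitangent {F} (hS : SmoothF F) (hF : IsForm 4 F) {l} (hB : Bit F l) :
    ∃ l', Bit F l' ∧ l ⨯₃ l' ≠ 0 := by
  obtain ⟨hl, q, hq, hqF⟩ := hB
  obtain ⟨t2, hl2, h2⟩ := hS.ne_zero_on hF hl
  have h20 : t2 ≠ 0 := by rintro rfl; exact h2 (hF.zero_of_pos (by norm_num))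
  obtain ⟨t1, hl1⟩ := exists_dot_one hl
  have : ∃ t0, l ⬝ᵥ t0 = 0 ∧ t0 ⬝ᵥ (t1 ⨯₃ t2) ≠ 0 := by
    by_contra! h
    obtain ⟨μ, hμ⟩ := plane_vanish (m := t1 ⨯₃ t2) hl (fun X hX => by rw [dotProduct_comm, h X hX])
    have e := dot_self_cross t1 t2
    rw [hμ, dotProduct_smul, dotProduct_comm, hl1] at e
    have hμ0 : μ = 0 := by simpa using e
    rw [hμ0, zero_smul] at hμ
    have ht1 : t1 ≠ 0 := by rintro rfl; simp at hl1
    obtain ⟨ν, hν⟩ := parallel_of_cross ht1 hμ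
    rw [hν, dotProduct_smul, hl1] at hl2
    have : ν = 0 := by simpa using hl2
    rw [this, zero_smul] at hν
    exact h20 hν
  obtain ⟨t0, hl0, ht⟩ := this
  have hT : IsUnit (colM t0 t1 t2).det := by rw [colM_det]; exact isUnit_iff_ne_zero.2 ht
  have hS' := hS.comp hT
  have hF' := hF.comp1 _ (isForm_mulVec (colM t0 t1 t2))
  obtain ⟨S, hSs, hqS⟩ := (hq.comp1 _ (isForm_mulVec (colM t0 t1 t2))).quad
  have hsy := fun i j => hSs.apply i j
  have hplane : ∀ X : Fin 3 → ℂ, X 1 = 0 → F (colM t0 t1 t2 *ᵥ X) =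
      (S 2 2 * X 2 ^ 2 + 2 * S 0 2 * X 0 * X 2 + S 0 0 * X 0 ^ 2) ^ 2 := by
    intro X h1
    rw [hqF, hqS]
    · simp [dotProduct, mulVec, Fin.sum_univ_three, h1, hsy 0 2]; ring
    · rw [colM_mulVec]
      simp [dotProduct_add, hl0, hl2, h1]
  have hQ : IsForm 2 (fun X => S 2 2 * X 2 ^ 2 + 2 * S 0 2 * X 0 * X 2 + S 0 0 * X 0 ^ 2) :=
    (((((isForm_X 2).pow 2).smul (S 2 2)).add (((isForm_X 0).smul (2 * S 0 2)).mul (isForm_X 2))).add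
      (((isForm_X 0).pow 2).smul (S 0 0)))
  have hly : (![0, 1, 0] : Fin 3 → ℂ) ≠ 0 := fun e => by simpa using congrFun e 1
  have hdy : ∀ X : Fin 3 → ℂ, ![0, 1, 0] ⬝ᵥ X = X 1 := fun X => by
    simp [dotProduct, Fin.sum_univ_three]
  obtain ⟨C, hC, hFC⟩ := IsForm.div (n := 3) hly (hF'.sub (hQ.pow 2)) (fun X hX => by
    rw [hdy] at hX
    simp only [hplane X hX]; ring)
  obtain ⟨a, ha⟩ := hC.cubic
  have hk : S 2 2 ≠ 0 := by
    intro h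
    have := hplane ![0, 0, 1] rfl
    rw [colM_mulVec] at this
    simp [h] at this
    exact h2 this
  obtain ⟨s, hs⟩ := IsAlgClosed.exists_pow_nat_eq ((2 * S 0 2) ^ 2 - 4 * S 2 2 * S 0 0) (n := 2)
    (by norm_num)
  obtain ⟨l', p, hB', hp, hp1⟩ := second_aux hS' (S 2 2) ((- (2 * S 0 2) + s) / (2 * S 2 2))
    ((- (2 * S 0 2) - s) / (2 * S 2 2)) hk (a := a) (fun X => by
      have e := hFC X
      rw [hdy, ha] at e
      have e2 : S 2 2 * (X 2 - (- (2 * S 0 2) + s) / (2 * S 2 2) * X 0) *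
          (X 2 - (- (2 * S 0 2) - s) / (2 * S 2 2) * X 0) =
          S 2 2 * X 2 ^ 2 + 2 * S 0 2 * X 0 * X 2 + S 0 0 * X 0 ^ 2 := by
        field_simp
        linear_combination -X 0 ^ 2 * hs
      rw [e2]
      linear_combination e)
  refine ⟨_, hB'.comp hT, fun h => ?_⟩
  obtain ⟨μ, hμ⟩ := parallel_of_cross hl h
  have e1 : (l' ᵥ* (colM t0 t1 t2)⁻¹) ⬝ᵥ (colM t0 t1 t2 *ᵥ p) = 0 := by
    rw [← dotProduct_mulVec, mulVec_mulVec, nonsing_inv_mul _ hT, one_mulVec, hp]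
  rw [hμ, colM_mulVec] at e1
  simp [dotProduct_add, hl0, hl1, hl2, hp1] at e1
  rw [e1, zero_smul] at hμ
  exact (hB'.comp hT).1 hμ

theorem two_bitangents {F} (hS : SmoothF F) (hF : IsForm 4 F) :
    ∃ a g, Bit F a ∧ Bit F g ∧ a ⨯₃ g ≠ 0 := by
  obtain ⟨a, ha⟩ := first_bitangent hS hF
  obtain ⟨g, hg, h⟩ := second_bitangent hS hF ha
  exact ⟨a, g, ha, hg, h⟩

/-- Quadratic form of a matrix. -/
def qf (S : Matrix (Fin 3) (Fin 3) ℂ) (X : Fin 3 → ℂ) : ℂ := X ⬝ᵥ (S *ᵥ X)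

theorem isForm_qf (S) : IsForm 2 (qf S) := isForm_quad S

theorem qf_exp (S : Matrix (Fin 3) (Fin 3) ℂ) (hS : S.IsSymm) (X : Fin 3 → ℂ) : qf S X =
    S 0 0 * X 0 ^ 2 + S 1 1 * X 1 ^ 2 + S 2 2 * X 2 ^ 2 + 2 * S 0 1 * X 0 * X 1
      + 2 * S 0 2 * X 0 * X 2 + 2 * S 1 2 * X 1 * X 2 := by
  have e := fun i j => hS.apply i j
  simp only [qf, dotProduct, mulVec, Fin.sum_univ_three]
  rw [e 0 1, e 0 2, e 1 2]; ring

theorem dot3 (a X : Fin 3 → ℂ) : a ⬝ᵥ X = a 0 * X 0 + a 1 * X 1 + a 2 * X 2 := by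
  simp [dotProduct, Fin.sum_univ_three]

theorem sym_prod {S : Matrix (Fin 3) (Fin 3) ℂ} (hS : S.IsSymm) {b e : Fin 3 → ℂ}
    (h : ∀ X, qf S X = (b ⬝ᵥ X) * (e ⬝ᵥ X)) (i j) : S i j = (b i * e j + b j * e i) / 2 := by
  have h' : ∀ x y z : ℂ, S 0 0 * x ^ 2 + S 1 1 * y ^ 2 + S 2 2 * z ^ 2 + 2 * S 0 1 * x * y
      + 2 * S 0 2 * x * z + 2 * S 1 2 * y * z =
      (b 0 * x + b 1 * y + b 2 * z) * (e 0 * x + e 1 * y + e 2 * z) := by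
    intro x y z
    have := h ![x, y, z]
    rw [qf_exp S hS, dot3, dot3] at this
    simpa using this
  have s := fun i j => hS.apply i j
  have h1 := h' 1 0 0
  have h2 := h' 0 1 0
  have h3 := h' 0 0 1
  have h4 := h' 1 1 0
  have h5 := h' 1 0 1
  have h6 := h' 0 1 1
  have s1 := s 0 1
  have s2 := s 0 2
  have s3 := s 1 2
  fin_cases i <;> fin_cases j <;> simp
  · linear_combination h1
  · linear_combination (h4 - h1 - h2) / 2
  · linear_combination (h5 - h1 - h3) / 2
  · linear_combination s1 + (h4 - h1 - h2) / 2
  · linear_combination h2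
  · linear_combination (h6 - h2 - h3) / 2
  · linear_combination s2 + (h5 - h1 - h3) / 2
  · linear_combination s3 + (h6 - h2 - h3) / 2
  · linear_combination h3

theorem det_of_prod {S : Matrix (Fin 3) (Fin 3) ℂ} (hS : S.IsSymm) {b e : Fin 3 → ℂ}
    (h : ∀ X, qf S X = (b ⬝ᵥ X) * (e ⬝ᵥ X)) : S.det = 0 := by
  rw [det_fin_three]
  simp only [sym_prod hS h]
  ring

theorem plane_comb {v y X : Fin 3 → ℂ} (h : v ⨯₃ y ≠ 0) (hX : (v ⨯₃ y) ⬝ᵥ X = 0) :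
    ∃ s t : ℂ, X = s • v + t • y := by
  obtain ⟨d, hd⟩ := exists_dot_one' h
  refine ⟨_, _, plane_span h ?_ ?_ hd hX⟩
  · rw [dotProduct_comm, dot_self_cross]
  · rw [dotProduct_comm, dot_cross_self]

theorem prod_of_det {S : Matrix (Fin 3) (Fin 3) ℂ} (hS : S.IsSymm) (h : S.det = 0) :
    ∃ b e : Fin 3 → ℂ, ∀ X, qf S X = (b ⬝ᵥ X) * (e ⬝ᵥ X) := by
  obtain ⟨v, hv, hSv⟩ := exists_mulVec_eq_zero_iff.2 h
  obtain ⟨t1, ht1⟩ := exists_cross_ne hv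
  obtain ⟨t2, ht2⟩ := exists_dot_one ht1
  obtain ⟨s, t, hst, hz⟩ := (isForm_qf S).line_zero (by norm_num) t1 t2
  have hvy : v ⨯₃ (s • t1 + t • t2) ≠ 0 := by
    intro h0
    rw [map_add, map_smul, map_smul] at h0
    have e1 := congrArg (fun w => w ⬝ᵥ t2) h0
    have e2 := congrArg (fun w => w ⬝ᵥ t1) h0
    simp only [add_dotProduct, smul_dotProduct, ht2, zero_dotProduct] at e1 e2
    have e3 : (v ⨯₃ t2) ⬝ᵥ t2 = 0 := by rw [dotProduct_comm, dot_cross_self]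
    have e4 : (v ⨯₃ t1) ⬝ᵥ t1 = 0 := by rw [dotProduct_comm, dot_cross_self]
    have e5 : (v ⨯₃ t2) ⬝ᵥ t1 = -1 := by
      rw [← ht2, dot3, dot3]; simp [cross_apply]; ring
    rw [e3] at e1
    rw [e4, e5] at e2
    simp at e1 e2
    simp [e1, e2] at hst
  set y := s • t1 + t • t2
  obtain ⟨G, hG, e⟩ := IsForm.div (n := 1) hvy (isForm_qf S) (fun X hX => by
    obtain ⟨α, β, rfl⟩ := plane_comb hvy hX
    have e1 : S *ᵥ (α • v + β • y) = β • (S *ᵥ y) := by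
      rw [mulVec_add, mulVec_smul, mulVec_smul, hSv]; simp
    have e2 : v ⬝ᵥ (S *ᵥ y) = 0 := by
      rw [dotProduct_mulVec, ← mulVec_transpose, hS.eq, hSv, zero_dotProduct]
    rw [qf] at hz
    rw [qf, e1, add_dotProduct]
    simp [e2, hz])
  obtain ⟨m, hm⟩ := hG.lin
  exact ⟨_, m, fun X => by rw [e, hm]⟩

/-- No point with `b = e = w = 0` if `kF = w² - p b e`. -/
theorem pencil_pt {F} (hS : SmoothF F) {k : ℂ} (hk : k ≠ 0) {w p : (Fin 3 → ℂ) → ℂ} {b e : Fin 3 → ℂ}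
    (hw : IsPolyF w) (hp : IsPolyF p) (h : ∀ X, k * F X = w X ^ 2 - p X * ((b ⬝ᵥ X) * (e ⬝ᵥ X)))
    {X : Fin 3 → ℂ} (hX : X ≠ 0) (hb : b ⬝ᵥ X = 0) (he : e ⬝ᵥ X = 0) : w X ≠ 0 := by
  intro hw0
  apply hX
  exact hS.sing2 k hk hw hw ((hp.mul (isForm_dot b).isPoly).neg) (isForm_dot e).isPoly
    (fun X => by rw [h]; ring) hw0 hw0 (by simp [hb]) he

theorem pencil_cross {F} (hS : SmoothF F) {k : ℂ} (hk : k ≠ 0) {w p : (Fin 3 → ℂ) → ℂ}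
    {b e : Fin 3 → ℂ} (hw : IsForm 2 w) (hp : IsForm 2 p)
    (h : ∀ X, k * F X = w X ^ 2 - p X * ((b ⬝ᵥ X) * (e ⬝ᵥ X))) : b ⨯₃ e ≠ 0 := by
  intro h0
  have : ∃ l : Fin 3 → ℂ, ∀ X, l ⬝ᵥ X = 0 → b ⬝ᵥ X = 0 ∧ e ⬝ᵥ X = 0 := by
    by_cases hb : b = 0
    · exact ⟨e, fun X hX => ⟨by rw [hb, zero_dotProduct], hX⟩⟩
    · obtain ⟨μ, hμ⟩ := parallel_of_cross hb h0
      exact ⟨b, fun X hX => ⟨hX, by rw [hμ, smul_dotProduct, hX, smul_zero]⟩⟩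
  obtain ⟨l, hl⟩ := this
  obtain ⟨X, hX, h1, h2⟩ := common_zero (isForm_dot l) hw (by norm_num) (by norm_num)
  exact pencil_pt hS hk hw.isPoly hp.isPoly h hX (hl X h1).1 (hl X h1).2 h2

/-- The discriminant polynomial of a family of conics. -/
noncomputable def DP (U W P : Matrix (Fin 3) (Fin 3) ℂ) : Polynomial ℂ :=
  (Matrix.of fun i j => Polynomial.C (U i j) + Polynomial.C (2 * W i j) * Polynomial.X +
    Polynomial.C (P i j) * Polynomial.X ^ 2 : Matrix (Fin 3) (Fin 3) (Polynomial ℂ)).det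

theorem DP_eval (U W P : Matrix (Fin 3) (Fin 3) ℂ) (t : ℂ) :
    (DP U W P).eval t = (U + (2 * t) • W + t ^ 2 • P).det := by
  simp only [DP, det_fin_three, of_apply, Polynomial.eval_add, Polynomial.eval_sub,
    Polynomial.eval_mul, Polynomial.eval_C, Polynomial.eval_X, Polynomial.eval_pow, Matrix.add_apply,
    Matrix.smul_apply, smul_eq_mul]
  ring

theorem DP_deg (U W P : Matrix (Fin 3) (Fin 3) ℂ) : (DP U W P).natDegree ≤ 6 := by
  simp only [DP, det_fin_three, of_apply]
  compute_degree

theorem DP_deriv (U W P : Matrix (Fin 3) (Fin 3) ℂ) (t : ℂ) :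
    (DP U W P).derivative.eval t =
      2 * ((U + (2 * t) • W + t ^ 2 • P).adjugate * (W + t • P)).trace := by
  simp only [DP, det_fin_three, of_apply, Polynomial.derivative_add, Polynomial.derivative_sub,
    Polynomial.derivative_mul, Polynomial.derivative_C, Polynomial.derivative_X,
    Polynomial.derivative_X_pow, Polynomial.eval_add, Polynomial.eval_sub,
    Polynomial.eval_mul, Polynomial.eval_C, Polynomial.eval_X, Polynomial.eval_pow, Matrix.add_apply,
    Matrix.smul_apply, smul_eq_mul, adjugate_fin_three, trace_fin_three, mul_apply, Fin.sum_univ_three]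
  simp
  ring

theorem DP_reflect (U W P : Matrix (Fin 3) (Fin 3) ℂ) :
    DP P W U = (DP U W P).reflect 6 := by
  apply Polynomial.eq_of_infinite_eval_eq
  apply Set.Infinite.mono (s := {0}ᶜ)
  · intro t ht
    have ht : t ≠ 0 := ht
    simp only [Set.mem_ofPred_eq]
    let _ : Invertible t⁻¹ := invertibleOfNonzero (inv_ne_zero ht)
    have := Polynomial.eval₂_reflect_mul_pow (RingHom.id ℂ) t⁻¹ 6 (DP U W P) (DP_deg U W P)
    rw [Polynomial.eval₂_id, Polynomial.eval₂_id, invOf_eq_inv, inv_inv, DP_eval] at this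
    rw [DP_eval]
    have e : P + (2 * t) • W + t ^ 2 • U = t ^ 2 • (U + (2 * t⁻¹) • W + t⁻¹ ^ 2 • P) := by
      ext i j
      simp
      field_simp
      ring
    rw [e, det_smul, ← this]
    simp
    field_simp
  · exact Set.Finite.infinite_compl (Set.finite_singleton 0)

theorem qf_fam (U W P : Matrix (Fin 3) (Fin 3) ℂ) (s t : ℂ) (X) :
    qf (U + s • W + t • P) X = qf U X + s * qf W X + t * qf P X := by
  simp only [qf, add_mulVec, smul_mulVec, dotProduct_add, dotProduct_smul, smul_eq_mul]

theorem qf_fam2 (W P : Matrix (Fin 3) (Fin 3) ℂ) (t : ℂ) (X) :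
    qf (W + t • P) X = qf W X + t * qf P X := by
  simp only [qf, add_mulVec, smul_mulVec, dotProduct_add, dotProduct_smul, smul_eq_mul]

theorem symm_fam {U W P : Matrix (Fin 3) (Fin 3) ℂ} (hU : U.IsSymm) (hW : W.IsSymm) (hP : P.IsSymm)
    (s t : ℂ) : (U + s • W + t • P).IsSymm := (hU.add (hW.smul s)).add (hP.smul t)

theorem tr_adj_prod {S W : Matrix (Fin 3) (Fin 3) ℂ} (hS : S.IsSymm) (hW : W.IsSymm)
    {b e : Fin 3 → ℂ} (h : ∀ X, qf S X = (b ⬝ᵥ X) * (e ⬝ᵥ X)) :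
    (S.adjugate * W).trace = - qf W (b ⨯₃ e) / 4 := by
  have s := fun i j => hW.apply i j
  rw [qf_exp W hW]
  simp only [adjugate_fin_three, trace_fin_three, mul_apply, Fin.sum_univ_three, sym_prod hS h]
  rw [s 0 1, s 0 2, s 1 2]
  simp [cross_apply]
  ring

theorem CF_simple {F} (hS : SmoothF F) {k : ℂ} (hk : k ≠ 0) {U W P : Matrix (Fin 3) (Fin 3) ℂ}
    (hU : U.IsSymm) (hW : W.IsSymm) (hP : P.IsSymm)
    (h : ∀ X, k * F X = qf W X ^ 2 - qf P X * qf U X) {t : ℂ} (ht : (DP U W P).eval t = 0) :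
    (DP U W P).derivative.eval t ≠ 0 := by
  rw [DP_eval] at ht
  have hC := symm_fam hU hW hP (2 * t) (t ^ 2)
  obtain ⟨b, e, hbe⟩ := prod_of_det hC ht
  have h' : ∀ X, k * F X = qf (W + t • P) X ^ 2 - qf P X * ((b ⬝ᵥ X) * (e ⬝ᵥ X)) := by
    intro X
    rw [← hbe, qf_fam, qf_fam2, h]; ring
  have hx := pencil_cross hS hk (isForm_qf _) (isForm_qf _) h'
  have hw := pencil_pt hS hk (isForm_qf _).isPoly (isForm_qf _).isPoly h' hx
    (dot_self_cross b e) (dot_cross_self b e)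
  rw [DP_deriv, tr_adj_prod hC (hW.add (hP.smul t)) hbe]
  intro h0
  apply hw
  linear_combination -2 * h0

theorem DP_ne_zero {F} (hS : SmoothF F) {k : ℂ} (hk : k ≠ 0) {U W P : Matrix (Fin 3) (Fin 3) ℂ}
    (hU : U.IsSymm) (hW : W.IsSymm) (hP : P.IsSymm)
    (h : ∀ X, k * F X = qf W X ^ 2 - qf P X * qf U X) : DP U W P ≠ 0 := by
  intro h0
  apply CF_simple hS hk hU hW hP h (t := 0) (by rw [h0]; simp)
  rw [h0]; simp

theorem roots_enum {D : Polynomial ℂ} {n : ℕ} (h0 : D ≠ 0) (hd : D.natDegree = n)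
    (hs : ∀ t, D.eval t = 0 → D.derivative.eval t ≠ 0) :
    ∃ r : Fin n → ℂ, Function.Injective r ∧ ∀ t, D.eval t = 0 ↔ ∃ i, r i = t := by
  have hnd : D.roots.Nodup := by
    apply Polynomial.nodup_roots
    rw [Polynomial.separable_def]
    rw [Polynomial.isCoprime_iff_aeval_ne_zero_of_isAlgClosed ℂ ℂ]
    intro t
    by_cases ht : D.eval t = 0
    · right
      simpa using hs t ht
    · left
      simpa using ht
  have hc : D.roots.toFinset.card = n := by
    rw [Multiset.toFinset_card_of_nodup hnd, ← hd]
    exact IsAlgClosed.card_roots_eq_natDegree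
  let e := D.roots.toFinset.equivFinOfCardEq hc
  refine ⟨fun i => (e.symm i : ℂ), fun i j hij => e.symm.injective (Subtype.ext hij), fun t => ?_⟩
  constructor
  · intro ht
    exact ⟨e ⟨t, by simp [h0, ht]⟩, by simp⟩
  · rintro ⟨i, rfl⟩
    have := (e.symm i).2
    rw [Multiset.mem_toFinset, Polynomial.mem_roots h0] at this
    exact this

theorem CF6 {F} (hS : SmoothF F) {k : ℂ} (hk : k ≠ 0) {U W P : Matrix (Fin 3) (Fin 3) ℂ}
    (hU : U.IsSymm) (hW : W.IsSymm) (hP : P.IsSymm)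
    (h : ∀ X, k * F X = qf W X ^ 2 - qf P X * qf U X) (hdet : P.det ≠ 0) :
    ∃ r : Fin 6 → ℂ, Function.Injective r ∧
      ∀ t, (U + (2 * t) • W + t ^ 2 • P).det = 0 ↔ ∃ i, r i = t := by
  have hd : (DP U W P).natDegree = 6 := by
    apply le_antisymm (DP_deg U W P)
    apply Polynomial.le_natDegree_of_ne_zero
    have : (DP P W U).coeff 0 = P.det := by
      rw [Polynomial.coeff_zero_eq_eval_zero, DP_eval]; simp
    rw [DP_reflect, Polynomial.coeff_reflect] at this
    change (DP U W P).coeff 6 = _ at this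
    rwa [this]
  simp only [← DP_eval]
  exact roots_enum (DP_ne_zero hS hk hU hW hP h) hd (fun t => CF_simple hS hk hU hW hP h)

theorem CF5 {F} (hS : SmoothF F) {k : ℂ} (hk : k ≠ 0) {U W P : Matrix (Fin 3) (Fin 3) ℂ}
    (hU : U.IsSymm) (hW : W.IsSymm) (hP : P.IsSymm)
    (h : ∀ X, k * F X = qf W X ^ 2 - qf P X * qf U X) (hdet : P.det = 0) :
    ∃ r : Fin 5 → ℂ, Function.Injective r ∧
      ∀ t, (U + (2 * t) • W + t ^ 2 • P).det = 0 ↔ ∃ i, r i = t := by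
  have hd : (DP U W P).natDegree = 5 := by
    have h6 : (DP U W P).coeff 6 = 0 := by
      have : (DP P W U).coeff 0 = P.det := by
        rw [Polynomial.coeff_zero_eq_eval_zero, DP_eval]; simp
      rw [DP_reflect, Polynomial.coeff_reflect] at this
      change (DP U W P).coeff 6 = _ at this
      rw [this, hdet]
    have h5 : (DP U W P).coeff 5 ≠ 0 := by
      have h1 := CF_simple hS hk hP hW hU (fun X => by rw [h]; ring) (t := 0)
        (by rw [DP_eval]; simpa using hdet)
      rw [← Polynomial.coeff_zero_eq_eval_zero, Polynomial.coeff_derivative, DP_reflect,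
        Polynomial.coeff_reflect] at h1
      change (DP U W P).coeff 5 * _ ≠ 0 at h1
      intro h5
      apply h1
      rw [h5, zero_mul]
    apply le_antisymm _ (Polynomial.le_natDegree_of_ne_zero h5)
    rw [Polynomial.natDegree_le_iff_coeff_eq_zero]
    intro N hN
    by_cases hN6 : N = 6
    · rw [hN6, h6]
    · apply Polynomial.coeff_eq_zero_of_natDegree_lt
      have := DP_deg U W P
      omega
  simp only [← DP_eval]
  exact roots_enum (DP_ne_zero hS hk hU hW hP h) hd (fun t => CF_simple hS hk hU hW hP h)

/-- Two vectors are proportional with nonzero factor. -/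
def Par {n : ℕ} (a b : Fin n → ℂ) : Prop := ∃ μ : ℂ, μ ≠ 0 ∧ b = μ • a

theorem Par.refl {n : ℕ} (a : Fin n → ℂ) : Par a a := ⟨1, one_ne_zero, (one_smul _ _).symm⟩

theorem Par.symm {n : ℕ} {a b : Fin n → ℂ} (h : Par a b) : Par b a := by
  obtain ⟨μ, hμ, rfl⟩ := h
  exact ⟨μ⁻¹, inv_ne_zero hμ, by rw [smul_smul, inv_mul_cancel₀ hμ, one_smul]⟩

theorem Par.trans {n : ℕ} {a b c : Fin n → ℂ} (h : Par a b) (h' : Par b c) : Par a c := by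
  obtain ⟨μ, hμ, rfl⟩ := h
  obtain ⟨ν, hν, rfl⟩ := h'
  exact ⟨ν * μ, mul_ne_zero hν hμ, by rw [smul_smul]⟩

theorem par_of_smul {n : ℕ} {a b : Fin n → ℂ} (hb : b ≠ 0) {μ : ℂ} (h : b = μ • a) : Par a b :=
  ⟨μ, by rintro rfl; simp at h; exact hb h, h⟩

theorem Par.ne_zero {n : ℕ} {a b : Fin n → ℂ} (h : Par a b) (ha : a ≠ 0) : b ≠ 0 := by
  obtain ⟨μ, hμ, rfl⟩ := h
  exact smul_ne_zero hμ ha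

theorem Par.cross {a b : Fin 3 → ℂ} (h : Par a b) : a ⨯₃ b = 0 := by
  obtain ⟨μ, hμ, rfl⟩ := h
  simp

theorem dot_ext {a b : Fin 3 → ℂ} (h : ∀ X, a ⬝ᵥ X = b ⬝ᵥ X) : a = b := by
  funext i
  simpa using h (Pi.single i 1)

theorem dot_zero {a : Fin 3 → ℂ} (h : ∀ X, a ⬝ᵥ X = 0) : a = 0 :=
  dot_ext fun X => by rw [h, zero_dotProduct]

/-- Unique factorisation of a product of two linear forms. -/
theorem prod_unique {b e b' e' : Fin 3 → ℂ} {κ : ℂ} (hb : b ≠ 0) (he : e ≠ 0) (hb' : b' ≠ 0)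
    (he' : e' ≠ 0) (h : ∀ X, (b ⬝ᵥ X) * (e ⬝ᵥ X) = κ * ((b' ⬝ᵥ X) * (e' ⬝ᵥ X))) :
    (Par b b' ∧ Par e e') ∨ (Par b e' ∧ Par e b') := by
  have hκ : κ ≠ 0 := by
    rintro rfl
    rcases poly_domain (isForm_dot b).isPoly (isForm_dot e).isPoly (fun X => by rw [h]; simp) with h | h
    · exact hb (dot_zero h)
    · exact he (dot_zero h)
  have key : ∀ {b' e' : Fin 3 → ℂ}, b' ≠ 0 → e' ≠ 0 →
      (∀ X, (b ⬝ᵥ X) * (e ⬝ᵥ X) = κ * ((b' ⬝ᵥ X) * (e' ⬝ᵥ X))) →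
      (∀ X, b ⬝ᵥ X = 0 → b' ⬝ᵥ X = 0) → Par b b' ∧ Par e e' := by
    intro b' e' hb' he' h h1
    obtain ⟨μ, hμ⟩ := plane_vanish hb h1
    refine ⟨par_of_smul hb' hμ, ?_⟩
    have h2 : ∀ X, (b ⬝ᵥ X) * ((e - (κ * μ) • e') ⬝ᵥ X) = 0 := by
      intro X
      have := h X
      rw [hμ, smul_dotProduct, smul_eq_mul] at this
      rw [sub_dotProduct, smul_dotProduct, smul_eq_mul]
      linear_combination this
    rcases poly_domain (isForm_dot b).isPoly (isForm_dot _).isPoly h2 with h3 | h3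
    · exact absurd (dot_zero h3) hb
    · exact (par_of_smul he (sub_eq_zero.1 (dot_zero h3))).symm
  have h1 : ∀ X, b ⬝ᵥ X = 0 → (b' ⬝ᵥ X) * (e' ⬝ᵥ X) = 0 := by
    intro X hX
    have := h X
    rw [hX, zero_mul] at this
    exact (mul_eq_zero.1 this.symm).resolve_left hκ
  rcases plane_domain hb (isForm_dot b') (isForm_dot e') h1 with h2 | h2
  · exact Or.inl (key hb' he' h h2)
  · exact Or.inr (key he' hb' (fun X => by rw [h]; ring) h2)

theorem dual_vec {a g : Fin 3 → ℂ} (h : a ⨯₃ g ≠ 0) : ∃ v, a ⬝ᵥ v = 0 ∧ g ⬝ᵥ v = 1 := by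
  obtain ⟨d, hd⟩ := exists_dot_one' h
  refine ⟨d ⨯₃ a, dot_cross_self _ _, ?_⟩
  rw [← hd]
  rw [dot3, dot3]; simp [cross_apply]; ring

theorem ortho_cross {a g X : Fin 3 → ℂ} (h : a ⨯₃ g ≠ 0) (h1 : a ⬝ᵥ X = 0) (h2 : g ⬝ᵥ X = 0) :
    ∃ c : ℂ, X = c • (a ⨯₃ g) := by
  apply parallel_of_cross h
  rw [dot3] at h1 h2
  funext i
  fin_cases i <;> simp [cross_apply]
  · linear_combination g 0 * h1 - a 0 * h2
  · linear_combination g 1 * h1 - a 1 * h2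
  · linear_combination g 2 * h1 - a 2 * h2

/-- Any two bitangents give a representation `F = w² - a g u`. -/
theorem two_bit_form {F} (hF : IsForm 4 F) {a g : Fin 3 → ℂ} (ha : Bit F a) (hg : Bit F g)
    (hag : a ⨯₃ g ≠ 0) : ∃ w u, IsForm 2 w ∧ IsForm 2 u ∧
      ∀ X, F X = w X ^ 2 - ((a ⬝ᵥ X) * (g ⬝ᵥ X)) * u X := by
  obtain ⟨ha0, q1, hq1, h1⟩ := ha
  obtain ⟨hg0, q2', hq2', h2'⟩ := hg
  obtain ⟨q2, hq2, h2, hY⟩ : ∃ q2, IsForm 2 q2 ∧ (∀ X, g ⬝ᵥ X = 0 → F X = q2 X ^ 2) ∧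
      q1 (a ⨯₃ g) = q2 (a ⨯₃ g) := by
    have e1 := h1 (a ⨯₃ g) (dot_self_cross _ _)
    have e2 := h2' (a ⨯₃ g) (dot_cross_self _ _)
    rcases sq_eq_sq_iff_eq_or_eq_neg.1 (e1.symm.trans e2) with h | h
    · exact ⟨q2', hq2', h2', h⟩
    · exact ⟨fun X => - q2' X, hq2'.neg, fun X hX => by rw [h2' X hX, neg_sq], h⟩
  obtain ⟨v, hv1, hv2⟩ := dual_vec hag
  obtain ⟨m, hm, hm'⟩ := IsForm.div ha0 (n := 1)
      (((hq2.sub hq1).comp1 _ (isForm_proj g v))) (by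
    intro X hX
    obtain ⟨c, hc⟩ := ortho_cross hag (X := X - (g ⬝ᵥ X) • v)
      (by rw [dotProduct_sub, dotProduct_smul, hv1, hX]; simp) (proj_mem hv2 X)
    show q2 _ - q1 _ = 0
    rw [hc, hq2.homog, hq1.homog, hY, sub_self])
  let w := fun X => q1 X + (a ⬝ᵥ X) * m X
  have hw : IsForm 2 w := hq1.add ((isForm_dot a).mul hm)
  obtain ⟨G, hG, hG'⟩ := IsForm.div ha0 (n := 3) (hF.sub (hw.pow 2)) (by
    intro X hX
    show F X - (q1 X + (a ⬝ᵥ X) * m X) ^ 2 = 0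
    rw [h1 X hX, hX]; ring)
  have hG0 : ∀ X, g ⬝ᵥ X = 0 → (a ⬝ᵥ X) * G X = 0 := by
    intro X hX
    rw [← hG']
    have := hm' X
    simp only [hX, zero_smul, sub_zero] at this
    show F X - (q1 X + (a ⬝ᵥ X) * m X) ^ 2 = 0
    rw [← this, h2 X hX]; ring
  have hG1 : ∀ X, g ⬝ᵥ X = 0 → G X = 0 := by
    rcases plane_domain hg0 (isForm_dot a) hG hG0 with h | h
    · obtain ⟨μ, hμ⟩ := plane_vanish hg0 h
      exact absurd (by rw [hμ]; simp) hag
    · exact h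
  obtain ⟨u, hu, hu'⟩ := IsForm.div hg0 (n := 2) hG hG1
  refine ⟨w, fun X => - u X, hw, hu.neg, fun X => ?_⟩
  have := hG' X
  rw [hu'] at this
  linear_combination this

theorem two_bit_unique {F} (hS : SmoothF F) {a g : Fin 3 → ℂ} (ha0 : a ≠ 0) (hg0 : g ≠ 0)
    (hag : a ⨯₃ g ≠ 0) {w u w' u' : (Fin 3 → ℂ) → ℂ} (hw : IsForm 2 w) (hu : IsForm 2 u)
    (hw' : IsForm 2 w') (hu' : IsForm 2 u')
    (h : ∀ X, F X = w X ^ 2 - ((a ⬝ᵥ X) * (g ⬝ᵥ X)) * u X)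
    (h' : ∀ X, F X = w' X ^ 2 - ((a ⬝ᵥ X) * (g ⬝ᵥ X)) * u' X) :
    ∃ t : ℂ, ∀ X, u' X = u X + (2 * t) * w X + t ^ 2 * ((a ⬝ᵥ X) * (g ⬝ᵥ X)) := by
  have hwY : w (a ⨯₃ g) ≠ 0 := pencil_pt hS one_ne_zero hw.isPoly hu.isPoly
    (fun X => by rw [h]; ring) hag (dot_self_cross _ _) (dot_cross_self _ _)
  have key : ∀ {w'}, IsForm 2 w' → (∀ X, F X = w' X ^ 2 - ((a ⬝ᵥ X) * (g ⬝ᵥ X)) * u' X) →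
      (∀ X, a ⬝ᵥ X = 0 → w' X - w X = 0) →
      ∃ t : ℂ, ∀ X, u' X = u X + (2 * t) * w X + t ^ 2 * ((a ⬝ᵥ X) * (g ⬝ᵥ X)) := by
    intro w' hw' h' hA
    have hB0 : ∀ X, g ⬝ᵥ X = 0 → (w' X - w X) * (w' X + w X) = 0 := by
      intro X hX
      have e1 := h X
      have e2 := h' X
      rw [hX] at e1 e2
      linear_combination e1 - e2
    have hB : ∀ X, g ⬝ᵥ X = 0 → w' X - w X = 0 := by
      rcases plane_domain hg0 (hw'.sub hw) (hw'.add hw) hB0 with h | h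
      · exact h
      · exfalso
        have e1 := hA _ (dot_self_cross a g)
        have e2 := h _ (dot_cross_self a g)
        apply hwY
        linear_combination (e2 - e1) / 2
    obtain ⟨G, hG, hG'⟩ := IsForm.div ha0 (n := 1) (hw'.sub hw) hA
    have hG0 : ∀ X, g ⬝ᵥ X = 0 → G X = 0 := by
      rcases plane_domain hg0 (isForm_dot a) hG (fun X hX => by rw [← hG', hB X hX]) with h | h
      · obtain ⟨μ, hμ⟩ := plane_vanish hg0 h
        exact absurd (by rw [hμ]; simp) hag
      · exact h
    obtain ⟨H, hH, hH'⟩ := IsForm.div hg0 (n := 0) hG hG0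
    obtain ⟨t, ht⟩ := isForm0_const hH
    have hp : IsForm 2 (fun X => (a ⬝ᵥ X) * (g ⬝ᵥ X)) := (isForm_dot a).mul (isForm_dot g)
    have e : ∀ X, w' X = w X + t * ((a ⬝ᵥ X) * (g ⬝ᵥ X)) := by
      intro X
      have := hG' X
      rw [hH', ht] at this
      linear_combination this
    refine ⟨t, ?_⟩
    have := poly_domain hp.isPoly (G := fun X => u X + (2 * t) * w X +
      t ^ 2 * ((a ⬝ᵥ X) * (g ⬝ᵥ X)) - u' X)
      (((hu.add (hw.smul (2 * t))).add (hp.smul (t ^ 2))).sub hu').isPoly (by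
        intro X
        have e1 := h X
        have e2 := h' X
        rw [e] at e2
        linear_combination e1 - e2)
    rcases this with h0 | h0
    · exfalso
      rcases poly_domain (isForm_dot a).isPoly (isForm_dot g).isPoly h0 with h1 | h1
      · exact ha0 (dot_zero h1)
      · exact hg0 (dot_zero h1)
    · intro X
      linear_combination - h0 X
  have hA0 : ∀ X, a ⬝ᵥ X = 0 → (w' X - w X) * (w' X + w X) = 0 := by
    intro X hX
    have e1 := h X
    have e2 := h' X
    rw [hX] at e1 e2
    linear_combination e1 - e2
  rcases plane_domain ha0 (hw'.sub hw) (hw'.add hw) hA0 with h1 | h1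
  · exact key hw' h' h1
  · exact key hw'.neg (fun X => by rw [h', neg_sq]) (fun X hX => by linear_combination - h1 X hX)

/-- The determinant of a zero-diagonal symmetric matrix in terms of three products. -/
def detf (p q r : ℂ) : ℂ := p ^ 2 + q ^ 2 + r ^ 2 - 2 * p * q - 2 * p * r - 2 * q * r

/-- The structure attached to a pair of bitangents. -/
structure Theta (F : (Fin 3 → ℂ) → ℂ) (a g : Fin 3 → ℂ) where
  θ : Fin 5 × Bool → (Fin 3 → ℂ) × (Fin 3 → ℂ)
  ne1 : ∀ s, (θ s).1 ≠ 0
  ne2 : ∀ s, (θ s).2 ≠ 0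
  γ : Fin 5 → (Fin 3 → ℂ) → ℂ
  hγ : ∀ s X, ((θ s).1 ⬝ᵥ X) * ((θ s).2 ⬝ᵥ X) = γ s.1 X
  complete : ∀ (b e : Fin 3 → ℂ) (κ : ℂ) (w : (Fin 3 → ℂ) → ℂ), b ≠ 0 → e ≠ 0 → κ ≠ 0 → IsForm 2 w →
    (∀ X, F X = w X ^ 2 - ((a ⬝ᵥ X) * (g ⬝ᵥ X)) * (κ * ((b ⬝ᵥ X) * (e ⬝ᵥ X)))) →
    ∃ s, Par (θ s).1 b ∧ Par (θ s).2 e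
  inj : ∀ s t, Par (θ s).1 (θ t).1 → Par (θ s).2 (θ t).2 → s = t
  pair : ∀ s t, s.1 ≠ t.1 → ∃ κ δ : ℂ, κ ≠ 0 ∧ δ ≠ 0 ∧ ∀ X, κ * F X =
    detf (δ * ((a ⬝ᵥ X) * (g ⬝ᵥ X))) (((θ s).1 ⬝ᵥ X) * ((θ s).2 ⬝ᵥ X))
      (((θ t).1 ⬝ᵥ X) * ((θ t).2 ⬝ᵥ X))

theorem theta_exists {F} (hS : SmoothF F) (hF : IsForm 4 F) {a g : Fin 3 → ℂ} (ha : Bit F a)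
    (hg : Bit F g) (hag : a ⨯₃ g ≠ 0) : Nonempty (Theta F a g) := by
  obtain ⟨w, u, hw, hu, h⟩ := two_bit_form hF ha hg hag
  have ha0 := ha.1
  have hg0 := hg.1
  have hp : IsForm 2 (fun X => (a ⬝ᵥ X) * (g ⬝ᵥ X)) := (isForm_dot a).mul (isForm_dot g)
  obtain ⟨W, hW, eW⟩ := hw.quad
  obtain ⟨U, hU, eU⟩ := hu.quad
  obtain ⟨P, hP, eP⟩ := hp.quad
  change ∀ X, w X = qf W X at eW
  change ∀ X, u X = qf U X at eU
  change ∀ X, (a ⬝ᵥ X) * (g ⬝ᵥ X) = qf P X at eP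
  have hdet : P.det = 0 := det_of_prod hP (fun X => (eP X).symm)
  obtain ⟨r, hr, hr'⟩ := CF5 hS one_ne_zero hU hW hP
    (fun X => by rw [← eW, ← eU, ← eP, h]; ring) hdet
  have hC : ∀ i, ∃ b e : Fin 3 → ℂ, ∀ X, u X + (2 * r i) * w X + r i ^ 2 *
      ((a ⬝ᵥ X) * (g ⬝ᵥ X)) = (b ⬝ᵥ X) * (e ⬝ᵥ X) := by
    intro i
    obtain ⟨b, e, hbe⟩ := prod_of_det (symm_fam hU hW hP (2 * r i) (r i ^ 2)) ((hr' (r i)).2 ⟨i, rfl⟩)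
    refine ⟨b, e, fun X => ?_⟩
    rw [← hbe, qf_fam, eW, eU, eP]
  choose b e hbe using hC
  -- the conic families
  let wi : Fin 5 → (Fin 3 → ℂ) → ℂ := fun i X => w X + r i * ((a ⬝ᵥ X) * (g ⬝ᵥ X))
  have hwi : ∀ i, IsForm 2 (wi i) := fun i => hw.add (hp.smul (r i))
  have hFi : ∀ i X, F X = wi i X ^ 2 - ((a ⬝ᵥ X) * (g ⬝ᵥ X)) * ((b i ⬝ᵥ X) * (e i ⬝ᵥ X)) := by
    intro i X
    rw [← hbe, h]
    simp only [wi]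
    ring
  have hcr : ∀ i, b i ⨯₃ e i ≠ 0 := fun i =>
    pencil_cross hS one_ne_zero (hwi i) hp (fun X => by rw [one_mul, hFi i])
  have hb0 : ∀ i, b i ≠ 0 := fun i h0 => hcr i (by rw [h0]; simp)
  have he0 : ∀ i, e i ≠ 0 := fun i h0 => hcr i (by rw [h0]; simp)
  have hdist : ∀ i j κ, (∀ X, (b j ⬝ᵥ X) * (e j ⬝ᵥ X) = κ * ((b i ⬝ᵥ X) * (e i ⬝ᵥ X))) → i = j := by
    intro i j κ hij
    by_contra hne
    have hδ : r i - r j ≠ 0 := sub_ne_zero.2 (fun h => hne (hr h))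
    have hpol := poly_domain hp.isPoly (G := fun X => (r i - r j) * (wi i X + wi j X) -
        (1 - κ) * ((b i ⬝ᵥ X) * (e i ⬝ᵥ X)))
      ((((hwi i).add (hwi j)).smul _).sub (((isForm_dot (b i)).mul (isForm_dot (e i))).smul _)).isPoly
      (by
        intro X
        have e1 := hFi i X
        have e2 := hFi j X
        rw [hij] at e2
        have e3 : wi i X - wi j X = (r i - r j) * ((a ⬝ᵥ X) * (g ⬝ᵥ X)) := by simp only [wi]; ring
        linear_combination e2 - e1 - (wi i X + wi j X) * e3)
    have hpol : ∀ X, (r i - r j) * (wi i X + wi j X) -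
        (1 - κ) * ((b i ⬝ᵥ X) * (e i ⬝ᵥ X)) = 0 := by
      rcases hpol with h0 | h0
      · exfalso
        rcases poly_domain (isForm_dot a).isPoly (isForm_dot g).isPoly h0 with h1 | h1
        · exact ha0 (dot_zero h1)
        · exact hg0 (dot_zero h1)
      · exact h0
    obtain ⟨X, hX, hX1, hX2⟩ := common_zero (isForm_dot a) (isForm_dot (b i)) one_pos one_pos
    have e1 := hpol X
    rw [hX2] at e1
    have e1' : wi i X + wi j X = 0 := by
      have e1'' : (r i - r j) * (wi i X + wi j X) = 0 := by linear_combination e1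
      exact (mul_eq_zero.1 e1'').resolve_left hδ
    have e2 : wi i X - wi j X = 0 := by simp only [wi, hX1]; ring
    have e3 : wi i X = 0 := by linear_combination (e1' + e2) / 2
    apply hX
    exact hS.sing2 1 one_ne_zero (hwi i).isPoly (hwi i).isPoly hp.neg.isPoly
      ((isForm_dot (b i)).mul (isForm_dot (e i))).isPoly
      (fun X => by rw [one_mul, hFi i]; ring) e3 e3 (by simp [hX1]) (by simp [hX2])
  let θ : Fin 5 × Bool → (Fin 3 → ℂ) × (Fin 3 → ℂ) := fun s =>
    if s.2 then (b s.1, e s.1) else (e s.1, b s.1)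
  have hθ : ∀ s X, ((θ s).1 ⬝ᵥ X) * ((θ s).2 ⬝ᵥ X) = (b s.1 ⬝ᵥ X) * (e s.1 ⬝ᵥ X) := by
    rintro ⟨i, _ | _⟩ X
    · simp [θ, mul_comm]
    · simp [θ]
  refine ⟨⟨θ, ?_, ?_, fun i X => (b i ⬝ᵥ X) * (e i ⬝ᵥ X), hθ, ?_, ?_, ?_⟩⟩
  · rintro ⟨i, _ | _⟩ <;> simp [θ, hb0, he0]
  · rintro ⟨i, _ | _⟩ <;> simp [θ, hb0, he0]
  · intro b' e' κ w' hb' he' hκ hw' h'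
    obtain ⟨t, ht⟩ := two_bit_unique hS ha0 hg0 hag hw hu hw'
      (((isForm_dot b').mul (isForm_dot e')).smul κ) h h'
    have hd : (U + (2 * t) • W + t ^ 2 • P).det = 0 := by
      apply det_of_prod (symm_fam hU hW hP _ _) (b := κ • b') (e := e')
      intro X
      rw [qf_fam, ← eW, ← eU, ← eP, ← ht X, smul_dotProduct, smul_eq_mul, mul_assoc]
    obtain ⟨i, rfl⟩ := (hr' t).1 hd
    have := fun X => (hbe i X).symm.trans (ht X).symm
    rcases prod_unique (hb0 i) (he0 i) hb' he' this with h1 | h1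
    · exact ⟨(i, true), by simpa [θ] using h1⟩
    · exact ⟨(i, false), by simpa [θ] using h1.symm⟩
  · intro s t h1 h2
    have hst : s.1 = t.1 := by
      obtain ⟨μ, hμ, e1⟩ := h1
      obtain ⟨ν, hν, e2⟩ := h2
      apply hdist s.1 t.1 (μ * ν)
      intro X
      rw [← hθ, ← hθ, e1, e2]
      simp; ring
    obtain ⟨i, x⟩ := s
    obtain ⟨j, y⟩ := t
    obtain rfl : i = j := hst
    cases x <;> cases y
    · rfl
    · exact absurd h1.symm.cross (by simpa [θ] using hcr i)
    · exact absurd h1.cross (by simpa [θ] using hcr i)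
    · rfl
  · intro s t hst
    have hδ : r t.1 - r s.1 ≠ 0 := sub_ne_zero.2 (fun h => hst (hr h).symm)
    refine ⟨4 * (r t.1 - r s.1) ^ 2, (r t.1 - r s.1) ^ 2, by simpa using hδ, by simpa using hδ, fun X => ?_⟩
    rw [hθ, hθ, ← hbe, ← hbe, h, detf]
    ring

/-- The class of a nonzero vector. -/
noncomputable abbrev cl (v : Fin 3 → ℂ) (hv : v ≠ 0) : Projectivization ℂ (Fin 3 → ℂ) :=
  Projectivization.mk ℂ v hv

theorem cl_eq {a b : Fin 3 → ℂ} (ha : a ≠ 0) (hb : b ≠ 0) : cl a ha = cl b hb ↔ Par a b := by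
  rw [Projectivization.mk_eq_mk_iff']
  constructor
  · rintro ⟨c, hc⟩
    exact (par_of_smul ha hc.symm).symm
  · intro h
    obtain ⟨μ, -, h⟩ := h.symm
    exact ⟨μ, h.symm⟩

theorem cl_rep (x : Projectivization ℂ (Fin 3 → ℂ)) : cl x.rep x.rep_nonzero = x := x.mk_rep

theorem Bit.par {F} {a b : Fin 3 → ℂ} (h : Bit F a) (hab : Par a b) : Bit F b := by
  obtain ⟨ha, q, hq, h⟩ := h
  refine ⟨hab.ne_zero ha, q, hq, fun X hX => h X ?_⟩
  obtain ⟨μ, hμ, rfl⟩ := hab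
  rw [smul_dotProduct, smul_eq_mul] at hX
  exact (mul_eq_zero.1 hX).resolve_left hμ

/-- The set of bitangents as a set of points of the dual plane. -/
def BitP (F : (Fin 3 → ℂ) → ℂ) : Set (Projectivization ℂ (Fin 3 → ℂ)) := {x | Bit F x.rep}

theorem cl_mem_BitP {F} {a : Fin 3 → ℂ} (ha : a ≠ 0) : cl a ha ∈ BitP F ↔ Bit F a := by
  have h : Par (cl a ha).rep a := (cl_eq _ _).1 (cl_rep _)
  exact ⟨fun h' => Bit.par h' h, fun h' => Bit.par h' h.symm⟩

/-- Ordered sextuples of lines defining a zero-diagonal symmetric determinant for `F`. -/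
def InW (F : (Fin 3 → ℂ) → ℂ) (w : Fin 6 → Projectivization ℂ (Fin 3 → ℂ)) : Prop :=
  ∃ (m : Fin 6 → Fin 3 → ℂ) (hm : ∀ i, m i ≠ 0), (∀ i, cl (m i) (hm i) = w i) ∧
    ∃ κ : ℂ, κ ≠ 0 ∧ ∀ X, κ * F X = detf ((m 0 ⬝ᵥ X) * (m 1 ⬝ᵥ X)) ((m 2 ⬝ᵥ X) * (m 3 ⬝ᵥ X))
      ((m 4 ⬝ᵥ X) * (m 5 ⬝ᵥ X))

theorem parallel_iff {a b : Fin 3 → ℂ} (ha : a ≠ 0) (hb : b ≠ 0) : a ⨯₃ b = 0 ↔ Par a b :=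
  ⟨fun h => by
    obtain ⟨μ, h⟩ := parallel_of_cross ha h
    exact par_of_smul hb h, Par.cross⟩

/-- normal form of a determinantal identity -/
theorem detf_form {F : (Fin 3 → ℂ) → ℂ} {κ : ℂ} (hκ : κ ≠ 0) {a g b e c d : Fin 3 → ℂ}
    (h : ∀ X, κ * F X = detf ((a ⬝ᵥ X) * (g ⬝ᵥ X)) ((b ⬝ᵥ X) * (e ⬝ᵥ X)) ((c ⬝ᵥ X) * (d ⬝ᵥ X))) :
    ∃ (w : (Fin 3 → ℂ) → ℂ), IsForm 2 w ∧ ∀ X, F X = w X ^ 2 -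
      ((a ⬝ᵥ X) * (g ⬝ᵥ X)) * ((4 / κ) * ((b ⬝ᵥ X) * (e ⬝ᵥ X))) := by
  obtain ⟨z, hz⟩ := IsAlgClosed.exists_pow_nat_eq κ⁻¹ two_pos
  refine ⟨fun X => z * ((a ⬝ᵥ X) * (g ⬝ᵥ X) + (b ⬝ᵥ X) * (e ⬝ᵥ X) - (c ⬝ᵥ X) * (d ⬝ᵥ X)),
    ((((isForm_dot a).mul (isForm_dot g)).add ((isForm_dot b).mul (isForm_dot e))).sub
      ((isForm_dot c).mul (isForm_dot d))).smul z, fun X => ?_⟩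
  have : F X = κ⁻¹ * (κ * F X) := by rw [inv_mul_cancel_left₀ hκ]
  rw [this, h, mul_pow, hz, detf]
  field_simp
  ring

theorem InW_bit {F} (hS : SmoothF F) {κ : ℂ} (hκ : κ ≠ 0) {a g b e c d : Fin 3 → ℂ} (ha : a ≠ 0)
    (hg : g ≠ 0)
    (h : ∀ X, κ * F X = detf ((a ⬝ᵥ X) * (g ⬝ᵥ X)) ((b ⬝ᵥ X) * (e ⬝ᵥ X)) ((c ⬝ᵥ X) * (d ⬝ᵥ X))) :
    Bit F a ∧ Bit F g ∧ a ⨯₃ g ≠ 0 := by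
  obtain ⟨w, hw, h'⟩ := detf_form hκ h
  refine ⟨⟨ha, w, hw, fun X hX => by rw [h', hX]; ring⟩, ⟨hg, w, hw, fun X hX => by rw [h', hX]; ring⟩, ?_⟩
  exact pencil_cross hS one_ne_zero hw (((isForm_dot b).mul (isForm_dot e)).smul (4 / κ))
    (fun X => by rw [h']; ring)

theorem detf_not_par {F} (hS : SmoothF F) {κ ρ : ℂ} (hκ : κ ≠ 0) {p q : (Fin 3 → ℂ) → ℂ}
    (hp : IsForm 2 p) (hq : IsForm 2 q)
    (h : ∀ X, κ * F X = detf (p X) (q X) (ρ * q X)) : False := by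
  -- p² - 2(1+ρ)pq + (1-ρ)²q² = (p - αq)(p - βq)
  obtain ⟨z, hz⟩ := IsAlgClosed.exists_pow_nat_eq ρ two_pos
  have h1 : IsForm 2 (fun X => p X - (1 + z) ^ 2 * q X) := hp.sub (hq.smul _)
  have h2 : IsForm 2 (fun X => p X - (1 - z) ^ 2 * q X) := hp.sub (hq.smul _)
  obtain ⟨X, hX, e1, e2⟩ := common_zero h1 h2 two_pos two_pos
  exact hX (hS.sing2 κ hκ h1.isPoly h2.isPoly isPoly_zero isPoly_zero
    (fun X => by rw [h, detf, ← hz]; ring) e1 e2 rfl rfl)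

theorem detf_swap (p q r : ℂ) : detf p q r = detf p r q := by unfold detf; ring

abbrev BitPairs (F : (Fin 3 → ℂ) → ℂ) := {x : BitP F × BitP F // x.1 ≠ x.2}
abbrev STPairs := {st : (Fin 5 × Bool) × (Fin 5 × Bool) // st.1.1 ≠ st.2.1}

theorem card_W {F} (hS : SmoothF F) (hF : IsForm 4 F) :
    Nat.card {w // InW F w} = Nat.card (BitPairs F) * 80 := by
  have hcr : ∀ x : BitPairs F, x.1.1.1.rep ⨯₃ x.1.2.1.rep ≠ 0 := by
    intro x h
    rw [parallel_iff (Projectivization.rep_nonzero _) (Projectivization.rep_nonzero _),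
      ← cl_eq (Projectivization.rep_nonzero _) (Projectivization.rep_nonzero _), cl_rep, cl_rep] at h
    exact x.2 (Subtype.ext h)
  have th : ∀ x : BitPairs F, Nonempty (Theta F x.1.1.1.rep x.1.2.1.rep) := fun x =>
    theta_exists hS hF x.1.1.2 x.1.2.2 (hcr x)
  let Θ := fun x => (th x).some
  let f : BitPairs F × STPairs → Fin 6 → Projectivization ℂ (Fin 3 → ℂ) := fun y =>
    ![y.1.1.1.1, y.1.1.2.1, cl _ ((Θ y.1).ne1 y.2.1.1), cl _ ((Θ y.1).ne2 y.2.1.1),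
      cl _ ((Θ y.1).ne1 y.2.1.2), cl _ ((Θ y.1).ne2 y.2.1.2)]
  have hf : ∀ y, InW F (f y) := by
    intro y
    obtain ⟨κ, δ, hκ, hδ, h⟩ := (Θ y.1).pair y.2.1.1 y.2.1.2 y.2.2
    have hd : δ • y.1.1.1.1.rep ≠ 0 := smul_ne_zero hδ (Projectivization.rep_nonzero _)
    refine ⟨![δ • y.1.1.1.1.rep, y.1.1.2.1.rep, ((Θ y.1).θ y.2.1.1).1, ((Θ y.1).θ y.2.1.1).2,
      ((Θ y.1).θ y.2.1.2).1, ((Θ y.1).θ y.2.1.2).2], ?_, ?_, κ, hκ, ?_⟩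
    · intro i
      fin_cases i
      · exact hd
      · exact Projectivization.rep_nonzero _
      · exact (Θ y.1).ne1 _
      · exact (Θ y.1).ne2 _
      · exact (Θ y.1).ne1 _
      · exact (Θ y.1).ne2 _
    · intro i
      fin_cases i
      · have : cl (δ • y.1.1.1.1.rep) hd = y.1.1.1.1 := by
          refine Eq.trans ?_ (cl_rep y.1.1.1.1)
          rw [cl_eq]
          exact Par.symm ⟨δ, hδ, rfl⟩
        exact this
      · exact cl_rep _
      · rfl
      · rfl
      · rfl
      · rfl
    · intro X
      rw [h]
      simp [mul_assoc]
  have hbij : Function.Bijective (fun y => (⟨f y, hf y⟩ : {w // InW F w})) := by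
    constructor
    · rintro ⟨⟨⟨⟨a, ha⟩, ⟨g, hg⟩⟩, hag⟩, ⟨⟨s, t⟩, hst⟩⟩ ⟨⟨⟨⟨a', ha'⟩, ⟨g', hg'⟩⟩, hag'⟩, ⟨⟨s', t'⟩, hst'⟩⟩ hy
      have hy := congrArg Subtype.val hy
      have h0 : a = a' := congrFun hy 0
      have h1 : g = g' := congrFun hy 1
      subst h0 h1
      have h2 := (cl_eq _ _).1 (congrFun hy 2)
      have h3 := (cl_eq _ _).1 (congrFun hy 3)
      have h4 := (cl_eq _ _).1 (congrFun hy 4)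
      have h5 := (cl_eq _ _).1 (congrFun hy 5)
      have e1 := (Θ _).inj _ _ h2 h3
      have e2 := (Θ _).inj _ _ h4 h5
      simp only at e1 e2
      subst e1 e2
      rfl
    · rintro ⟨w, m, hm, hw, κ, hκ, h⟩
      obtain ⟨b1, b2, hx⟩ := InW_bit hS hκ (hm 0) (hm 1) h
      have hne : cl _ (hm 0) ≠ cl _ (hm 1) := by
        rw [ne_eq, cl_eq, ← parallel_iff (hm 0) (hm 1)]
        exact hx
      let x : BitPairs F := ⟨⟨⟨cl _ (hm 0), (cl_mem_BitP _).2 b1⟩, ⟨cl _ (hm 1), (cl_mem_BitP _).2 b2⟩⟩,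
        fun e => hne (congrArg Subtype.val e)⟩
      obtain ⟨μ, hμ, eμ⟩ : Par (cl _ (hm 0)).rep (m 0) := (cl_eq _ _).1 (cl_rep _)
      obtain ⟨ν, hν, eν⟩ : Par (cl _ (hm 1)).rep (m 1) := (cl_eq _ _).1 (cl_rep _)
      have key : ∀ b e c d : Fin 3 → ℂ, b ≠ 0 → e ≠ 0 → (∀ X, κ * F X = detf ((m 0 ⬝ᵥ X) * (m 1 ⬝ᵥ X))
          ((b ⬝ᵥ X) * (e ⬝ᵥ X)) ((c ⬝ᵥ X) * (d ⬝ᵥ X))) →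
          ∃ s, Par ((Θ x).θ s).1 b ∧ Par ((Θ x).θ s).2 e := by
        intro b e c d hb he h
        obtain ⟨w, hw, h'⟩ := detf_form hκ h
        refine (Θ x).complete b e (4 / κ * (μ * ν)) w hb he
          (mul_ne_zero (div_ne_zero (by norm_num) hκ) (mul_ne_zero hμ hν)) hw (fun X => ?_)
        rw [h']
        show _ = w X ^ 2 - (((cl _ (hm 0)).rep ⬝ᵥ X) * ((cl _ (hm 1)).rep ⬝ᵥ X)) * _
        have e1 := congrArg (fun v => v ⬝ᵥ X) eμ
        have e2 := congrArg (fun v => v ⬝ᵥ X) eν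
        simp only [smul_dotProduct, smul_eq_mul] at e1 e2
        rw [e1, e2]
        ring
      obtain ⟨s, hs1, hs2⟩ := key _ _ _ _ (hm 2) (hm 3) h
      obtain ⟨t, ht1, ht2⟩ := key _ _ _ _ (hm 4) (hm 5) (fun X => by rw [h, detf_swap])
      have hst : s.1 ≠ t.1 := by
        intro hst
        obtain ⟨c2, hc2, e2⟩ := hs1
        obtain ⟨c3, hc3, e3⟩ := hs2
        obtain ⟨c4, hc4, e4⟩ := ht1
        obtain ⟨c5, hc5, e5⟩ := ht2
        apply detf_not_par hS hκ (p := fun X => (m 0 ⬝ᵥ X) * (m 1 ⬝ᵥ X))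
          (q := fun X => (m 2 ⬝ᵥ X) * (m 3 ⬝ᵥ X)) (ρ := (c4 * c5) / (c2 * c3))
          ((isForm_dot _).mul (isForm_dot _)) ((isForm_dot _).mul (isForm_dot _))
        intro X
        rw [h]
        congr 1
        have e6 := (Θ x).hγ s X
        have e7 := (Θ x).hγ t X
        rw [← hst, ← e6] at e7
        simp only [e2, e3, e4, e5, smul_dotProduct, smul_eq_mul]
        field_simp
        linear_combination e7
      refine ⟨⟨x, ⟨⟨s, t⟩, hst⟩⟩, Subtype.ext ?_⟩
      funext i
      fin_cases i
      · exact hw 0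
      · exact hw 1
      · exact ((cl_eq _ _).2 hs1).trans (hw 2)
      · exact ((cl_eq _ _).2 hs2).trans (hw 3)
      · exact ((cl_eq _ _).2 ht1).trans (hw 4)
      · exact ((cl_eq _ _).2 ht2).trans (hw 5)
  rw [← Nat.card_congr (Equiv.ofBijective _ hbij), Nat.card_prod]
  congr 1
  rw [Nat.card_eq_fintype_card]
  decide

theorem SmoothF.sing5 {F} (hS : SmoothF F) {g0 h0 g1 h1 g2 h2 g3 h3 g4 h4 : (Fin 3 → ℂ) → ℂ}
    (k : ℂ) (hk : k ≠ 0)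
    (G0 : IsPolyF g0) (H0 : IsPolyF h0) (G1 : IsPolyF g1) (H1 : IsPolyF h1)
    (G2 : IsPolyF g2) (H2 : IsPolyF h2) (G3 : IsPolyF g3) (H3 : IsPolyF h3)
    (G4 : IsPolyF g4) (H4 : IsPolyF h4)
    (hF : ∀ X, k * F X = g0 X * h0 X + g1 X * h1 X + g2 X * h2 X + g3 X * h3 X + g4 X * h4 X)
    {a : Fin 3 → ℂ} (e0 : g0 a = 0) (e1 : g1 a = 0) (e2 : g2 a = 0) (e3 : g3 a = 0) (e4 : g4 a = 0)
    (f0 : h0 a = 0) (f1 : h1 a = 0) (f2 : h2 a = 0) (f3 : h3 a = 0) (f4 : h4 a = 0) : a = 0 := by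
  obtain ⟨p0, G0⟩ := G0
  obtain ⟨q0, H0⟩ := H0
  obtain ⟨p1, G1⟩ := G1
  obtain ⟨q1, H1⟩ := H1
  obtain ⟨p2, G2⟩ := G2
  obtain ⟨q2, H2⟩ := H2
  obtain ⟨p3, G3⟩ := G3
  obtain ⟨q3, H3⟩ := H3
  obtain ⟨p4, G4⟩ := G4
  obtain ⟨q4, H4⟩ := H4
  apply hS (MvPolynomial.C k⁻¹ * (p0 * q0 + p1 * q1 + p2 * q2 + p3 * q3 + p4 * q4))
  · intro X
    simp only [map_mul, map_add, eval_C, ← G0, ← G1, ← G2, ← G3, ← G4, ← H0, ← H1, ← H2, ← H3, ← H4, ← hF]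
    field_simp
  · intro i
    simp [Derivation.leibniz, ← G0, ← G1, ← G2, ← G3, ← G4, ← H0, ← H1, ← H2, ← H3, ← H4,
      e0, e1, e2, e3, e4, f0, f1, f2, f3, f4]

/-- Determinant of a symmetric 4 × 4 matrix. -/
def sdet (a b c d e f g h i j : ℂ) : ℂ :=
  a * (e * (h * j - i ^ 2) - f * (f * j - i * g) + g * (f * i - h * g))
  - b * (b * (h * j - i ^ 2) - 2 * c * (f * j - i * g) + 2 * d * (f * i - h * g))
  - c * (c * (e * j - g ^ 2) - 2 * d * (e * i - f * g)) - d * (d * (e * h - f ^ 2))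

theorem sdet_eq (M : Matrix (Fin 4) (Fin 4) ℂ) (hM : M.IsSymm) : M.det =
    sdet (M 0 0) (M 0 1) (M 0 2) (M 0 3) (M 1 1) (M 1 2) (M 1 3) (M 2 2) (M 2 3) (M 3 3) := by
  have e := fun i j => hM.apply i j
  have hd : M.det = Matrix.det !![M 0 0, M 0 1, M 0 2, M 0 3; M 0 1, M 1 1, M 1 2, M 1 3;
      M 0 2, M 1 2, M 2 2, M 2 3; M 0 3, M 1 3, M 2 3, M 3 3] := by
    congr 1
    ext i j
    fin_cases i <;> fin_cases j <;> simp [e 0 1, e 0 2, e 0 3, e 1 2, e 1 3, e 2 3]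
  rw [hd, Matrix.det_succ_row_zero]
  simp only [Matrix.det_fin_three, Fin.sum_univ_four, sdet]
  simp [Fin.succAbove, Fin.succ]
  ring

theorem sdet_kernel {F} (hS : SmoothF F) {k : ℂ} (hk : k ≠ 0) {a b c d e f g h i j : Fin 3 → ℂ}
    (hF : ∀ X, k * F X = sdet (a ⬝ᵥ X) (b ⬝ᵥ X) (c ⬝ᵥ X) (d ⬝ᵥ X) (e ⬝ᵥ X) (f ⬝ᵥ X) (g ⬝ᵥ X) (h ⬝ᵥ X)
      (i ⬝ᵥ X) (j ⬝ᵥ X)) {X : Fin 3 → ℂ} (hX : X ≠ 0) :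
    -- corank one with a base point
    (a = 0 → b ⬝ᵥ X = 0 → c ⬝ᵥ X = 0 → d ⬝ᵥ X = 0 → False) ∧
    -- corank two
    (a ⬝ᵥ X = 0 → b ⬝ᵥ X = 0 → c ⬝ᵥ X = 0 → d ⬝ᵥ X = 0 → e ⬝ᵥ X = 0 → f ⬝ᵥ X = 0 → g ⬝ᵥ X = 0 → False) ∧
    -- a totally isotropic space of dimension three
    (a ⬝ᵥ X = 0 → b ⬝ᵥ X = 0 → c ⬝ᵥ X = 0 → e ⬝ᵥ X = 0 → f ⬝ᵥ X = 0 → h ⬝ᵥ X = 0 → False) := by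
  have D : ∀ v : Fin 3 → ℂ, IsPolyF (fun X => v ⬝ᵥ X) := fun v => (isForm_dot v).isPoly
  have C2 := isPolyF_const 2
  have m11 := ((D h).mul (D j)).sub ((D i).pow 2)
  have m12 := ((D f).mul (D j)).sub ((D i).mul (D g))
  have m13 := ((D f).mul (D i)).sub ((D h).mul (D g))
  have m22 := ((D e).mul (D j)).sub ((D g).pow 2)
  have m23 := ((D e).mul (D i)).sub ((D f).mul (D g))
  have h0 := (((D e).mul m11).sub ((D f).mul m12)).add ((D g).mul m13)
  have h1 := ((((D b).mul m11).sub ((C2.mul (D c)).mul m12)).add ((C2.mul (D d)).mul m13)).neg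
  have h2 := (((D c).mul m22).sub ((C2.mul (D d)).mul m23)).neg
  have h3 := ((D d).mul (((D e).mul (D h)).sub ((D f).pow 2))).neg
  have h3e := (((D d).pow 2).mul (D h)).neg
  have h3f := ((D d).pow 2).mul (D f)
  refine ⟨?_, ?_, ?_⟩
  · intro ha hb hc hd
    subst ha
    exact hX (hS.sing k hk (D b) h1 (D c) h2 (D d) h3 (fun X => by rw [hF, sdet, zero_dotProduct]; ring)
      hb (by simp [hb, hc, hd]) hc (by simp [hc, hd]) hd (by simp [hd]))
  · intro ha hb hc hd he hf hg
    apply hX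
    exact hS.sing5 k hk (D a) h0 (D b) h1 (D c) h2 (D d) h3 isPoly_zero isPoly_zero
      (fun X => by rw [hF, sdet]; ring) ha hb hc hd rfl (by simp [he, hf, hg]) (by simp [hb, hc, hd])
      (by simp [hc, hd]) (by simp [hd]) rfl
  · intro ha hb hc he hf hh
    apply hX
    exact hS.sing5 k hk (D a) h0 (D b) h1 (D c) h2 (D e) h3e (D f) h3f
      (fun X => by rw [hF, sdet]; ring) ha hb hc he hf (by simp [he, hf, hh]) (by simp [hb, hc, hf, hh])
      (by simp [hc, he, hf]) (by simp [hh]) (by simp [hf])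

/-- The linear form attached to a pair of vectors by a net of quadrics. -/
def bet (N : Fin 3 → Matrix (Fin 4) (Fin 4) ℂ) (u v : Fin 4 → ℂ) : Fin 3 → ℂ :=
  fun i => u ⬝ᵥ (N i *ᵥ v)

def pen (N : Fin 3 → Matrix (Fin 4) (Fin 4) ℂ) (X : Fin 3 → ℂ) : Matrix (Fin 4) (Fin 4) ℂ :=
  ∑ i, X i • N i

structure IsRep (F : (Fin 3 → ℂ) → ℂ) (N : Fin 3 → Matrix (Fin 4) (Fin 4) ℂ) : Prop where
  symm : ∀ i, (N i).IsSymm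
  det : ∃ k : ℂ, k ≠ 0 ∧ ∀ X, k * F X = (pen N X).det

section bet
variable (N : Fin 3 → Matrix (Fin 4) (Fin 4) ℂ)

theorem bet_dot (u v X) : bet N u v ⬝ᵥ X = u ⬝ᵥ (pen N X *ᵥ v) := by
  simp only [bet, pen, dotProduct, Fin.sum_univ_three, mulVec, Fin.sum_univ_four, Matrix.add_apply,
    Matrix.smul_apply, smul_eq_mul]
  ring

theorem bet_add_left (u u' v) : bet N (u + u') v = bet N u v + bet N u' v := by
  funext i; simp [bet]

theorem bet_add_right (u v v') : bet N u (v + v') = bet N u v + bet N u v' := by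
  funext i; simp [bet, mulVec_add]

theorem bet_smul_left (c : ℂ) (u v) : bet N (c • u) v = c • bet N u v := by
  funext i; simp [bet]

theorem bet_smul_right (c : ℂ) (u v) : bet N u (c • v) = c • bet N u v := by
  funext i; simp [bet, mulVec_smul]

theorem bet_zero_left (v) : bet N 0 v = 0 := by
  funext i; simp [bet]

theorem bet_zero_right (v) : bet N v 0 = 0 := by
  funext i; simp [bet]

variable {N}
theorem bet_comm (hN : ∀ i, (N i).IsSymm) (u v) : bet N u v = bet N v u := by
  funext i
  simp only [bet]
  rw [dotProduct_mulVec, ← mulVec_transpose, hN i, dotProduct_comm]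

theorem pen_symm (hN : ∀ i, (N i).IsSymm) (X) : (pen N X).IsSymm := by
  ext i j
  simp [pen, Fin.sum_univ_three, fun k => (hN k).apply i j]
end bet

theorem IsRep.gram {F N} (h : IsRep F N) {u v w z : Fin 4 → ℂ} (hv : LinearIndependent ℂ ![u, v, w, z]) :
    ∃ k : ℂ, k ≠ 0 ∧ ∀ X, k * F X = sdet (bet N u u ⬝ᵥ X) (bet N u v ⬝ᵥ X) (bet N u w ⬝ᵥ X) (bet N u z ⬝ᵥ X)
      (bet N v v ⬝ᵥ X) (bet N v w ⬝ᵥ X) (bet N v z ⬝ᵥ X) (bet N w w ⬝ᵥ X) (bet N w z ⬝ᵥ X)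
      (bet N z z ⬝ᵥ X) := by
  obtain ⟨k, hk, h2⟩ := h.det
  set T : Matrix (Fin 4) (Fin 4) ℂ := Matrix.of ![u, v, w, z] with hT
  have hu : IsUnit T := Matrix.linearIndependent_rows_iff_isUnit.1 hv
  have hd : T.det ≠ 0 := ((Matrix.isUnit_iff_isUnit_det _).1 hu).ne_zero
  refine ⟨T.det ^ 2 * k, mul_ne_zero (pow_ne_zero _ hd) hk, fun X => ?_⟩
  have e : ∀ i j, (T * pen N X * Tᵀ) i j = bet N (T i) (T j) ⬝ᵥ X := by
    intro i j
    rw [bet_dot, Matrix.mul_assoc, Matrix.mul_apply]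
    rfl
  have hs : (T * pen N X * Tᵀ).IsSymm := by
    ext i j
    rw [Matrix.transpose_apply, e, e, bet_comm h.symm]
  have := sdet_eq _ hs
  simp only [e] at this
  rw [Matrix.det_mul, Matrix.det_mul, Matrix.det_transpose, ← h2] at this
  calc _ = T.det * (k * F X) * T.det := by ring
    _ = _ := this

theorem ext3 {u v w : Fin 4 → ℂ} (h : LinearIndependent ℂ ![u, v, w]) :
    ∃ z, LinearIndependent ℂ ![u, v, w, z] := by
  obtain ⟨z, hz⟩ := exists_linearIndependent_snoc_of_lt_finrank h (by simp)
  refine ⟨z, ?_⟩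
  have e : (![u, v, w, z] : Fin 4 → Fin 4 → ℂ) = Fin.snoc ![u, v, w] z := by
    ext i; fin_cases i <;> rfl
  rw [e]; exact hz

theorem ext2 {u v : Fin 4 → ℂ} (h : LinearIndependent ℂ ![u, v]) :
    ∃ w z, LinearIndependent ℂ ![u, v, w, z] := by
  obtain ⟨w, hw⟩ := exists_linearIndependent_snoc_of_lt_finrank h (by simp)
  refine ⟨w, ext3 ?_⟩
  have e : (![u, v, w] : Fin 3 → Fin 4 → ℂ) = Fin.snoc ![u, v] w := by
    ext i; fin_cases i <;> rfl
  rw [e]; exact hw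

theorem ext1 {u : Fin 4 → ℂ} (h : u ≠ 0) :
    ∃ v, LinearIndependent ℂ ![u, v] := by
  have h : LinearIndependent ℂ ![u] := by
    rw [Fintype.linearIndependent_iff]
    intro g hg i
    simpa [h, Fin.fin_one_eq_zero] using hg
  obtain ⟨w, hw⟩ := exists_linearIndependent_snoc_of_lt_finrank h (by simp)
  refine ⟨w, ?_⟩
  have e : (![u, w] : Fin 2 → Fin 4 → ℂ) = Fin.snoc ![u] w := by
    ext i; fin_cases i <;> rfl
  rw [e]; exact hw

theorem li_pair {u v : Fin 4 → ℂ} (hu : u ≠ 0) (hv : v ≠ 0) (h : ¬ Par u v) : LinearIndependent ℂ ![u, v] := by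
  rw [LinearIndependent.pair_iff' hu]
  intro a ha
  exact h (par_of_smul hv ha.symm)

theorem li_not_par {u v : Fin 4 → ℂ} (h : LinearIndependent ℂ ![u, v]) : ¬ Par u v := by
  rintro ⟨μ, hμ, e⟩
  rw [LinearIndependent.pair_iff] at h
  have := (h μ (-1) (by simp [e])).2
  simp at this

section L
variable {F : (Fin 3 → ℂ) → ℂ} {N : Fin 3 → Matrix (Fin 4) (Fin 4) ℂ}

theorem IsRep.L1 (hS : SmoothF F) (h : IsRep F N) {u v w z : Fin 4 → ℂ} (hv : LinearIndependent ℂ ![u, v, w, z]) (h0 : bet N u u = 0)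
    {X} (hX : X ≠ 0) (h1 : bet N u v ⬝ᵥ X = 0) (h2 : bet N u w ⬝ᵥ X = 0) (h3 : bet N u z ⬝ᵥ X = 0) : False := by
  obtain ⟨k, hk, e⟩ := h.gram hv
  exact (sdet_kernel hS hk e hX).1 h0 h1 h2 h3

theorem IsRep.L1b (hS : SmoothF F) (h : IsRep F N) {u v w : Fin 4 → ℂ} (hv : LinearIndependent ℂ ![u, v, w])
    {X} (hX : X ≠ 0) (h0 : bet N u u ⬝ᵥ X = 0) (h1 : bet N u v ⬝ᵥ X = 0) (h2 : bet N u w ⬝ᵥ X = 0)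
    (h3 : bet N v v ⬝ᵥ X = 0) (h4 : bet N v w ⬝ᵥ X = 0) (h5 : bet N w w ⬝ᵥ X = 0) : False := by
  obtain ⟨z, hz⟩ := ext3 hv
  obtain ⟨k, hk, e⟩ := h.gram hz
  exact (sdet_kernel hS hk e hX).2.2 h0 h1 h2 h3 h4 h5

theorem IsRep.L1c (hS : SmoothF F) (h : IsRep F N) {u v : Fin 4 → ℂ} (hv : LinearIndependent ℂ ![u, v])
    {X} (hX : X ≠ 0) (h0 : pen N X *ᵥ u = 0) (h1 : pen N X *ᵥ v = 0) : False := by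
  obtain ⟨w, z, hz⟩ := ext2 hv
  obtain ⟨k, hk, e⟩ := h.gram hz
  have a : ∀ t, bet N u t ⬝ᵥ X = 0 := fun t => by rw [bet_comm h.symm, bet_dot, h0, dotProduct_zero]
  have b : ∀ t, bet N v t ⬝ᵥ X = 0 := fun t => by rw [bet_comm h.symm, bet_dot, h1, dotProduct_zero]
  exact (sdet_kernel hS hk e hX).2.1 (a _) (a _) (a _) (a _) (b _) (b _) (b _)

theorem IsRep.L2 (hS : SmoothF F) (h : IsRep F N) {u v : Fin 4 → ℂ} (hv : LinearIndependent ℂ ![u, v])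
    (h0 : bet N u u = 0) (h1 : bet N u v = 0) (h2 : bet N v v = 0) : False := by
  obtain ⟨w, z, hz⟩ := ext2 hv
  obtain ⟨k, hk, e⟩ := h.gram hz
  have hG : IsForm 2 (fun X => (bet N u w ⬝ᵥ X) * (bet N v z ⬝ᵥ X) - (bet N u z ⬝ᵥ X) * (bet N v w ⬝ᵥ X)) :=
    ((isForm_dot _).mul (isForm_dot _)).sub ((isForm_dot _).mul (isForm_dot _))
  obtain ⟨X, hX, hX1, -⟩ := common_zero hG hG (by norm_num) (by norm_num)
  exact hX (hS.sing k hk hG.isPoly hG.isPoly isPoly_zero isPoly_zero isPoly_zero isPoly_zero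
    (fun X => by rw [e, h0, h1, h2]; simp [sdet]; ring) hX1 hX1 rfl rfl rfl rfl)

theorem IsRep.L6 (hS : SmoothF F) (h : IsRep F N) {u v : Fin 4 → ℂ} (hv : LinearIndependent ℂ ![u, v])
    (h0 : bet N u u = 0) (h2 : bet N v v = 0) : Bit F (bet N u v) := by
  refine ⟨fun h1 => h.L2 hS hv h0 h1 h2, ?_⟩
  obtain ⟨w, z, hz⟩ := ext2 hv
  obtain ⟨k, hk, e⟩ := h.gram hz
  have hG : IsForm 2 (fun X => (bet N u w ⬝ᵥ X) * (bet N v z ⬝ᵥ X) - (bet N u z ⬝ᵥ X) * (bet N v w ⬝ᵥ X)) :=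
    ((isForm_dot _).mul (isForm_dot _)).sub ((isForm_dot _).mul (isForm_dot _))
  obtain ⟨s, hs⟩ := IsAlgClosed.exists_pow_nat_eq k⁻¹ (n := 2) (by norm_num)
  refine ⟨_, hG.smul s, fun X hX => ?_⟩
  have e := e X
  rw [hX, h0, h2] at e
  simp only [sdet, zero_dotProduct] at e
  have : F X = k⁻¹ * (k * F X) := by field_simp
  rw [this, e, ← hs]
  ring
end L

theorem exists_orth (a b : Fin 3 → ℂ) : ∃ X : Fin 3 → ℂ, X ≠ 0 ∧ a ⬝ᵥ X = 0 ∧ b ⬝ᵥ X = 0 :=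
  common_zero (isForm_dot a) (isForm_dot b) (by norm_num) (by norm_num)

theorem par_dot {a b X : Fin 3 → ℂ} (h : Par a b) (ha : a ⬝ᵥ X = 0) : b ⬝ᵥ X = 0 := by
  obtain ⟨μ, -, rfl⟩ := h
  rw [smul_dotProduct, ha, smul_zero]

/-- Two base points that are not proportional. -/
structure BP2 (N : Fin 3 → Matrix (Fin 4) (Fin 4) ℂ) (u v : Fin 4 → ℂ) : Prop where
  li : LinearIndependent ℂ ![u, v]
  b1 : bet N u u = 0
  b2 : bet N v v = 0

theorem BP2.symm {N u v} (h : BP2 N u v) : BP2 N v u :=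
  ⟨LinearIndependent.pair_symm_iff.1 h.li, h.b2, h.b1⟩

theorem BP2.ne1 {N u v} (h : BP2 N u v) : u ≠ 0 := by simpa using h.li.ne_zero 0
theorem BP2.ne2 {N u v} (h : BP2 N u v) : v ≠ 0 := by simpa using h.li.ne_zero 1

theorem detf_gram (b c d f g i : ℂ) : sdet 0 b c d 0 f g 0 i 0 = detf (b * i) (c * g) (d * f) := by
  simp only [sdet, detf]; ring

section R
variable {F : (Fin 3 → ℂ) → ℂ} {N : Fin 3 → Matrix (Fin 4) (Fin 4) ℂ}

theorem IsRep.bne (hS : SmoothF F) (h : IsRep F N) {u v} (huv : BP2 N u v) : bet N u v ≠ 0 := (h.L6 hS huv.li huv.b1 huv.b2).1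

theorem IsRep.R3aux (hS : SmoothF F) (h : IsRep F N) {u v w : Fin 4 → ℂ} (huv : BP2 N u v) (huw : BP2 N u w) {x y z : ℂ}
    (e : x • u + y • v + z • w = 0) : x * y = 0 := by
  have e' : x • u + y • v = (-z) • w := by rw [neg_smul, ← eq_neg_iff_add_eq_zero.2 e]
  have := congrArg₂ (bet N) e' e'
  simp only [bet_add_left, bet_add_right, bet_smul_left, bet_smul_right, huv.b1, huv.b2, huw.b2, smul_zero,
    bet_comm h.symm v u, zero_add, add_zero, ← add_smul, smul_smul] at this
  have := (smul_eq_zero.1 this).resolve_right (h.bne hS huv)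
  linear_combination this / 2

theorem IsRep.R3 (hS : SmoothF F) (h : IsRep F N) {u v w : Fin 4 → ℂ} (huv : BP2 N u v) (huw : BP2 N u w) (hvw : BP2 N v w) :
    LinearIndependent ℂ ![u, v, w] := by
  rw [Fintype.linearIndependent_iff]
  intro g hg
  simp [Fin.sum_univ_three] at hg
  have h1 := h.R3aux hS huv huw hg
  have h2 := h.R3aux hS (x := g 0) (y := g 2) (z := g 1) huw huv (by rw [← hg]; abel)
  have h3 := h.R3aux hS (x := g 1) (y := g 2) (z := g 0) hvw huv.symm (by rw [← hg]; abel)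
  have n1 := huv.ne1
  have n2 := huv.ne2
  have n3 := huw.ne2
  intro i
  by_cases g0 : g 0 = 0
  · by_cases g1 : g 1 = 0
    · simp [g0, g1, n3] at hg
      fin_cases i <;> assumption
    · have g2 : g 2 = 0 := (mul_eq_zero.1 h3).resolve_left g1
      simp [g0, g1, g2, n2] at hg
  · have g1 : g 1 = 0 := (mul_eq_zero.1 h1).resolve_left g0
    have g2 : g 2 = 0 := (mul_eq_zero.1 h2).resolve_left g0
    simp [g0, g1, g2, n1] at hg

theorem IsRep.R4aux (hS : SmoothF F) (h : IsRep F N) {u v w s : Fin 4 → ℂ} (huv : BP2 N u v) (huw : BP2 N u w) (hvw : BP2 N v w) (hs : bet N s s = 0)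
    {x y z t : ℂ}
    (e : x • u + y • v + z • w + t • s = 0) : y * z = 0 := by
  by_contra hyz
  have e' : x • u + y • v + z • w = (-t) • s := by rw [neg_smul, ← eq_neg_iff_add_eq_zero.2 e]
  have := congrArg₂ (bet N) e' e'
  simp only [bet_add_left, bet_add_right, bet_smul_left, bet_smul_right, huv.b1, huv.b2, huw.b2, hs, smul_zero,
    bet_comm h.symm v u, bet_comm h.symm w u, bet_comm h.symm w v, zero_add, add_zero] at this
  obtain ⟨X, hX, h1, h2⟩ := exists_orth (bet N u v) (bet N u w)
  have h3 := congrArg (· ⬝ᵥ X) this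
  simp only [add_dotProduct, smul_dotProduct, h1, h2, zero_dotProduct, smul_zero, zero_add, add_zero, smul_eq_mul] at h3
  have h4 : bet N v w ⬝ᵥ X = 0 := by
    have : (y * z) * (bet N v w ⬝ᵥ X) = 0 := by linear_combination h3 / 2
    exact (mul_eq_zero.1 this).resolve_left hyz
  exact h.L1b hS (h.R3 hS huv huw hvw) hX (by rw [huv.b1, zero_dotProduct]) h1 h2 (by rw [huv.b2, zero_dotProduct])
    h4 (by rw [huw.b2, zero_dotProduct])

theorem IsRep.R4 (hS : SmoothF F) (h : IsRep F N) {u v w s : Fin 4 → ℂ} (huv : BP2 N u v) (huw : BP2 N u w) (hus : BP2 N u s) (hvw : BP2 N v w)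
    (hvs : BP2 N v s) (hws : BP2 N w s) : LinearIndependent ℂ ![u, v, w, s] := by
  rw [Fintype.linearIndependent_iff]
  intro g hg
  simp [Fin.sum_univ_four] at hg
  have p12 := h.R4aux hS (x := g 0) (y := g 1) (z := g 2) (t := g 3) huv huw hvw hws.b2 (by rw [← hg])
  have p13 := h.R4aux hS (x := g 0) (y := g 1) (z := g 3) (t := g 2) huv hus hvs hws.b1 (by rw [← hg]; abel)
  have p23 := h.R4aux hS (x := g 0) (y := g 2) (z := g 3) (t := g 1) huw hus hws hvw.b1 (by rw [← hg]; abel)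
  have p02 := h.R4aux hS (x := g 1) (y := g 0) (z := g 2) (t := g 3) huv.symm hvw huw hws.b2 (by rw [← hg]; abel)
  have p01 := h.R4aux hS (x := g 2) (y := g 0) (z := g 1) (t := g 3) huw.symm hvw.symm huv hws.b2 (by rw [← hg]; abel)
  have p03 := h.R4aux hS (x := g 1) (y := g 0) (z := g 3) (t := g 2) huv.symm hvs hus hws.b1 (by rw [← hg]; abel)
  have n1 := huv.ne1
  have n2 := huv.ne2
  have n3 := huw.ne2
  have n4 := hus.ne2
  intro i
  by_cases g0 : g 0 = 0
  · by_cases g1 : g 1 = 0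
    · by_cases g2 : g 2 = 0
      · simp [g0, g1, g2, n4] at hg
        fin_cases i <;> assumption
      · have g3 : g 3 = 0 := (mul_eq_zero.1 p23).resolve_left g2
        simp [g0, g1, g2, g3, n3] at hg
    · have g2 : g 2 = 0 := (mul_eq_zero.1 p12).resolve_left g1
      have g3 : g 3 = 0 := (mul_eq_zero.1 p13).resolve_left g1
      simp [g0, g1, g2, g3, n2] at hg
  · have g1 : g 1 = 0 := (mul_eq_zero.1 p01).resolve_left g0
    have g2 : g 2 = 0 := (mul_eq_zero.1 p02).resolve_left g0
    have g3 : g 3 = 0 := (mul_eq_zero.1 p03).resolve_left g0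
    simp [g0, g1, g2, g3, n1] at hg

theorem IsRep.L7a (hS : SmoothF F) (h : IsRep F N) {u v w : Fin 4 → ℂ} (huv : BP2 N u v) (huw : BP2 N u w) (hvw : BP2 N v w) :
    ¬ Par (bet N u v) (bet N u w) := by
  intro hp
  obtain ⟨z, hz⟩ := ext3 (h.R3 hS huv huw hvw)
  obtain ⟨X, hX, h1, h2⟩ := exists_orth (bet N u v) (bet N u z)
  exact h.L1 hS hz huv.b1 hX h1 (par_dot hp h1) h2

theorem IsRep.gram0 (h : IsRep F N) {u v w s : Fin 4 → ℂ} (hl : LinearIndependent ℂ ![u, v, w, s])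
    (hu : bet N u u = 0) (hv : bet N v v = 0) (hw : bet N w w = 0) (hs : bet N s s = 0) :
    ∃ k : ℂ, k ≠ 0 ∧ ∀ X, k * F X = detf ((bet N u v ⬝ᵥ X) * (bet N w s ⬝ᵥ X))
      ((bet N u w ⬝ᵥ X) * (bet N v s ⬝ᵥ X)) ((bet N u s ⬝ᵥ X) * (bet N v w ⬝ᵥ X)) := by
  obtain ⟨k, hk, e⟩ := h.gram hl
  refine ⟨k, hk, fun X => ?_⟩
  rw [e, hu, hv, hw, hs, zero_dotProduct, detf_gram]

theorem IsRep.L7b (hS : SmoothF F) (h : IsRep F N) {u v w s : Fin 4 → ℂ} (huv : BP2 N u v) (huw : BP2 N u w) (hus : BP2 N u s) (hvw : BP2 N v w)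
    (hvs : BP2 N v s) (hws : BP2 N w s) : ¬ Par (bet N u v) (bet N w s) := by
  intro hp
  obtain ⟨k, hk, e⟩ := h.gram0 (h.R4 hS huv huw hus hvw hvs hws) huv.b1 huv.b2 hws.b1 hws.b2
  have := (InW_bit hS hk (h.bne hS huv) (h.bne hS hws) e).2.2
  exact this ((parallel_iff (h.bne hS huv) (h.bne hS hws)).2 hp)

end R

theorem finrank_ker_comp_le {V : Type*} [AddCommGroup V] [Module ℂ V] [FiniteDimensional ℂ V]
    (f g : V →ₗ[ℂ] V) : Module.finrank ℂ (LinearMap.ker (g ∘ₗ f)) ≤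
      Module.finrank ℂ (LinearMap.ker f) + Module.finrank ℂ (LinearMap.ker g) := by
  have e := LinearMap.finrank_range_add_finrank_ker (f.domRestrict (LinearMap.ker (g ∘ₗ f)))
  have h1 : Module.finrank ℂ (LinearMap.range (f.domRestrict (LinearMap.ker (g ∘ₗ f)))) ≤
      Module.finrank ℂ (LinearMap.ker g) := by
    apply Submodule.finrank_mono
    rintro _ ⟨⟨x, hx⟩, rfl⟩
    simpa using hx
  have h2 : Module.finrank ℂ (LinearMap.ker (f.domRestrict (LinearMap.ker (g ∘ₗ f)))) ≤
      Module.finrank ℂ (LinearMap.ker f) := by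
    let φ : LinearMap.ker (f.domRestrict (LinearMap.ker (g ∘ₗ f))) →ₗ[ℂ] LinearMap.ker f :=
      LinearMap.codRestrict _ ((Submodule.subtype _) ∘ₗ (Submodule.subtype _)) (fun x => by
        exact LinearMap.mem_ker.1 x.2)
    apply LinearMap.finrank_le_finrank_of_injective (f := φ)
    intro x y hxy
    have := congrArg Subtype.val hxy
    exact Subtype.ext (Subtype.ext this)
  omega

theorem plane_basis {l Y : Fin 3 → ℂ} (hl : l ≠ 0) (hY : Y ≠ 0) (h : l ⬝ᵥ Y = 0) :
    ∃ Z, l ⬝ᵥ Z = 0 ∧ Y ⨯₃ Z = l := by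
  obtain ⟨d, hd⟩ := exists_dot_one hY
  refine ⟨l ⨯₃ d, dot_self_cross _ _, ?_⟩
  rw [dot3] at h hd
  funext i
  fin_cases i <;> simp [cross_apply]
  · linear_combination l 0 * hd - d 0 * h
  · linear_combination l 1 * hd - d 1 * h
  · linear_combination l 2 * hd - d 2 * h

theorem pen_add (N X Y) : pen N (X + Y) = pen N X + pen N Y := by
  simp [pen, add_smul, Finset.sum_add_distrib]

theorem pen_smul (N) (c : ℂ) (X) : pen N (c • X) = c • pen N X := by
  simp [pen, smul_smul, Finset.smul_sum]

theorem quad_two_pts {q} (hq : IsForm 2 q) (Y Z : Fin 3 → ℂ) : ∃ b c : ℂ, ∀ t : ℂ, q (t • Y + Z) = q Y * t ^ 2 + b * t + c := by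
  obtain ⟨S, hS, e⟩ := hq.quad
  refine ⟨Y ⬝ᵥ (S *ᵥ Z) + Z ⬝ᵥ (S *ᵥ Y), Z ⬝ᵥ (S *ᵥ Z), fun t => ?_⟩
  rw [e, e]
  simp only [mulVec_add, mulVec_smul, add_dotProduct, dotProduct_add, smul_dotProduct, dotProduct_smul, smul_eq_mul]
  ring

theorem quad_roots {a : ℂ} (ha : a ≠ 0) (b c : ℂ) : ∃ r s : ℂ, ∀ t : ℂ, a * t ^ 2 + b * t + c = a * ((t - r) * (t - s)) := by
  obtain ⟨d, hd⟩ := IsAlgClosed.exists_pow_nat_eq (b ^ 2 - 4 * a * c) (n := 2) (by norm_num)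
  refine ⟨(-b + d) / (2 * a), (-b - d) / (2 * a), fun t => ?_⟩
  field_simp
  linear_combination hd

section
variable {F : (Fin 3 → ℂ) → ℂ} {N : Fin 3 → Matrix (Fin 4) (Fin 4) ℂ}

theorem IsRep.ker_le (hS : SmoothF F) (h : IsRep F N) {X} (hX : X ≠ 0) : Module.finrank ℂ (LinearMap.ker (pen N X).mulVecLin) ≤ 1 := by
  by_contra! hc
  obtain ⟨f, hf⟩ := exists_linearIndependent_of_le_finrank (R := ℂ) (n := 2) hc
  have := hf.map' _ (Submodule.ker_subtype _)
  have e : (![(f 0 : Fin 4 → ℂ), f 1]) = (Submodule.subtype _) ∘ f := by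
    funext i; fin_cases i <;> rfl
  rw [← e] at this
  exact h.L1c hS this hX (LinearMap.mem_ker.1 (f 0).2) (LinearMap.mem_ker.1 (f 1).2)

theorem IsRep.iso_pair (hS : SmoothF F) (h : IsRep F N) (hF : IsForm 4 F) {l} (hl : Bit F l) : ∃ u v : Fin 4 → ℂ, LinearIndependent ℂ ![u, v] ∧
    (∃ c : ℂ, bet N u u = c • l) ∧ (∃ c : ℂ, bet N u v = c • l) ∧ (∃ c : ℂ, bet N v v = c • l) := by
  obtain ⟨hl0, q, hq, hFq⟩ := hl
  obtain ⟨Y, hY, hFY⟩ := hS.ne_zero_on hF hl0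
  have hY0 : Y ≠ 0 := by rintro rfl; exact hFY (hF.zero_of_pos (by norm_num))
  obtain ⟨Z, hZ, hYZ⟩ := plane_basis hl0 hY0 hY
  have hqY : q Y ≠ 0 := by intro e; apply hFY; rw [hFq Y hY, e]; ring
  obtain ⟨k, hk, hdet⟩ := h.det
  obtain ⟨b, c, hbc⟩ := quad_two_pts hq Y Z
  obtain ⟨r, s, hrs⟩ := quad_roots hqY b c
  set A := pen N Y with hA
  set B := pen N Z with hB
  have hAs : Aᵀ = A := pen_symm h.symm Y
  have hBs : Bᵀ = B := pen_symm h.symm Z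
  have hAd : A.det ≠ 0 := by rw [hA, ← hdet]; exact mul_ne_zero hk hFY
  have hAu : IsUnit A.det := isUnit_iff_ne_zero.2 hAd
  obtain ⟨M, hM⟩ : ∃ M, M = -(A⁻¹ * B) := ⟨_, rfl⟩
  have hAM : A * M = -B := by rw [hM, mul_neg, Matrix.mul_nonsing_inv_cancel_left _ _ hAu]
  have hpt : ∀ t : ℂ, pen N (t • Y + Z) = A * (t • 1 - M) := by
    intro t
    rw [pen_add, pen_smul, mul_sub, hAM, sub_neg_eq_add, mul_smul_comm, mul_one]
  have hch : M.charpoly = ((Polynomial.X - Polynomial.C r) * (Polynomial.X - Polynomial.C s)) ^ 2 := by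
    apply Polynomial.funext
    intro t
    have h1 := hdet (t • Y + Z)
    rw [hpt, Matrix.det_mul, hFq _ (by simp [hY, hZ]), hbc, hrs] at h1
    have h2 := hdet Y
    rw [hFq _ hY, ← hA] at h2
    rw [Matrix.eval_charpoly, Matrix.scalar_apply, ← Matrix.smul_one_eq_diagonal]
    apply mul_left_cancel₀ hAd
    rw [← h1, ← h2]
    simp
    ring
  obtain ⟨K1, hK1⟩ : ∃ K, K = M - r • (1 : Matrix (Fin 4) (Fin 4) ℂ) := ⟨_, rfl⟩
  obtain ⟨K2, hK2⟩ : ∃ K, K = M - s • (1 : Matrix (Fin 4) (Fin 4) ℂ) := ⟨_, rfl⟩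
  have hK : (K1 * K2) * (K1 * K2) = 0 := by
    have := Matrix.aeval_self_charpoly M
    rw [hch] at this
    simpa [pow_two, Algebra.algebraMap_eq_smul_one, ← hK1, ← hK2] using this
  have hMt : Mᵀ * A = A * M := by
    have := congrArg Matrix.transpose hAM
    rw [Matrix.transpose_mul, hAs, Matrix.transpose_neg, hBs] at this
    rw [this, hAM]
  have hK1t : K1ᵀ * A = A * K1 := by
    simp [hK1, sub_mul, mul_sub, hMt]
  have hK2t : K2ᵀ * A = A * K2 := by
    simp [hK2, sub_mul, mul_sub, hMt]
  have hcomm : K1 * K2 = K2 * K1 := by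
    simp only [hK1, hK2, sub_mul, mul_sub, smul_mul_assoc, mul_smul_comm, one_mul, mul_one, smul_smul, smul_sub]
    rw [mul_comm r s]; abel
  have hMc : M * (K1 * K2) = (K1 * K2) * M := by
    have a1 : M * K1 = K1 * M := by simp [hK1, sub_mul, mul_sub]
    have a2 : M * K2 = K2 * M := by simp [hK2, sub_mul, mul_sub]
    rw [← mul_assoc, a1, mul_assoc, a2, mul_assoc]
  have hKt : (K1 * K2)ᵀ * A = A * (K1 * K2) := by
    rw [Matrix.transpose_mul, mul_assoc, hK1t, ← mul_assoc, hK2t, mul_assoc, ← hcomm]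
  have isoA : (K1 * K2)ᵀ * A * (K1 * K2) = 0 := by
    rw [hKt, mul_assoc, hK, mul_zero]
  have isoB : (K1 * K2)ᵀ * B * (K1 * K2) = 0 := by
    have : B = - (A * M) := by rw [hAM, neg_neg]
    rw [this, mul_neg, neg_mul, ← mul_assoc (K1 * K2)ᵀ, hKt, mul_assoc, hMc, mul_assoc A,
      ← mul_assoc (K1 * K2) (K1 * K2), hK]
    simp
  have hkr : ∀ t : ℂ, Module.finrank ℂ (LinearMap.ker (M - t • (1 : Matrix (Fin 4) (Fin 4) ℂ)).mulVecLin) ≤ 1 := by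
    intro t
    have hne : t • Y + Z ≠ 0 := by
      intro e
      apply hl0
      rw [← hYZ, ← neg_eq_iff_add_eq_zero.2 e]
      simp
    refine le_trans (Submodule.finrank_mono ?_) (h.ker_le hS hne)
    intro x hx
    rw [LinearMap.mem_ker, Matrix.mulVecLin_apply] at hx ⊢
    rw [hpt, ← neg_sub, mul_neg, neg_mulVec, ← mulVec_mulVec, hx, mulVec_zero, neg_zero]
  have hrange : 2 ≤ Module.finrank ℂ (LinearMap.range (K1 * K2).mulVecLin) := by
    have e1 := LinearMap.finrank_range_add_finrank_ker (K1 * K2).mulVecLin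
    have e2 := finrank_ker_comp_le K2.mulVecLin K1.mulVecLin
    rw [← Matrix.mulVecLin_mul] at e2
    have h1 := hkr r
    have h2 := hkr s
    rw [← hK1] at h1
    rw [← hK2] at h2
    simp only [Module.finrank_fin_fun] at e1
    omega
  obtain ⟨f, hf⟩ := exists_linearIndependent_of_le_finrank (R := ℂ) (n := 2) hrange
  have hf' := hf.map' _ (Submodule.ker_subtype _)
  have e : (![(f 0 : Fin 4 → ℂ), f 1]) = (Submodule.subtype _) ∘ f := by
    funext i; fin_cases i <;> rfl
  rw [← e] at hf'
  have key : ∀ i j : Fin 2, ∃ c : ℂ, bet N (f i) (f j) = c • l := by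
    intro i j
    obtain ⟨x, hx⟩ := (f i).2
    obtain ⟨y, hy⟩ := (f j).2
    rw [Matrix.mulVecLin_apply] at hx hy
    apply plane_vanish hl0
    have iso : ∀ C : Matrix (Fin 4) (Fin 4) ℂ, (K1 * K2)ᵀ * C * (K1 * K2) = 0 →
        ((f i : Fin 4 → ℂ)) ⬝ᵥ (C *ᵥ (f j : Fin 4 → ℂ)) = 0 := by
      intro C hC
      rw [← hx, ← hy, Matrix.mulVec_mulVec, ← Matrix.vecMul_transpose, ← Matrix.dotProduct_mulVec,
        Matrix.mulVec_mulVec, ← mul_assoc, hC]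
      simp
    intro X hX
    obtain ⟨s, t, rfl⟩ := plane_comb (v := Y) (y := Z) (by rwa [hYZ]) (by rwa [hYZ])
    rw [bet_dot, pen_add, pen_smul, pen_smul, add_mulVec, smul_mulVec, smul_mulVec,
      dotProduct_add, dotProduct_smul, dotProduct_smul, iso _ isoA, iso _ isoB]
    simp
  exact ⟨f 0, f 1, hf', key 0 0, key 0 1, key 1 1⟩

theorem IsRep.L5 (hS : SmoothF F) (h : IsRep F N) (hF : IsForm 4 F) {l} (hl : Bit F l) : ∃ u v : Fin 4 → ℂ, BP2 N u v ∧ Par (bet N u v) l := by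
  obtain ⟨u, v, huv, ⟨c0, h0⟩, ⟨c1, h1⟩, ⟨c2, h2⟩⟩ := h.iso_pair hS hF hl
  obtain ⟨u, v, huv, h0, ⟨c, h1⟩, ⟨d, h2⟩⟩ : ∃ u v : Fin 4 → ℂ, LinearIndependent ℂ ![u, v] ∧ bet N u u = 0 ∧
    (∃ c : ℂ, bet N u v = c • l) ∧ (∃ c : ℂ, bet N v v = c • l) := by
    by_cases hc : c0 = 0
    · exact ⟨u, v, huv, by rw [h0, hc, zero_smul], ⟨_, h1⟩, ⟨_, h2⟩⟩
    · obtain ⟨r, s, hrs⟩ := quad_roots hc (2 * c1) c2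
      refine ⟨r • u + v, u, ?_, ?_, ⟨r * c0 + c1, ?_⟩, ⟨_, h0⟩⟩
      · rw [LinearIndependent.pair_iff] at huv ⊢
        intro x y e
        have := huv (x * r + y) x (by rw [← e]; module)
        obtain ⟨e1, rfl⟩ := this
        simpa using e1
      · have := hrs r
        simp only [bet_add_left, bet_add_right, bet_smul_left, bet_smul_right, h0, h1, h2, bet_comm h.symm v u,
          smul_smul, ← add_smul]
        rw [show r * (r * c0 + c1) + (r * c1 + c2) = 0 by linear_combination this, zero_smul]
      · simp only [bet_add_left, bet_smul_left, h0, h1, bet_comm h.symm v u, smul_smul, ← add_smul]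
  have hc : c ≠ 0 := by
    rintro rfl
    obtain ⟨w, z, hz⟩ := ext2 huv
    obtain ⟨X, hX, e1, e2⟩ := exists_orth (bet N u w) (bet N u z)
    exact h.L1 hS hz h0 hX (by rw [h1]; simp) e1 e2
  have hv : bet N u (v + (-(d / (2 * c))) • u) = c • l := by
    rw [bet_add_right, bet_smul_right, h0, smul_zero, add_zero, h1]
  refine ⟨u, v + (-(d / (2 * c))) • u, ⟨?_, h0, ?_⟩, ?_⟩
  · rw [LinearIndependent.pair_iff] at huv ⊢
    intro x y e
    obtain ⟨e1, rfl⟩ := huv (x + y * (-(d / (2 * c)))) y (by rw [← e]; module)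
    simpa using e1
  · simp only [bet_add_left, bet_add_right, bet_smul_left, bet_smul_right, h0, h1, h2, bet_comm h.symm v u,
          smul_smul, smul_zero, add_zero, ← add_smul]
    rw [show d + -(d / (2 * c)) * c + (-(d / (2 * c)) * c) = 0 by field_simp; ring, zero_smul]
  · rw [hv]
    exact ⟨c⁻¹, inv_ne_zero hc, by rw [smul_smul, inv_mul_cancel₀ hc, one_smul]⟩
end

theorem li4 {u v w s : Fin 4 → ℂ} (h : LinearIndependent ℂ ![u, v, w, s]) {x y z t : ℂ}
    (e : x • u + y • v + z • w + t • s = 0) : x = 0 ∧ y = 0 ∧ z = 0 ∧ t = 0 := by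
  rw [Fintype.linearIndependent_iff] at h
  have := h ![x, y, z, t] (by simpa [Fin.sum_univ_four] using e)
  exact ⟨this 0, this 1, this 2, this 3⟩

theorem li4_mk {u v w s : Fin 4 → ℂ} (h : ∀ x y z t : ℂ, x • u + y • v + z • w + t • s = 0 →
    x = 0 ∧ y = 0 ∧ z = 0 ∧ t = 0) : LinearIndependent ℂ ![u, v, w, s] := by
  rw [Fintype.linearIndependent_iff]
  intro g hg i
  simp [Fin.sum_univ_four] at hg
  obtain ⟨h0, h1, h2, h3⟩ := h _ _ _ _ hg
  fin_cases i <;> assumption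

theorem li4_span {u v w s : Fin 4 → ℂ} (h : LinearIndependent ℂ ![u, v, w, s]) (P : Fin 4 → ℂ) :
    ∃ x y z t : ℂ, P = x • u + y • v + z • w + t • s := by
  have := h.span_eq_top_of_card_eq_finrank' (by simp)
  have hP : P ∈ Submodule.span ℂ (Set.range ![u, v, w, s]) := by rw [this]; trivial
  rw [Submodule.mem_span_range_iff_exists_fun] at hP
  obtain ⟨c, hc⟩ := hP
  refine ⟨c 0, c 1, c 2, c 3, ?_⟩
  rw [← hc]; simp [Fin.sum_univ_four]

/-- The symmetric matrix of a product of two linear forms. -/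
noncomputable def sq2 (p q : Fin 3 → ℂ) : Matrix (Fin 3) (Fin 3) ℂ :=
  Matrix.of fun i j => (p i * q j + q i * p j) / 2

theorem sq2_symm (p q) : (sq2 p q).IsSymm := by
  ext i j; simp [sq2]; ring

theorem qf_sq2 (p q X) : qf (sq2 p q) X = (p ⬝ᵥ X) * (q ⬝ᵥ X) := by
  rw [qf_exp _ (sq2_symm p q), dot3, dot3]; simp [sq2]; ring

noncomputable def Kap (N : Fin 3 → Matrix (Fin 4) (Fin 4) ℂ) (u v w w' : Fin 4 → ℂ) : Matrix (Fin 3) (Fin 3) ℂ :=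
  sq2 (bet N u w) (bet N v w') + sq2 (bet N u w') (bet N v w) - sq2 (bet N u v) (bet N w w')

theorem Kap_symm (N u v w w') : (Kap N u v w w').IsSymm :=
  ((sq2_symm _ _).add (sq2_symm _ _)).sub (sq2_symm _ _)

theorem qf_Kap (N u v w w' X) : qf (Kap N u v w w') X = (bet N u w ⬝ᵥ X) * (bet N v w' ⬝ᵥ X) +
    (bet N u w' ⬝ᵥ X) * (bet N v w ⬝ᵥ X) - (bet N u v ⬝ᵥ X) * (bet N w w' ⬝ᵥ X) := by
  rw [← qf_sq2, ← qf_sq2, ← qf_sq2]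
  simp only [Kap, qf, add_mulVec, sub_mulVec, dotProduct_add, dotProduct_sub]

theorem Kap_fam {N : Fin 3 → Matrix (Fin 4) (Fin 4) ℂ} (hN : ∀ i, (N i).IsSymm) (u v w z) (t : ℂ) :
    Kap N u v (w + t • z) (w + t • z) = Kap N u v w w + (2 * t) • Kap N u v w z + t ^ 2 • Kap N u v z z := by
  ext i j
  simp only [Kap, sq2, bet_add_left, bet_add_right, bet_smul_left, bet_smul_right, bet_comm hN z w, Matrix.add_apply,
    Matrix.sub_apply, Matrix.smul_apply, Matrix.of_apply, Pi.add_apply, Pi.smul_apply, smul_eq_mul]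
  ring

structure Octad (N : Fin 3 → Matrix (Fin 4) (Fin 4) ℂ) {ι : Type} (O : ι → Fin 4 → ℂ) : Prop where
  bp : ∀ i j, i ≠ j → BP2 N (O i) (O j)
  complete : ∀ P, P ≠ 0 → bet N P P = 0 → ∃ i, Par (O i) P

theorem bet_uvw {N : Fin 3 → Matrix (Fin 4) (Fin 4) ℂ} (hN : ∀ i, (N i).IsSymm) {u v} (w) (huv : BP2 N u v) (x y : ℂ) :
    bet N (x • u + y • v + w) (x • u + y • v + w) = (2 * x * y) • bet N u v + (2 * x) • bet N u w +
      (2 * y) • bet N v w + bet N w w := by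
  simp only [bet_add_left, bet_add_right, bet_smul_left, bet_smul_right, huv.b1, huv.b2, smul_zero,
    bet_comm hN v u, bet_comm hN w u, bet_comm hN w v]
  module

theorem Kap_root {N : Fin 3 → Matrix (Fin 4) (Fin 4) ℂ} (hN : ∀ i, (N i).IsSymm) {u v w} (huv : BP2 N u v) {x y : ℂ}
    (h : bet N (x • u + y • v + w) (x • u + y • v + w) = 0) : (Kap N u v w w).det = 0 := by
  rw [bet_uvw hN w huv] at h
  apply det_of_prod (Kap_symm _ _ _ _ _) (b := (2 : ℂ) • (bet N u w + y • bet N u v)) (e := bet N v w + x • bet N u v)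
  intro X
  have := congrArg (· ⬝ᵥ X) h
  simp only [add_dotProduct, smul_dotProduct, zero_dotProduct, smul_eq_mul] at this
  rw [qf_Kap]
  simp only [add_dotProduct, smul_dotProduct, smul_eq_mul]
  linear_combination - (bet N u v ⬝ᵥ X) * this

section
variable {F : (Fin 3 → ℂ) → ℂ} {N : Fin 3 → Matrix (Fin 4) (Fin 4) ℂ}

theorem IsRep.gramK (h : IsRep F N) {u v w z : Fin 4 → ℂ} (huv : BP2 N u v) (hl : LinearIndependent ℂ ![u, v, w, z]) :
    ∃ k : ℂ, k ≠ 0 ∧ ∀ X, k * F X = qf (Kap N u v w z) X ^ 2 - qf (Kap N u v z z) X * qf (Kap N u v w w) X := by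
  obtain ⟨k, hk, e⟩ := h.gram hl
  refine ⟨k, hk, fun X => ?_⟩
  rw [e, huv.b1, huv.b2, qf_Kap, qf_Kap, qf_Kap]
  simp only [sdet, zero_dotProduct]
  ring

theorem IsRep.npar_a (hS : SmoothF F) (h : IsRep F N) {u v w z : Fin 4 → ℂ} (hu : bet N u u = 0) (hl : LinearIndependent ℂ ![u, v, w, z]) (μ : ℂ) :
    bet N u w ≠ μ • bet N u v := by
  intro e
  obtain ⟨X, hX, h1, h2⟩ := exists_orth (bet N u v) (bet N u z)
  exact h.L1 hS hl hu hX h1 (by rw [e, smul_dotProduct, h1, smul_zero]) h2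

theorem IsRep.root_base (hS : SmoothF F) (h : IsRep F N) {u v w z : Fin 4 → ℂ} (huv : BP2 N u v) (hl : LinearIndependent ℂ ![u, v, w, z])
    (hdet : (Kap N u v w w).det = 0) : ∃ x y : ℂ, bet N (x • u + y • v + w) (x • u + y • v + w) = 0 := by
  have n1 := h.npar_a hS huv.b1 hl
  have n2 := h.npar_a hS (u := v) (v := u) (w := w) (z := z) huv.b2 (li4_mk fun x y z t e => by
    obtain ⟨a, b, c, d⟩ := li4 hl (x := y) (y := x) (z := z) (t := t) (by rw [← e]; abel)
    exact ⟨b, a, c, d⟩)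
  rw [bet_comm h.symm v u] at n2
  have ha0 := h.bne hS huv
  obtain ⟨b, e, hbe⟩ := prod_of_det (Kap_symm _ _ _ _ _) hdet
  have hcr : bet N u v ⨯₃ bet N u w ≠ 0 := by
    intro hc
    obtain ⟨μ, hμ⟩ := parallel_of_cross ha0 hc
    exact n1 μ hμ
  have hX := hbe (bet N u v ⨯₃ bet N u w)
  rw [qf_Kap] at hX
  rw [dot_self_cross, dot_cross_self] at hX
  have hX : (b ⬝ᵥ bet N u v ⨯₃ bet N u w) * (e ⬝ᵥ bet N u v ⨯₃ bet N u w) = 0 := by rw [← hX]; ring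
  obtain ⟨b, e, hbe, hb⟩ : ∃ b e : Fin 3 → ℂ, (∀ X, qf (Kap N u v w w) X = (b ⬝ᵥ X) * (e ⬝ᵥ X)) ∧
      b ⬝ᵥ bet N u v ⨯₃ bet N u w = 0 := by
    rcases mul_eq_zero.1 hX with h' | h'
    · exact ⟨b, e, hbe, h'⟩
    · exact ⟨e, b, fun X => by rw [hbe, mul_comm], h'⟩
  obtain ⟨t, σ, rfl⟩ := plane_comb hcr (by rwa [dotProduct_comm])
  simp only [qf_Kap, add_dotProduct, smul_dotProduct, smul_eq_mul] at hbe
  have h3 : ∀ X, bet N u v ⬝ᵥ X = 0 → ((2 : ℂ) • bet N v w - σ • e) ⬝ᵥ X = 0 := by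
    have := plane_domain ha0 (isForm_dot (bet N u w)) (isForm_dot ((2 : ℂ) • bet N v w - σ • e)) (fun X hX => by
      have := hbe X
      rw [hX] at this
      simp only [sub_dotProduct, smul_dotProduct, smul_eq_mul]
      linear_combination this)
    refine this.resolve_left fun h4 => ?_
    obtain ⟨μ, hμ⟩ := plane_vanish ha0 h4
    exact n1 μ hμ
  obtain ⟨τ, hτ⟩ := plane_vanish ha0 h3
  have hσ : σ ≠ 0 := by
    rintro rfl
    apply n2 (τ / 2)
    rw [zero_smul, sub_zero] at hτ
    rw [div_eq_inv_mul, mul_smul, ← hτ, smul_smul]; norm_num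
  refine ⟨- τ / 2, t / σ, ?_⟩
  rw [bet_uvw h.symm w huv]
  apply dot_zero
  have := poly_domain (isForm_dot (bet N u v)).isPoly (isForm_dot ((2 * (-τ / 2) * (t / σ)) • bet N u v +
    (2 * (-τ / 2)) • bet N u w + (2 * (t / σ)) • bet N v w + bet N w w)).isPoly (fun X => by
      have e1 := hbe X
      have e2 := congrArg (· ⬝ᵥ X) hτ
      simp only [add_dotProduct, sub_dotProduct, smul_dotProduct, smul_eq_mul] at e2 ⊢
      field_simp
      linear_combination (-σ) * e1 + (t * (bet N u v ⬝ᵥ X) + σ * (bet N u w ⬝ᵥ X)) * e2)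
  refine this.resolve_left fun h4 => ha0 (dot_zero h4)

theorem IsRep.base_uniq (hS : SmoothF F) (h : IsRep F N) {u v w z : Fin 4 → ℂ} (huv : BP2 N u v) (hl : LinearIndependent ℂ ![u, v, w, z])
    {x y x' y' : ℂ} (h1 : bet N (x • u + y • v + w) (x • u + y • v + w) = 0)
    (h2 : bet N (x' • u + y' • v + w) (x' • u + y' • v + w) = 0) : x = x' ∧ y = y' := by
  by_contra hne
  have np : ∀ x y : ℂ, BP2 N u v → bet N (x • u + y • v + w) (x • u + y • v + w) = 0 →
      BP2 N u (x • u + y • v + w) ∧ BP2 N v (x • u + y • v + w) := by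
    intro x y _ hb
    refine ⟨⟨?_, huv.b1, hb⟩, ⟨?_, huv.b2, hb⟩⟩
    · rw [LinearIndependent.pair_iff]
      intro a b e
      obtain ⟨e1, e2, rfl, -⟩ := li4 hl (x := a + b * x) (y := b * y) (z := b) (t := 0) (by rw [← e]; module)
      simpa using e1
    · rw [LinearIndependent.pair_iff]
      intro a b e
      obtain ⟨e1, e2, rfl, -⟩ := li4 hl (x := b * x) (y := a + b * y) (z := b) (t := 0) (by rw [← e]; module)
      simpa using e2
  obtain ⟨p1, p2⟩ := np x y huv h1
  obtain ⟨p3, p4⟩ := np x' y' huv h2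
  have p5 : BP2 N (x • u + y • v + w) (x' • u + y' • v + w) := by
    refine ⟨?_, h1, h2⟩
    rw [LinearIndependent.pair_iff]
    intro a b e
    obtain ⟨e1, e2, e3, -⟩ := li4 hl (x := a * x + b * x') (y := a * y + b * y') (z := a + b) (t := 0)
      (by rw [← e]; module)
    have hb : b = -a := by linear_combination e3
    subst hb
    by_cases ha : a = 0
    · simp [ha]
    exfalso
    apply hne
    constructor <;> apply mul_left_cancel₀ ha
    · linear_combination e1
    · linear_combination e2
  have hR := h.R4 hS huv p1 p3 p2 p4 p5
  have := li4 hR (x := x' - x) (y := y' - y) (z := 1) (t := -1) (by module)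
  exact one_ne_zero this.2.2.1

theorem IsRep.octad (hS : SmoothF F) (h : IsRep F N) (hF : IsForm 4 F) : ∃ O : Fin 8 → Fin 4 → ℂ, Octad N O := by
  obtain ⟨a, -, ha, -⟩ := two_bitangents hS hF
  obtain ⟨u, v, huv, -⟩ := h.L5 hS hF ha
  obtain ⟨w, z, hl, hz⟩ : ∃ w z, LinearIndependent ℂ ![u, v, w, z] ∧ (Kap N u v z z).det ≠ 0 := by
    obtain ⟨w, z, hl⟩ := ext2 huv.li
    obtain ⟨k, hk, e⟩ := h.gramK huv hl
    have hD := DP_ne_zero hS hk (Kap_symm _ _ _ _ _) (Kap_symm _ _ _ _ _) (Kap_symm _ _ _ _ _) e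
    obtain ⟨t, ht⟩ : ∃ t, (DP (Kap N u v w w) (Kap N u v w z) (Kap N u v z z)).eval t ≠ 0 := by
      by_contra! h0
      exact hD (Polynomial.funext fun t => by rw [h0, Polynomial.eval_zero])
    refine ⟨z, w + t • z, li4_mk fun x y a b e => ?_, ?_⟩
    · obtain ⟨e1, e2, rfl, e4⟩ := li4 hl (x := x) (y := y) (z := b) (t := a + b * t) (by rw [← e]; module)
      simp_all
    · rw [DP_eval, ← Kap_fam h.symm] at ht
      exact ht
  obtain ⟨k, hk, e⟩ := h.gramK huv hl
  obtain ⟨r, hr, hroot⟩ := CF6 hS hk (Kap_symm _ _ _ _ _) (Kap_symm _ _ _ _ _) (Kap_symm _ _ _ _ _) e hz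
  have hlt : ∀ t : ℂ, LinearIndependent ℂ ![u, v, w + t • z, z] := by
    intro t
    refine li4_mk fun x y a b e => ?_
    obtain ⟨e1, e2, rfl, e4⟩ := li4 hl (x := x) (y := y) (z := a) (t := b + a * t) (by rw [← e]; module)
    simp_all
  have hG : ∀ i, ∃ x y : ℂ, bet N (x • u + y • v + (w + r i • z)) (x • u + y • v + (w + r i • z)) = 0 := by
    intro i
    apply h.root_base hS huv (hlt _)
    rw [Kap_fam h.symm]
    exact (hroot _).2 ⟨i, rfl⟩
  choose x y hG using hG
  set G : Fin 6 → Fin 4 → ℂ := fun i => x i • u + y i • v + (w + r i • z) with hGd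
  have huG : ∀ i, LinearIndependent ℂ ![u, G i] := by
    intro i
    rw [LinearIndependent.pair_iff]
    intro a b e
    obtain ⟨e1, e2, rfl, -⟩ := li4 hl (x := a + b * x i) (y := b * y i) (z := b) (t := b * r i)
      (by rw [← e]; simp only [hGd]; module)
    simpa using e1
  have hvG : ∀ i, LinearIndependent ℂ ![v, G i] := by
    intro i
    rw [LinearIndependent.pair_iff]
    intro a b e
    obtain ⟨e1, e2, rfl, -⟩ := li4 hl (x := b * x i) (y := a + b * y i) (z := b) (t := b * r i)
      (by rw [← e]; simp only [hGd]; module)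
    simpa using e2
  have hGG : ∀ i j, i ≠ j → LinearIndependent ℂ ![G i, G j] := by
    intro i j hij
    rw [LinearIndependent.pair_iff]
    intro a b e
    obtain ⟨-, -, e3, e4⟩ := li4 hl (x := a * x i + b * x j) (y := a * y i + b * y j) (z := a + b) (t := a * r i + b * r j)
      (by rw [← e]; simp only [hGd]; module)
    have hb : b = -a := by linear_combination e3
    subst hb
    have : a * (r i - r j) = 0 := by linear_combination e4
    have := (mul_eq_zero.1 this).resolve_right (sub_ne_zero.2 (fun e => hij (hr e)))
    simp [this]
  let O : Fin 2 ⊕ Fin 6 → Fin 4 → ℂ := Sum.elim ![u, v] G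
  have hO : Octad N O := by
    refine ⟨?_, ?_⟩
    · have hh : ∀ i j, BP2 N (![u, v] i) (G j) := by
        intro i j
        fin_cases i
        · exact ⟨huG j, huv.b1, hG j⟩
        · exact ⟨hvG j, huv.b2, hG j⟩
      rintro (i | i) (j | j) hij
      · fin_cases i <;> fin_cases j
        · exact absurd rfl hij
        · exact huv
        · exact huv.symm
        · exact absurd rfl hij
      · exact hh i j
      · exact (hh j i).symm
      · exact ⟨hGG i j (fun e => hij (by rw [e])), hG i, hG j⟩
    · intro P hP0 hP
      obtain ⟨p, q, a, b, rfl⟩ := li4_span hl P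
      by_cases ha : a = 0
      · subst ha
        by_cases hb : b = 0
        · subst hb
          have := bet_uvw h.symm 0 huv p q
          simp only [zero_smul, add_zero] at hP this
          rw [hP] at this
          simp only [bet_zero_right, smul_zero, add_zero] at this
          have := (smul_eq_zero.1 this.symm).resolve_right (h.bne hS huv)
          rcases mul_eq_zero.1 this with h' | h'
          · have hp : p = 0 := by simpa using h'
            refine ⟨Sum.inl 1, par_of_smul hP0 (μ := q) ?_⟩
            simp [O, hp]
          · refine ⟨Sum.inl 0, par_of_smul hP0 (μ := p) ?_⟩
            simp [O, h']
        · exfalso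
          apply hz
          apply Kap_root h.symm huv (x := p / b) (y := q / b)
          have : (p / b) • u + (q / b) • v + z = b⁻¹ • (p • u + q • v + (0 : ℂ) • w + b • z) := by
            rw [zero_smul, add_zero, smul_add, smul_add, smul_smul, smul_smul, smul_smul, inv_mul_cancel₀ hb, one_smul,
              div_eq_inv_mul, div_eq_inv_mul]
          rw [this, bet_smul_left, bet_smul_right, hP, smul_zero, smul_zero]
      · have e1 : (p / a) • u + (q / a) • v + (w + (b / a) • z) = a⁻¹ • (p • u + q • v + a • w + b • z) := by
          simp only [smul_add, smul_smul, inv_mul_cancel₀ ha, one_smul, div_eq_inv_mul, add_assoc]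
        have e2 : bet N ((p / a) • u + (q / a) • v + (w + (b / a) • z)) ((p / a) • u + (q / a) • v + (w + (b / a) • z)) = 0 := by
          rw [e1, bet_smul_left, bet_smul_right, hP, smul_zero, smul_zero]
        have e3 := Kap_root h.symm huv e2
        rw [Kap_fam h.symm, hroot] at e3
        obtain ⟨i, hi⟩ := e3
        have e4 := hG i
        simp only [hGd, hi] at e4
        obtain ⟨f1, f2⟩ := h.base_uniq hS huv (hlt _) e4 e2
        refine ⟨Sum.inr i, par_of_smul hP0 (μ := a) ?_⟩
        simp only [O, Sum.elim_inr, hGd, f1, f2, hi, e1]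
        rw [smul_smul, mul_inv_cancel₀ ha, one_smul]
  let E : Fin 2 ⊕ Fin 6 ≃ Fin 8 := finSumFinEquiv
  refine ⟨O ∘ E.symm, fun i j hij => hO.bp _ _ (fun e => hij (E.symm.injective e)), fun P h1 h2 => ?_⟩
  obtain ⟨i, hi⟩ := hO.complete P h1 h2
  exact ⟨E i, by simpa using hi⟩
end

theorem plane_ne4 {l a b c d : Fin 3 → ℂ} (hl : l ≠ 0) (ha0 : a ≠ 0) (hb0 : b ≠ 0) (hc0 : c ≠ 0) (hd0 : d ≠ 0)
    (ha : ¬ Par l a) (hb : ¬ Par l b) (hc : ¬ Par l c)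
    (hd : ¬ Par l d) : ∃ X, l ⬝ᵥ X = 0 ∧ a ⬝ᵥ X ≠ 0 ∧ b ⬝ᵥ X ≠ 0 ∧ c ⬝ᵥ X ≠ 0 ∧ d ⬝ᵥ X ≠ 0 := by
  by_contra! h
  have key : ∀ m : Fin 3 → ℂ, m ≠ 0 → ¬ Par l m → ¬ ∀ X, l ⬝ᵥ X = 0 → m ⬝ᵥ X = 0 := by
    intro m hm hp hv
    obtain ⟨μ, e⟩ := plane_vanish hl hv
    exact hp (par_of_smul hm e)
  have D := fun v : Fin 3 → ℂ => isForm_dot v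
  have := plane_domain hl ((D a).mul (D b)) ((D c).mul (D d)) (fun X hX => by
    by_contra hne
    simp only [mul_eq_zero, not_or] at hne
    exact hne.2.2 (h X hX hne.1.1 hne.1.2 hne.2.1))
  rcases this with h' | h'
  · rcases plane_domain hl (D a) (D b) h' with h' | h'
    · exact key a ha0 ha h'
    · exact key b hb0 hb h'
  · rcases plane_domain hl (D c) (D d) h' with h' | h'
    · exact key c hc0 hc h'
    · exact key d hd0 hd h'

theorem detf_torus {A B C σ p q r p' q' r' p1 : ℂ} 
    (hr : r ≠ 0) (hq : q' ≠ 0) (hp : p1 ≠ 0)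
    (e1 : σ * detf 0 0 r = detf (A * 0) (B * 0) (C * r)) 
    (e2 : σ * detf 0 q' 0 = detf (A * 0) (B * q') (C * 0)) 
    (e3 : σ * detf p1 0 0 = detf (A * p1) (B * 0) (C * 0)) 
    (hp' : p ≠ 0) (hq' : q ≠ 0) (e4 : σ * detf p q 0 = detf (A * p) (B * q) (C * 0))
    (hp1 : p' ≠ 0) (hr1 : r' ≠ 0) (e5 : σ * detf p' 0 r' = detf (A * p') (B * 0) (C * r')) (hA : A ≠ 0) :
    B = A ∧ C = A := by
  simp only [detf] at *
  have a1 : C ^ 2 = σ := by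
    apply mul_right_cancel₀ (pow_ne_zero 2 hr); linear_combination -e1
  have a2 : B ^ 2 = σ := by
    apply mul_right_cancel₀ (pow_ne_zero 2 hq); linear_combination -e2
  have a3 : A ^ 2 = σ := by
    apply mul_right_cancel₀ (pow_ne_zero 2 hp); linear_combination -e3
  have a4 : A * B = σ := by
    apply mul_right_cancel₀ (mul_ne_zero hp' hq'); linear_combination (e4 + p ^ 2 * a3 + q ^ 2 * a2) / 2
  have a5 : A * C = σ := by
    apply mul_right_cancel₀ (mul_ne_zero hp1 hr1); linear_combination (e5 + p' ^ 2 * a3 + r' ^ 2 * a1) / 2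
  constructor <;> apply mul_left_cancel₀ hA
  · rw [a4, ← a3, pow_two]
  · rw [a5, ← a3, pow_two]

theorem torus_scal {c01 c02 c03 c12 c13 c23 : ℂ} (h01 : c01 ≠ 0) (h02 : c02 ≠ 0) (h03 : c03 ≠ 0)
    (h12 : c12 ≠ 0) (e1 : c02 * c13 = c01 * c23) (e2 : c03 * c12 = c01 * c23) :
    ∃ t0 t1 t2 t3 : ℂ, t0 ≠ 0 ∧ t1 ≠ 0 ∧ t2 ≠ 0 ∧ t3 ≠ 0 ∧ c01 = t0 * t1 ∧ c02 = t0 * t2 ∧ c03 = t0 * t3 ∧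
      c12 = t1 * t2 ∧ c13 = t1 * t3 ∧ c23 = t2 * t3 := by
  obtain ⟨t, ht⟩ := IsAlgClosed.exists_pow_nat_eq (c01 * c02 / c12) (n := 2) (by norm_num)
  have ht0 : t ≠ 0 := by
    rintro rfl
    have : c01 * c02 / c12 ≠ 0 := div_ne_zero (mul_ne_zero h01 h02) h12
    exact this (by rw [← ht]; ring)
  have ht' : t ^ 2 * c12 = c01 * c02 := by rw [ht]; field_simp
  refine ⟨t, c01 / t, c02 / t, c03 / t, ht0, div_ne_zero h01 ht0, div_ne_zero h02 ht0, div_ne_zero h03 ht0,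
    by field_simp, by field_simp, by field_simp, ?_, ?_, ?_⟩
  · field_simp; linear_combination ht'
  · field_simp
    apply mul_left_cancel₀ (mul_ne_zero h02 h12)
    linear_combination c02 * c13 * ht' + c01 * c02 * (e1 - e2)
  · field_simp
    apply mul_left_cancel₀ (mul_ne_zero h01 h12)
    linear_combination c01 * c23 * ht' - c01 * c02 * e2

def BPF (N : Fin 3 → Matrix (Fin 4) (Fin 4) ℂ) {ι : Type} (u : ι → Fin 4 → ℂ) : Prop := ∀ i j, i ≠ j → BP2 N (u i) (u j)

theorem BPF.base {N} {u : Fin 4 → Fin 4 → ℂ} (h : BPF N u) (i) : bet N (u i) (u i) = 0 := by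
  obtain ⟨j, hj⟩ := exists_ne i
  exact (h i j hj.symm).b1

section
variable {F : (Fin 3 → ℂ) → ℂ} {N : Fin 3 → Matrix (Fin 4) (Fin 4) ℂ}

theorem IsRep.pt1 (hS : SmoothF F) (h : IsRep F N) {u : Fin 4 → Fin 4 → ℂ} (hu : BPF N u) {i j k l : Fin 4} (hij : i ≠ j) (hik : i ≠ k) (hil : i ≠ l)
    (hjk : j ≠ k) (hjl : j ≠ l) (hkl : k ≠ l) :
    ∃ X, bet N (u i) (u j) ⬝ᵥ X = 0 ∧ bet N (u i) (u k) ⬝ᵥ X = 0 ∧ bet N (u i) (u l) ⬝ᵥ X ≠ 0 ∧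
      bet N (u j) (u k) ⬝ᵥ X ≠ 0 := by
  obtain ⟨X, hX, h1, h2⟩ := exists_orth (bet N (u i) (u j)) (bet N (u i) (u k))
  refine ⟨X, h1, h2, fun h3 => ?_, fun h3 => ?_⟩
  · exact h.L1 hS (h.R4 hS (hu i j hij) (hu i k hik) (hu i l hil) (hu j k hjk) (hu j l hjl) (hu k l hkl))
      (hu.base i) hX h1 h2 h3
  · exact h.L1b hS (h.R3 hS (hu i j hij) (hu i k hik) (hu j k hjk)) hX (by rw [hu.base, zero_dotProduct]) h1 h2
      (by rw [hu.base, zero_dotProduct]) h3 (by rw [hu.base, zero_dotProduct])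

theorem IsRep.pt2 (hS : SmoothF F) (h : IsRep F N) {u : Fin 4 → Fin 4 → ℂ} (hu : BPF N u) {i j k l : Fin 4} (hij : i ≠ j) (hik : i ≠ k) (hil : i ≠ l)
    (hjk : j ≠ k) (hjl : j ≠ l) (hkl : k ≠ l) :
    ∃ X, bet N (u i) (u j) ⬝ᵥ X = 0 ∧ bet N (u i) (u k) ⬝ᵥ X ≠ 0 ∧ bet N (u i) (u l) ⬝ᵥ X ≠ 0 ∧
      bet N (u j) (u k) ⬝ᵥ X ≠ 0 ∧ bet N (u j) (u l) ⬝ᵥ X ≠ 0 := by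
  apply plane_ne4 (h.bne hS (hu _ _ hij)) (h.bne hS (hu _ _ hik)) (h.bne hS (hu _ _ hil)) (h.bne hS (hu _ _ hjk))
    (h.bne hS (hu _ _ hjl)) (h.L7a hS (hu _ _ hij) (hu _ _ hik) (hu _ _ hjk))
    (h.L7a hS (hu _ _ hij) (hu _ _ hil) (hu _ _ hjl))
  · rw [bet_comm h.symm (u i)]
    exact h.L7a hS (hu _ _ hij.symm) (hu _ _ hjk) (hu _ _ hik)
  · rw [bet_comm h.symm (u i)]
    exact h.L7a hS (hu _ _ hij.symm) (hu _ _ hjl) (hu _ _ hil)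

theorem IsRep.torus (hS : SmoothF F) (h : IsRep F N) {N'} (h' : IsRep F N') {u u' : Fin 4 → Fin 4 → ℂ} (hu : BPF N u) (hu' : BPF N' u')
    (hp : ∀ i j, i < j → Par (bet N (u i) (u j)) (bet N' (u' i) (u' j))) :
    ∃ T : Matrix (Fin 4) (Fin 4) ℂ, IsUnit T.det ∧ ∀ k, N' k = T * N k * Tᵀ := by
  have li := h.R4 hS (hu 0 1 (by decide)) (hu 0 2 (by decide)) (hu 0 3 (by decide)) (hu 1 2 (by decide))
    (hu 1 3 (by decide)) (hu 2 3 (by decide))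
  have li' := h'.R4 hS (hu' 0 1 (by decide)) (hu' 0 2 (by decide)) (hu' 0 3 (by decide)) (hu' 1 2 (by decide))
    (hu' 1 3 (by decide)) (hu' 2 3 (by decide))
  obtain ⟨k, hk, e⟩ := h.gram0 li (hu.base 0) (hu.base 1) (hu.base 2) (hu.base 3)
  obtain ⟨k', hk', e'⟩ := h'.gram0 li' (hu'.base 0) (hu'.base 1) (hu'.base 2) (hu'.base 3)
  obtain ⟨c01, n01, h01⟩ := hp 0 1 (by decide)
  obtain ⟨c02, n02, h02⟩ := hp 0 2 (by decide)
  obtain ⟨c03, n03, h03⟩ := hp 0 3 (by decide)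
  obtain ⟨c12, n12, h12⟩ := hp 1 2 (by decide)
  obtain ⟨c13, n13, h13⟩ := hp 1 3 (by decide)
  obtain ⟨c23, n23, h23⟩ := hp 2 3 (by decide)
  have E : ∀ X, (k' / k) * detf ((bet N (u 0) (u 1) ⬝ᵥ X) * (bet N (u 2) (u 3) ⬝ᵥ X))
      ((bet N (u 0) (u 2) ⬝ᵥ X) * (bet N (u 1) (u 3) ⬝ᵥ X)) ((bet N (u 0) (u 3) ⬝ᵥ X) * (bet N (u 1) (u 2) ⬝ᵥ X)) =
      detf ((c01 * c23) * ((bet N (u 0) (u 1) ⬝ᵥ X) * (bet N (u 2) (u 3) ⬝ᵥ X)))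
      ((c02 * c13) * ((bet N (u 0) (u 2) ⬝ᵥ X) * (bet N (u 1) (u 3) ⬝ᵥ X)))
      ((c03 * c12) * ((bet N (u 0) (u 3) ⬝ᵥ X) * (bet N (u 1) (u 2) ⬝ᵥ X))) := by
    intro X
    rw [← e]
    have := e' X
    rw [h01, h02, h03, h12, h13, h23] at this
    simp only [smul_dotProduct, smul_eq_mul] at this
    rw [show k' / k * (k * F X) = k' * F X by field_simp, this]
    congr 1 <;> ring
  have d : ∀ {i j : Fin 4} (_ : decide (i ≠ j) = true), i ≠ j := fun hh => of_decide_eq_true hh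
  obtain ⟨X1, x1, x2, x3, x4⟩ := h.pt1 hS hu (i := 0) (j := 1) (k := 2) (l := 3) (d rfl) (d rfl) (d rfl) (d rfl) (d rfl) (d rfl)
  obtain ⟨X2, y1, y2, y3, y4⟩ := h.pt1 hS hu (i := 0) (j := 1) (k := 3) (l := 2) (d rfl) (d rfl) (d rfl) (d rfl) (d rfl) (d rfl)
  obtain ⟨X3, z1, z2, z3, z4⟩ := h.pt1 hS hu (i := 0) (j := 2) (k := 3) (l := 1) (d rfl) (d rfl) (d rfl) (d rfl) (d rfl) (d rfl)
  obtain ⟨X4, w0, w1, w2, w3, w4⟩ := h.pt2 hS hu (i := 0) (j := 3) (k := 1) (l := 2) (d rfl) (d rfl) (d rfl) (d rfl) (d rfl) (d rfl)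
  obtain ⟨X5, v0, v1, v2, v3, v4⟩ := h.pt2 hS hu (i := 0) (j := 2) (k := 1) (l := 3) (d rfl) (d rfl) (d rfl) (d rfl) (d rfl) (d rfl)
  rw [bet_comm h.symm (u 3)] at w3 w4
  rw [bet_comm h.symm (u 2)] at v3
  have E1 := E X1
  rw [x1, x2, zero_mul, zero_mul] at E1
  have E2 := E X2
  rw [y1, y2, zero_mul, zero_mul] at E2
  have E3 := E X3
  rw [z1, z2, zero_mul, zero_mul] at E3
  have E4 := E X4
  rw [w0, zero_mul] at E4
  have E5 := E X5
  rw [v0, zero_mul] at E5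
  obtain ⟨hB, hC⟩ := detf_torus (mul_ne_zero x3 x4) (mul_ne_zero y3 y4) (mul_ne_zero z3 z4) E1 E2 E3
    (mul_ne_zero w1 w4) (mul_ne_zero w2 w3) E4 (mul_ne_zero v1 v4) (mul_ne_zero v2 v3) E5 (mul_ne_zero n01 n23)
  obtain ⟨t0, t1, t2, t3, m0, m1, m2, m3, rfl, rfl, rfl, rfl, rfl, rfl⟩ := torus_scal n01 n02 n03 n12 hB hC
  have key : ∀ i j, bet N' (u' i) (u' j) = (![t0, t1, t2, t3] i * ![t0, t1, t2, t3] j) • bet N (u i) (u j) := by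
    have lt : ∀ i j, i < j → bet N' (u' i) (u' j) = (![t0, t1, t2, t3] i * ![t0, t1, t2, t3] j) • bet N (u i) (u j) := by
      intro i j hij
      fin_cases i <;> fin_cases j <;> first | exact absurd hij (by decide) | assumption
    intro i j
    rcases lt_trichotomy i j with hij | hij | hij
    · exact lt i j hij
    · subst hij; rw [hu.base, hu'.base, smul_zero]
    · rw [bet_comm h.symm, bet_comm h'.symm, lt j i hij, mul_comm]
  have e0 : (Matrix.of ![u 0, u 1, u 2, u 3] : Matrix (Fin 4) (Fin 4) ℂ) = Matrix.of u := by
    ext i j; fin_cases i <;> rfl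
  have e0' : (Matrix.of ![u' 0, u' 1, u' 2, u' 3] : Matrix (Fin 4) (Fin 4) ℂ) = Matrix.of u' := by
    ext i j; fin_cases i <;> rfl
  set S : Matrix (Fin 4) (Fin 4) ℂ := Matrix.of u with hSd
  set S' : Matrix (Fin 4) (Fin 4) ℂ := Matrix.of u' with hSd'
  have hSu : IsUnit S := by
    rw [← e0]; exact Matrix.linearIndependent_rows_iff_isUnit.1 li
  have hSu' : IsUnit S' := by
    rw [← e0']; exact Matrix.linearIndependent_rows_iff_isUnit.1 li'
  rw [Matrix.isUnit_iff_isUnit_det] at hSu hSu'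
  have ent : ∀ (N : Fin 3 → Matrix (Fin 4) (Fin 4) ℂ) (u : Fin 4 → Fin 4 → ℂ) k i j,
      ((Matrix.of u) * N k * (Matrix.of u)ᵀ) i j = bet N (u i) (u j) k := by
    intro N u k i j
    rw [Matrix.mul_assoc, Matrix.mul_apply]
    rfl
  set D : Matrix (Fin 4) (Fin 4) ℂ := Matrix.diagonal ![t0, t1, t2, t3] with hD
  have hDt : Dᵀ = D := Matrix.diagonal_transpose _
  have hmat : ∀ k, S' * N' k * S'ᵀ = D * (S * N k * Sᵀ) * Dᵀ := by
    intro k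
    ext i j
    rw [hDt, hD, Matrix.mul_diagonal, Matrix.diagonal_mul, ent, ent, key]
    simp only [Pi.smul_apply, smul_eq_mul]
    ring
  refine ⟨S'⁻¹ * D * S, ?_, fun k => ?_⟩
  · rw [Matrix.det_mul, Matrix.det_mul]
    refine IsUnit.mul (IsUnit.mul (Matrix.isUnit_nonsing_inv_det _ hSu') ?_) hSu
    rw [hD, Matrix.det_diagonal, Fin.prod_univ_four]
    simp [m0, m1, m2, m3]
  · have hst : IsUnit S'ᵀ.det := by rwa [Matrix.det_transpose]
    calc N' k = S'⁻¹ * (S' * N' k * S'ᵀ) * S'ᵀ⁻¹ := by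
          rw [Matrix.mul_assoc S', Matrix.nonsing_inv_mul_cancel_left _ _ hSu', Matrix.mul_nonsing_inv_cancel_right _ _ hst]
      _ = _ := by
          rw [hmat]
          simp only [Matrix.transpose_mul, Matrix.transpose_nonsing_inv, Matrix.mul_assoc]
end

/-- Exact determinantal representations. -/
structure IsRep1 (F : (Fin 3 → ℂ) → ℂ) (N : Fin 3 → Matrix (Fin 4) (Fin 4) ℂ) : Prop where
  symm : ∀ i, (N i).IsSymm
  det : ∀ X, F X = (pen N X).det

theorem IsRep1.isRep {F N} (h : IsRep1 F N) : IsRep F N :=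
  ⟨h.symm, 1, one_ne_zero, fun X => by rw [one_mul, h.det]⟩

theorem bet_single (N : Fin 3 → Matrix (Fin 4) (Fin 4) ℂ) (i j : Fin 4) :
    bet N (Pi.single i 1) (Pi.single j 1) = fun k => N k i j := by
  funext k
  simp [bet]

theorem pen_apply (N : Fin 3 → Matrix (Fin 4) (Fin 4) ℂ) (X : Fin 3 → ℂ) (i j : Fin 4) :
    pen N X i j = (fun k => N k i j) ⬝ᵥ X := by
  rw [← bet_single, bet_dot]
  simp

/-- The net with zero diagonal and prescribed off-diagonal linear forms. -/
def netOf (c : ℂ) (m : Fin 6 → Fin 3 → ℂ) : Fin 3 → Matrix (Fin 4) (Fin 4) ℂ := fun k =>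
  c • !![0, m 0 k, m 2 k, m 4 k; m 0 k, 0, m 5 k, m 3 k; m 2 k, m 5 k, 0, m 1 k; m 4 k, m 3 k, m 1 k, 0]

theorem netOf_rep {F : (Fin 3 → ℂ) → ℂ} {m : Fin 6 → Fin 3 → ℂ} {κ c : ℂ} (hc : c ^ 4 * κ = 1)
    (h : ∀ X, κ * F X = detf ((m 0 ⬝ᵥ X) * (m 1 ⬝ᵥ X)) ((m 2 ⬝ᵥ X) * (m 3 ⬝ᵥ X))
      ((m 4 ⬝ᵥ X) * (m 5 ⬝ᵥ X))) : IsRep1 F (netOf c m) := by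
  have hs : ∀ i, (netOf c m i).IsSymm := by
    intro i
    ext a b
    fin_cases a <;> fin_cases b <;> rfl
  refine ⟨hs, fun X => ?_⟩
  rw [sdet_eq _ (pen_symm hs X)]
  have z : ∀ i, (fun k => netOf c m k i i) ⬝ᵥ X = 0 := by
    intro i
    have : (fun k => netOf c m k i i) = 0 := by
      funext k; fin_cases i <;> simp [netOf]
    rw [this, zero_dotProduct]
  have e : ∀ i j l, (∀ k, netOf c m k i j = c * m l k) → (fun k => netOf c m k i j) ⬝ᵥ X = c * (m l ⬝ᵥ X) := by
    intro i j l hh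
    have : (fun k => netOf c m k i j) = c • m l := by
      funext k; rw [hh]; rfl
    rw [this, smul_dotProduct, smul_eq_mul]
  simp only [pen_apply]
  rw [z, z, z, z, e 0 1 0 (fun _ => rfl), e 0 2 2 (fun _ => rfl), e 0 3 4 (fun _ => rfl),
    e 1 2 5 (fun _ => rfl), e 1 3 3 (fun _ => rfl), e 2 3 1 (fun _ => rfl), detf_gram]
  calc F X = c ^ 4 * (κ * F X) := by rw [← mul_assoc, hc, one_mul]
    _ = _ := by rw [h]; simp only [detf]; ring

theorem netOf_BPF (c : ℂ) (m : Fin 6 → Fin 3 → ℂ) : BPF (netOf c m) (fun i => Pi.single i 1) := by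
  have z : ∀ i : Fin 4, bet (netOf c m) (Pi.single i 1) (Pi.single i 1) = 0 := by
    intro i
    rw [bet_single]
    funext k; fin_cases i <;> simp [netOf]
  intro i j hij
  refine ⟨li_pair ?_ ?_ ?_, z i, z j⟩
  · intro h; have := congrFun h i; simp at this
  · intro h; have := congrFun h j; simp at this
  · rintro ⟨μ, hμ, h⟩
    have := congrFun h j
    simp [hij.symm] at this

theorem rep_of_InW {F : (Fin 3 → ℂ) → ℂ} {m : Fin 6 → Fin 3 → ℂ} {κ : ℂ} (hκ : κ ≠ 0)
    (h : ∀ X, κ * F X = detf ((m 0 ⬝ᵥ X) * (m 1 ⬝ᵥ X)) ((m 2 ⬝ᵥ X) * (m 3 ⬝ᵥ X))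
      ((m 4 ⬝ᵥ X) * (m 5 ⬝ᵥ X))) :
    ∃ (N : Fin 3 → Matrix (Fin 4) (Fin 4) ℂ) (u : Fin 4 → Fin 4 → ℂ), IsRep1 F N ∧ BPF N u ∧ Par (m 0) (bet N (u 0) (u 1)) ∧ Par (m 1) (bet N (u 2) (u 3)) ∧
      Par (m 2) (bet N (u 0) (u 2)) ∧ Par (m 3) (bet N (u 1) (u 3)) ∧
      Par (m 4) (bet N (u 0) (u 3)) ∧ Par (m 5) (bet N (u 1) (u 2)) := by
  obtain ⟨c, hc⟩ := IsAlgClosed.exists_pow_nat_eq κ⁻¹ (show 0 < 4 by norm_num)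
  have hc0 : c ≠ 0 := by
    rintro rfl
    rw [zero_pow (by norm_num)] at hc
    exact inv_ne_zero hκ hc.symm
  refine ⟨netOf c m, fun i : Fin 4 => Pi.single i 1, netOf_rep (by rw [hc, inv_mul_cancel₀ hκ]) h, netOf_BPF c m, ?_⟩
  refine ⟨⟨c, hc0, ?_⟩, ⟨c, hc0, ?_⟩, ⟨c, hc0, ?_⟩, ⟨c, hc0, ?_⟩, ⟨c, hc0, ?_⟩, ⟨c, hc0, ?_⟩⟩ <;>
    rw [bet_single] <;> rfl

theorem rep_exists {F} (hS : SmoothF F) (hF : IsForm 4 F) : ∃ N, IsRep1 F N := by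
  obtain ⟨a, g, ha, hg, hag⟩ := two_bitangents hS hF
  obtain ⟨Θ⟩ := theta_exists hS hF ha hg hag
  obtain ⟨κ, δ, hκ, hδ, h⟩ := Θ.pair (0, true) (1, true) (by simp)
  obtain ⟨N, u, hN, -⟩ := rep_of_InW (F := F) (m := ![δ • a, g, (Θ.θ (0, true)).1, (Θ.θ (0, true)).2,
    (Θ.θ (1, true)).1, (Θ.θ (1, true)).2]) hκ (by
      intro X
      rw [h X]
      simp [mul_assoc])
  exact ⟨N, hN⟩

/-- Index set of unordered pairs. -/
abbrev P28 := {x : Fin 8 × Fin 8 // x.1 < x.2}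

section
variable {F : (Fin 3 → ℂ) → ℂ} {N : Fin 3 → Matrix (Fin 4) (Fin 4) ℂ}

/-- The lines through octad points determine the pair of indices. -/
theorem IsRep.pair_inj (h : IsRep F N) (hS : SmoothF F) {O : Fin 8 → Fin 4 → ℂ} (hO : Octad N O) {i j k l : Fin 8}
    (hij : i ≠ j) (hkl : k ≠ l) (hp : Par (bet N (O i) (O j)) (bet N (O k) (O l))) :
    (i = k ∧ j = l) ∨ (i = l ∧ j = k) := by
  have key : ∀ {i j k : Fin 8}, i ≠ j → i ≠ k → Par (bet N (O i) (O j)) (bet N (O i) (O k)) → j = k := by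
    intro i j k hij hik hp
    by_contra hjk
    exact h.L7a hS (hO.bp _ _ hij) (hO.bp _ _ hik) (hO.bp _ _ hjk) hp
  by_cases h1 : i = k
  · subst h1
    exact Or.inl ⟨rfl, key hij hkl hp⟩
  by_cases h2 : i = l
  · subst h2
    rw [bet_comm h.symm (O k)] at hp
    exact Or.inr ⟨rfl, key hij hkl.symm hp⟩
  by_cases h3 : j = k
  · subst h3
    rw [bet_comm h.symm (O i)] at hp
    exact absurd (key hij.symm hkl hp) h2
  by_cases h4 : j = l
  · subst h4
    rw [bet_comm h.symm (O i), bet_comm h.symm (O k)] at hp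
    exact absurd (key hij.symm hkl.symm hp) h1
  exact absurd hp (h.L7b hS (hO.bp _ _ hij) (hO.bp _ _ h1) (hO.bp _ _ h2) (hO.bp _ _ h3) (hO.bp _ _ h4) (hO.bp _ _ hkl))

theorem IsRep.bit_pair (h : IsRep F N) (hS : SmoothF F) {u v : Fin 4 → ℂ} (huv : BP2 N u v) : Bit F (bet N u v) :=
  h.L6 hS huv.li huv.b1 huv.b2

theorem par_bet {u v u' v' : Fin 4 → ℂ} (hu : Par u u') (hv : Par v v') : Par (bet N u v) (bet N u' v') := by
  obtain ⟨a, ha, rfl⟩ := hu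
  obtain ⟨b, hb, rfl⟩ := hv
  exact ⟨a * b, mul_ne_zero ha hb, by rw [bet_smul_left, bet_smul_right, smul_smul]⟩

theorem card_BitP (hS : SmoothF F) (hF : IsForm 4 F) : Nat.card (BitP F) = 28 := by
  obtain ⟨N, hN⟩ := rep_exists hS hF
  have h := hN.isRep
  obtain ⟨O, hO⟩ := h.octad hS hF
  let φ : P28 → BitP F := fun x => ⟨cl (bet N (O x.1.1) (O x.1.2)) (h.bne hS (hO.bp _ _ x.2.ne)),
    (cl_mem_BitP _).2 (h.bit_pair hS (hO.bp _ _ x.2.ne))⟩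
  have hφ : Function.Bijective φ := by
    constructor
    · rintro ⟨⟨i, j⟩, hij⟩ ⟨⟨k, l⟩, hkl⟩ e
      have e' := (cl_eq _ _).1 (Subtype.ext_iff.1 e)
      simp only at hij hkl e'
      rcases h.pair_inj hS hO hij.ne hkl.ne e' with ⟨rfl, rfl⟩ | ⟨rfl, rfl⟩
      · rfl
      · exact absurd hij hkl.asymm
    · rintro ⟨x, hx⟩
      obtain ⟨u, v, huv, hp⟩ := h.L5 hS hF hx
      obtain ⟨i, hi⟩ := hO.complete u huv.ne1 huv.b1
      obtain ⟨j, hj⟩ := hO.complete v huv.ne2 huv.b2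
      have hij : i ≠ j := by
        rintro rfl
        exact li_not_par huv.li (hi.symm.trans hj)
      have hp' : Par (bet N (O i) (O j)) x.rep := (par_bet hi hj).trans hp
      rcases lt_or_gt_of_ne hij with hlt | hlt
      · refine ⟨⟨(i, j), hlt⟩, Subtype.ext ?_⟩
        exact ((cl_eq _ x.rep_nonzero).2 hp').trans (cl_rep x)
      · refine ⟨⟨(j, i), hlt⟩, Subtype.ext ?_⟩
        rw [bet_comm h.symm] at hp'
        exact ((cl_eq _ x.rep_nonzero).2 hp').trans (cl_rep x)
  rw [← Nat.card_congr (Equiv.ofBijective φ hφ), Nat.card_eq_fintype_card]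
  decide

theorem card_pairs {α : Type*} {n : ℕ} (h : Nat.card α = n) (hn : n ≠ 0) :
    Nat.card {x : α × α // x.1 ≠ x.2} = n * n - n := by
  have : Finite α := Nat.finite_of_card_ne_zero (by rw [h]; exact hn)
  classical
  have := Fintype.ofFinite α
  rw [Nat.card_eq_fintype_card] at h ⊢
  rw [Fintype.card_subtype, ← h]
  have := Finset.offDiag_card (Finset.univ : Finset α)
  rw [Finset.card_univ] at this
  rw [← this]
  congr 1
  ext x
  simp

theorem card_InW (hS : SmoothF F) (hF : IsForm 4 F) : Nat.card {w // InW F w} = 60480 := by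
  rw [card_W hS hF]
  have := card_pairs (card_BitP hS hF) (by norm_num)
  unfold BitPairs
  rw [this]
end

/-- Equivalence of nets. -/
def NEq (N N' : Fin 3 → Matrix (Fin 4) (Fin 4) ℂ) : Prop :=
  ∃ T : Matrix (Fin 4) (Fin 4) ℂ, IsUnit T.det ∧ ∀ k, N' k = T * N k * Tᵀ

theorem NEq.refl (N) : NEq N N := ⟨1, by simp, fun k => by simp⟩

theorem NEq.symm {N N'} (h : NEq N N') : NEq N' N := by
  obtain ⟨T, hT, h⟩ := h
  have hst : IsUnit Tᵀ.det := by rwa [Matrix.det_transpose]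
  refine ⟨T⁻¹, Matrix.isUnit_nonsing_inv_det _ hT, fun k => ?_⟩
  rw [h, Matrix.transpose_nonsing_inv, Matrix.mul_assoc T, Matrix.nonsing_inv_mul_cancel_left _ _ hT,
    Matrix.mul_nonsing_inv_cancel_right _ _ hst]

theorem NEq.trans {N N' N''} (h : NEq N N') (h' : NEq N' N'') : NEq N N'' := by
  obtain ⟨T, hT, h⟩ := h
  obtain ⟨T', hT', h'⟩ := h'
  refine ⟨T' * T, by rw [Matrix.det_mul]; exact hT'.mul hT, fun k => ?_⟩
  rw [h', h, Matrix.transpose_mul]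
  simp only [Matrix.mul_assoc]

/-- The setoid of exact representations. -/
def repSetoid (F : (Fin 3 → ℂ) → ℂ) : Setoid {N // IsRep1 F N} where
  r a b := NEq a.1 b.1
  iseqv := ⟨fun a => NEq.refl a.1, NEq.symm, NEq.trans⟩

theorem bet_congr {N N' : Fin 3 → Matrix (Fin 4) (Fin 4) ℂ} {T : Matrix (Fin 4) (Fin 4) ℂ}
    (h : ∀ k, N' k = T * N k * Tᵀ) (u v : Fin 4 → ℂ) : bet N' u v = bet N (Tᵀ *ᵥ u) (Tᵀ *ᵥ v) := by
  funext k
  simp only [bet]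
  rw [h, Matrix.mulVec_mulVec, Matrix.dotProduct_mulVec, Matrix.dotProduct_mulVec, Matrix.mul_assoc,
    Matrix.mulVec_transpose T u, Matrix.vecMul_vecMul]

theorem BPF.congr {N N' : Fin 3 → Matrix (Fin 4) (Fin 4) ℂ} {T : Matrix (Fin 4) (Fin 4) ℂ} (hT : IsUnit T.det)
    (h : ∀ k, N' k = T * N k * Tᵀ) {u : Fin 4 → Fin 4 → ℂ} (hu : BPF N' u) : BPF N (fun i => Tᵀ *ᵥ u i) := by
  intro i j hij
  have hst : IsUnit Tᵀ := by rwa [Matrix.isUnit_iff_isUnit_det, Matrix.det_transpose]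
  have hh := hu i j hij
  refine ⟨?_, ?_, ?_⟩
  · have := hh.li.map' (Matrix.mulVecLin Tᵀ) (LinearMap.ker_eq_bot.2 (Matrix.mulVec_injective_iff_isUnit.2 hst))
    have e : (Matrix.mulVecLin Tᵀ) ∘ ![u i, u j] = ![Tᵀ *ᵥ u i, Tᵀ *ᵥ u j] := by
      funext k
      fin_cases k <;> rfl
    rw [e] at this
    exact this
  · rw [← bet_congr h]; exact hh.b1
  · rw [← bet_congr h]; exact hh.b2

/-- The order in which the six lines are listed. -/
def pr : Fin 6 → Fin 4 × Fin 4 := ![(0, 1), (2, 3), (0, 2), (1, 3), (0, 3), (1, 2)]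

theorem pr_ne (k : Fin 6) : (pr k).1 ≠ (pr k).2 := by
  revert k; decide

theorem pr_surj (i j : Fin 4) (h : i < j) : ∃ k, pr k = (i, j) := by
  revert i j; decide

section
variable {F : (Fin 3 → ℂ) → ℂ}

/-- The sextuple attached to a frame of base points. -/
noncomputable def sext {N} (h : IsRep F N) (hS : SmoothF F) {u : Fin 4 → Fin 4 → ℂ} (hu : BPF N u) :
    Fin 6 → Projectivization ℂ (Fin 3 → ℂ) :=
  fun k => cl (bet N (u (pr k).1) (u (pr k).2)) (h.bne hS (hu _ _ (pr_ne k)))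

theorem sext_InW {N} (h : IsRep F N) (hS : SmoothF F) {u : Fin 4 → Fin 4 → ℂ} (hu : BPF N u) :
    InW F (sext h hS hu) := by
  have li := h.R4 hS (hu 0 1 (by decide)) (hu 0 2 (by decide)) (hu 0 3 (by decide)) (hu 1 2 (by decide))
    (hu 1 3 (by decide)) (hu 2 3 (by decide))
  exact ⟨fun k => bet N (u (pr k).1) (u (pr k).2), fun k => h.bne hS (hu _ _ (pr_ne k)), fun k => rfl,
    h.gram0 li (hu.base 0) (hu.base 1) (hu.base 2) (hu.base 3)⟩

theorem sext_par {N N'} (h : IsRep F N) (h' : IsRep F N') (hS : SmoothF F) {u u' : Fin 4 → Fin 4 → ℂ} (hu : BPF N u)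
    (hu' : BPF N' u') (e : sext h hS hu = sext h' hS hu') {i j : Fin 4} (hij : i ≠ j) :
    Par (bet N (u i) (u j)) (bet N' (u' i) (u' j)) := by
  have key : ∀ i j, i < j → Par (bet N (u i) (u j)) (bet N' (u' i) (u' j)) := by
    intro i j hij
    obtain ⟨k, hk⟩ := pr_surj i j hij
    have := (cl_eq _ _).1 (congrFun e k)
    rwa [hk] at this
  rcases lt_or_gt_of_ne hij with hlt | hlt
  · exact key i j hlt
  · rw [bet_comm h.symm, bet_comm h'.symm]; exact key j i hlt

theorem Octad.bpf {N} {O : Fin 8 → Fin 4 → ℂ} (hO : Octad N O) (φ : Fin 4 ↪ Fin 8) : BPF N (fun i => O (φ i)) :=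
  fun _ _ hij => hO.bp _ _ (φ.injective.ne hij)

theorem emb_eq {N} (h : IsRep F N) (hS : SmoothF F) {O : Fin 8 → Fin 4 → ℂ} (hO : Octad N O) {φ ψ : Fin 4 ↪ Fin 8}
    (hp : ∀ i j, i ≠ j → Par (bet N (O (φ i)) (O (φ j))) (bet N (O (ψ i)) (O (ψ j)))) : φ = ψ := by
  have key : ∀ i j k, i ≠ j → i ≠ k → j ≠ k → φ i = ψ i := by
    intro i j k hij hik hjk
    rcases h.pair_inj hS hO (φ.injective.ne hij) (ψ.injective.ne hij) (hp i j hij) with h1 | h1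
    · exact h1.1
    rcases h.pair_inj hS hO (φ.injective.ne hik) (ψ.injective.ne hik) (hp i k hik) with h2 | h2
    · exact h2.1
    exact absurd (ψ.injective (h1.1.symm.trans h2.1)) hjk
  ext i
  have : ∃ j k, i ≠ j ∧ i ≠ k ∧ j ≠ k := by revert i; decide
  obtain ⟨j, k, h1, h2, h3⟩ := this
  rw [key i j k h1 h2 h3]

theorem card_reps (hS : SmoothF F) (hF : IsForm 4 F) : Nat.card (Quotient (repSetoid F)) = 36 := by
  have hr : ∀ ρ : Quotient (repSetoid F), IsRep F ρ.out.1 := fun ρ => ρ.out.2.isRep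
  choose O hO using fun ρ => (hr ρ).octad hS hF
  let Φ : Quotient (repSetoid F) × (Fin 4 ↪ Fin 8) → {w // InW F w} := fun x =>
    ⟨sext (hr x.1) hS ((hO x.1).bpf x.2), sext_InW _ _ _⟩
  have hΦ : Function.Bijective Φ := by
    constructor
    · rintro ⟨ρ, φ⟩ ⟨ρ', φ'⟩ e
      have e' : sext (hr ρ) hS ((hO ρ).bpf φ) = sext (hr ρ') hS ((hO ρ').bpf φ') := Subtype.ext_iff.1 e
      have hp := fun i j hij => sext_par (hr ρ) (hr ρ') hS ((hO ρ).bpf φ) ((hO ρ').bpf φ') e' (i := i) (j := j) hij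
      have hρ : ρ = ρ' := by
        rw [← Quotient.out_eq ρ, ← Quotient.out_eq ρ']
        exact Quotient.sound ((hr ρ).torus hS (hr ρ') ((hO ρ).bpf φ) ((hO ρ').bpf φ') (fun i j hij => hp i j hij.ne))
      subst hρ
      rw [emb_eq (hr ρ) hS (hO ρ) hp]
    · rintro ⟨w, m, hm, hw, κ, hκ, h⟩
      obtain ⟨N, u, hN, hu, h0, h1, h2, h3, h4, h5⟩ := rep_of_InW hκ h
      let ρ : Quotient (repSetoid F) := Quotient.mk (repSetoid F) ⟨N, hN⟩
      obtain ⟨T, hT, hTk⟩ : NEq ρ.out.1 N := Quotient.mk_out (s := repSetoid F) (⟨N, hN⟩ : {N // IsRep1 F N})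
      have hv := BPF.congr hT hTk hu
      have ex : ∀ i, ∃ j, Par (O ρ j) (Tᵀ *ᵥ u i) := by
        intro i
        obtain ⟨j, hj⟩ : ∃ j, i ≠ j := ⟨i + 1, by revert i; decide⟩
        exact (hO ρ).complete _ (hv i j hj).ne1 (hv i j hj).b1
      choose φ hφ using ex
      have hinj : Function.Injective φ := by
        intro i j e
        by_contra hij
        have := hφ j
        rw [← e] at this
        exact li_not_par (hv i j hij).li ((hφ i).symm.trans this)
      refine ⟨(ρ, ⟨φ, hinj⟩), Subtype.ext ?_⟩
      have hpar : ∀ i j, Par (bet N (u i) (u j)) (bet ρ.out.1 (O ρ (φ i)) (O ρ (φ j))) := by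
        intro i j
        rw [bet_congr hTk]
        exact par_bet (hφ i).symm (hφ j).symm
      have hmp : ∀ k, Par (m k) (bet N (u (pr k).1) (u (pr k).2)) := by
        intro k
        fin_cases k
        exacts [h0, h1, h2, h3, h4, h5]
      funext k
      refine Eq.trans ?_ (hw k)
      exact (cl_eq _ _).2 ((hmp k).trans (hpar _ _)).symm
  have hc := Nat.card_congr (Equiv.ofBijective Φ hΦ)
  rw [card_InW hS hF, Nat.card_prod, Nat.card_eq_fintype_card (α := Fin 4 ↪ Fin 8), Fintype.card_embedding_eq] at hc
  have : (Fintype.card (Fin 8)).descFactorial (Fintype.card (Fin 4)) = 1680 := by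
    simp [Nat.descFactorial]
  rw [this] at hc
  omega

theorem main_F (hS : SmoothF F) (hF : IsForm 4 F) : ∃ R : Fin 36 → Fin 3 → Matrix (Fin 4) (Fin 4) ℂ,
    (∀ k, IsRep1 F (R k)) ∧ (∀ k l, k ≠ l → ¬ NEq (R k) (R l)) ∧ (∀ N, IsRep1 F N → ∃ k, NEq (R k) N) := by
  have hc := card_reps hS hF
  have : Finite (Quotient (repSetoid F)) := Nat.finite_of_card_ne_zero (by rw [hc]; norm_num)
  have e : Fin 36 ≃ Quotient (repSetoid F) := (Finite.equivFinOfCardEq hc).symm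
  refine ⟨fun k => (e k).out.1, fun k => (e k).out.2, fun k l hkl h => hkl (e.injective ?_), fun N hN => ?_⟩
  · rw [← Quotient.out_eq (e k), ← Quotient.out_eq (e l)]
    exact Quotient.sound h
  · refine ⟨e.symm (Quotient.mk _ ⟨N, hN⟩), ?_⟩
    beta_reduce
    rw [e.apply_symm_apply]
    exact Quotient.mk_out (s := repSetoid F) (⟨N, hN⟩ : {N // IsRep1 F N})
end

theorem eval_pencil (A B C : Matrix (Fin 4) (Fin 4) ℂ) (X : Fin 3 → ℂ) :
    eval X (pencil A B C).det = (pen ![A, B, C] X).det := by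
  rw [RingHom.map_det]
  congr 1
  ext i j
  simp [pencil, pen, Fin.sum_univ_three]
  ring

theorem isLSDR_iff (f : MvPolynomial (Fin 3) ℝ) (A B C : Matrix (Fin 4) (Fin 4) ℂ) :
    IsLSDR f (A, B, C) ↔ IsRep1 (fun X => eval X (map (algebraMap ℝ ℂ) f)) ![A, B, C] := by
  constructor
  · rintro ⟨h1, h2, h3, h4⟩
    refine ⟨fun i => ?_, fun X => ?_⟩
    · fin_cases i
      exacts [h1, h2, h3]
    · rw [← eval_pencil, ← h4]
  · rintro ⟨h1, h2⟩
    refine ⟨h1 0, h1 1, h1 2, MvPolynomial.funext fun X => ?_⟩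
    rw [eval_pencil, ← h2]

theorem lsdrEquiv_iff (A B C A' B' C' : Matrix (Fin 4) (Fin 4) ℂ) :
    LSDREquiv (A, B, C) (A', B', C') ↔ NEq ![A, B, C] ![A', B', C'] := by
  constructor
  · rintro ⟨T, hT, h1, h2, h3⟩
    refine ⟨T, hT, fun k => ?_⟩
    fin_cases k
    exacts [h1, h2, h3]
  · rintro ⟨T, hT, h⟩
    exact ⟨T, hT, h 0, h 1, h 2⟩

theorem net_eta (N : Fin 3 → Matrix (Fin 4) (Fin 4) ℂ) : ![N 0, N 1, N 2] = N := by
  funext i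
  fin_cases i <;> rfl

/-- **Hesse (1855).** Every smooth ternary quartic has exactly 36 inequivalent
linear symmetric determinantal representations. -/
theorem smooth_quartic_has_36_determinantal_representations
    (f : MvPolynomial (Fin 3) ℝ) (hhom : f.IsHomogeneous 4) (hsm : IsSmooth f) :
    ∃ reps : Fin 36 → Matrix (Fin 4) (Fin 4) ℂ × Matrix (Fin 4) (Fin 4) ℂ ×
      Matrix (Fin 4) (Fin 4) ℂ,
      (∀ k, IsLSDR f (reps k)) ∧
      (∀ k l, k ≠ l → ¬ LSDREquiv (reps k) (reps l)) ∧
      (∀ t, IsLSDR f t → ∃ k, LSDREquiv (reps k) t) := by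
  have hF : IsForm 4 (fun X => eval X (map (algebraMap ℝ ℂ) f)) :=
    ⟨_, hhom.map _, fun X => rfl⟩
  have hS : SmoothF (fun X => eval X (map (algebraMap ℝ ℂ) f)) := by
    intro P hP a ha
    have : map (algebraMap ℝ ℂ) f = P := MvPolynomial.funext hP
    exact hsm a (by rw [this]; exact ha)
  obtain ⟨R, h1, h2, h3⟩ := main_F hS hF
  refine ⟨fun k => (R k 0, R k 1, R k 2), fun k => ?_, fun k l hkl h => h2 k l hkl ?_, ?_⟩
  · rw [isLSDR_iff, net_eta]
    exact h1 k
  · rwa [lsdrEquiv_iff, net_eta, net_eta] at h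
  · rintro ⟨A, B, C⟩ ht
    obtain ⟨k, hk⟩ := h3 _ ((isLSDR_iff f A B C).1 ht)
    refine ⟨k, ?_⟩
    rwa [lsdrEquiv_iff, net_eta]
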